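/- arXiv:1502.01202 — 3 statements merged into one kernel-verified Lean document; each statement's English description precedes it below -/
import Mathlib

section
/- Let α ∈ ℝ with |α| ∈ (0,1/2), let f(z) = ((z−1)/(z+1))^α be the holomorphic branch on ℂ∖[−1,1] with f(∞) = 1, and for each n let Q_{n,0}, Q_{n,1}, Q_{n,2} be type I Hermite–Padé polynomials of order n for (1, f, f²). Then, as n → ∞, the ratios Q_{n,1}(z)/Q_{n,2}(z) converge to −2cos(απ) f_0(z), and the ratios Q_{n,0}(z)/Q_{n,2}(z) converge to f_0(z)², in both cases locally uniformly on ℂ∖F. -/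
open Polynomial Filter Asymptotics Bornology Topology

/-- The polynomial with coefficients `a 0, …, a n`, as a function. -/
noncomputable def Sp (n : ℕ) (a : ℕ → ℝ) (y : ℂ) : ℂ :=
  ∑ j ∈ Finset.range (n + 1), (a j : ℂ) * y ^ j

/-- Positive coefficients, no zeros off the closed negative half-axis. -/
def ZF (n : ℕ) (a : ℕ → ℝ) : Prop :=
  (∀ j ≤ n, 0 < a j) ∧ ∀ v : ℂ, 0 < v.re → Sp n a (v ^ 2) ≠ 0

lemma exists_sq_or_neg (r : ℂ) : (∃ v : ℂ, 0 < v.re ∧ r = v ^ 2) ∨ ∃ b : ℝ, 0 ≤ b ∧ r = -(b : ℂ) := by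
  obtain ⟨v, hv⟩ := IsAlgClosed.exists_pow_nat_eq r (n := 2) (by norm_num)
  rcases lt_trichotomy v.re 0 with h | h | h
  · exact Or.inl ⟨-v, by simpa using h, by rw [← hv]; ring⟩
  · refine Or.inr ⟨v.im ^ 2, sq_nonneg _, ?_⟩
    rw [← hv]
    apply Complex.ext <;> simp [pow_two, h]
  · exact Or.inl ⟨v, h, hv.symm⟩

lemma ZF.factor {n : ℕ} {a : ℕ → ℝ} (h : ZF n a) :
    ∃ b : Fin n → ℝ, (∀ i, 0 ≤ b i) ∧ ∀ y, Sp n a y = a n * ∏ i, (y + b i) := by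
  set p : ℂ[X] := ∑ j ∈ Finset.range (n + 1), C (a j : ℂ) * X ^ j with hp
  have hev : ∀ y, p.eval y = Sp n a y := by
    intro y; simp [hp, Sp, eval_finsetSum]
  have hcoeff : ∀ m, p.coeff m = if m ≤ n then (a m : ℂ) else 0 := by
    intro m
    simp [hp, coeff_X_pow, Finset.sum_ite_eq]
  have han : (a n : ℂ) ≠ 0 := by exact_mod_cast (h.1 n le_rfl).ne'
  have hdeg : p.natDegree = n := by
    apply le_antisymm
    · rw [natDegree_le_iff_coeff_eq_zero]
      intro m hm
      rw [hcoeff, if_neg (by omega)]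
    · apply le_natDegree_of_ne_zero
      rw [hcoeff, if_pos le_rfl]; exact han
  have hlead : p.leadingCoeff = a n := by
    rw [leadingCoeff, hdeg, hcoeff, if_pos le_rfl]
  have hp0 : p ≠ 0 := by
    rw [← leadingCoeff_ne_zero, hlead]; exact han
  have hcard : p.roots.toList.length = n := by
    rw [Multiset.length_toList, ← hdeg]
    exact (IsAlgClosed.splits p).natDegree_eq_card_roots.symm
  have hroot : ∀ r ∈ p.roots.toList, ∃ b : ℝ, 0 ≤ b ∧ r = -(b : ℂ) := by
    intro r hr
    have hr' : p.IsRoot r := by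
      rw [Multiset.mem_toList, mem_roots hp0] at hr; exact hr
    rcases exists_sq_or_neg r with ⟨v, hv, rfl⟩ | h2
    · exact absurd (by rw [← hev]; exact hr') (h.2 v hv)
    · exact h2
  choose! B hB using hroot
  refine ⟨fun i => B (p.roots.toList.get (i.cast hcard.symm)), fun i => (hB _ (List.get_mem _ _)).1, ?_⟩
  intro y
  rw [← hev]
  have := (IsAlgClosed.splits p).eval_eq_prod_roots y
  rw [this, hlead]
  congr 1
  have e1 : (p.roots.map (fun r => y - r)).prod = (p.roots.toList.map (fun r => y - r)).prod := by
    conv_lhs => rw [← Multiset.coe_toList p.roots]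
    rw [Multiset.map_coe, Multiset.prod_coe]
  have key : ∀ l : List ℂ, ∀ hl : l.length = n, (l.map (fun r => y - r)).prod =
      ∏ i : Fin n, (y - l.get (i.cast hl.symm)) := by
    rintro l rfl
    rw [← List.prod_ofFn]
    congr 1
    apply List.ext_get <;> simp
  rw [e1, key _ hcard]
  apply Finset.prod_congr rfl
  intro i _
  have := (hB _ (List.get_mem p.roots.toList (i.cast hcard.symm))).2
  rw [sub_eq_add_neg]
  conv_lhs => rw [this]
  rw [neg_neg]

lemma Sp_theta (n : ℕ) (a : ℕ → ℝ) (y : ℂ) :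
    HasDerivAt (Sp n a) (∑ j ∈ Finset.range (n + 1), (a j : ℂ) * (j * y ^ (j - 1))) y := by
  unfold Sp
  apply HasDerivAt.fun_sum
  intro j _
  exact (hasDerivAt_pow j y).const_mul _

lemma Sp_theta_factor {n : ℕ} {a : ℕ → ℝ} {b : Fin n → ℝ}
    (hb : ∀ y, Sp n a y = a n * ∏ i, (y + b i)) {y : ℂ} (hy : ∀ i, y + b i ≠ 0) :
    Sp n (fun j => j * a j) y = Sp n a y * ∑ i, y / (y + b i) := by
  have h1 := Sp_theta n a y
  have h2 : HasDerivAt (Sp n a) (a n * ∑ i, (∏ j ∈ Finset.univ.erase i, (y + b j)) • (1:ℂ)) y := by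
    have : Sp n a = fun y : ℂ => (a n : ℂ) * ∏ i, (y + (b i : ℂ)) := funext hb
    rw [this]
    apply HasDerivAt.const_mul
    apply HasDerivAt.fun_finsetProd
    intro i _
    exact (hasDerivAt_id y).add_const _
  have h3 := h1.unique h2
  have h4 : Sp n (fun j => j * a j) y = y * ∑ j ∈ Finset.range (n + 1), (a j : ℂ) * (j * y ^ (j - 1)) := by
    unfold Sp
    rw [Finset.mul_sum]
    apply Finset.sum_congr rfl
    intro j _
    rcases j with _ | j
    · simp
    · simp [pow_succ]; ring
  rw [h4, h3, hb, Finset.mul_sum, Finset.mul_sum, Finset.mul_sum]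
  apply Finset.sum_congr rfl
  intro i hi
  rw [← Finset.mul_prod_erase Finset.univ _ hi]
  have := hy i
  field_simp
  simp

lemma v_add_ne {v : ℂ} (hv : 0 < v.re) {b : ℝ} (hb : 0 ≤ b) : v ^ 2 + b ≠ 0 := by
  intro h
  have h1 := congrArg Complex.re h
  have h2 := congrArg Complex.im h
  simp [pow_two] at h1 h2
  have : v.im = 0 := by nlinarith
  rw [this] at h1
  nlinarith

lemma re_aux1 {v : ℂ} (hv : 0 < v.re) {b : ℝ} (hb : 0 ≤ b) :
    0 ≤ (v⁻¹ * (v ^ 2 / (v ^ 2 + b))).re := by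
  have h0 : v ≠ 0 := by rintro rfl; simp at hv
  have : v⁻¹ * (v ^ 2 / (v ^ 2 + b)) = v / (v ^ 2 + b) := by field_simp
  rw [this, Complex.div_re]
  have h1 : 0 ≤ Complex.normSq (v ^ 2 + b) := Complex.normSq_nonneg _
  rw [← add_div]
  apply div_nonneg _ h1
  simp [pow_two]
  have : v.re * (v.re * v.re - v.im * v.im + b) + v.im * (v.re * v.im + v.im * v.re)
    = v.re * (v.re ^ 2 + v.im ^ 2 + b) := by ring
  rw [this]; positivity

lemma re_aux2 {v : ℂ} (hv : 0 < v.re) {b : ℝ} (hb : 0 ≤ b) :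
    0 ≤ (v * (b / (v ^ 2 + b))).re := by
  have : v * (b / (v ^ 2 + b)) = b * (v / (v ^ 2 + b)) := by ring
  rw [this, Complex.re_ofReal_mul]
  apply mul_nonneg hb
  have := re_aux1 hv hb
  have h0 : v ≠ 0 := by rintro rfl; simp at hv
  have h2 : v⁻¹ * (v ^ 2 / (v ^ 2 + b)) = v / (v ^ 2 + b) := by field_simp
  rwa [h2] at this

lemma ZF.mul_add {n : ℕ} {a : ℕ → ℝ} (h : ZF n a) {c : ℝ} (hc : 0 < c) :
    ZF n (fun j => (j + c) * a j) := by
  refine ⟨fun j hj => mul_pos (by positivity) (h.1 j hj), fun v hv => ?_⟩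
  obtain ⟨b, hb0, hb⟩ := h.factor
  have h1 := Sp_theta_factor hb (y := v ^ 2) (fun i => v_add_ne hv (hb0 i))
  have h2 : Sp n (fun j => (j + c) * a j) (v ^ 2) = Sp n (fun j => j * a j) (v ^ 2) + c * Sp n a (v ^ 2) := by
    unfold Sp
    rw [Finset.mul_sum, ← Finset.sum_add_distrib]
    apply Finset.sum_congr rfl
    intro j _
    push_cast; ring
  rw [h2, h1, mul_comm (c : ℂ), ← _root_.mul_add]
  refine mul_ne_zero (h.2 v hv) fun h3 => ?_
  have h0 : v ≠ 0 := by rintro rfl; simp at hv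
  have h4 : (v⁻¹ * (∑ i, v ^ 2 / (v ^ 2 + b i) + c)).re = 0 := by rw [h3]; simp
  rw [_root_.mul_add, Finset.mul_sum, Complex.add_re, Complex.re_sum, mul_comm, Complex.re_ofReal_mul] at h4
  have h5 : 0 ≤ ∑ i, (v⁻¹ * (v ^ 2 / (v ^ 2 + b i))).re := Finset.sum_nonneg fun i _ => re_aux1 hv (hb0 i)
  have h6 : 0 < (v⁻¹).re := by
    rw [Complex.inv_re]; exact div_pos hv (Complex.normSq_pos.mpr h0)
  nlinarith [mul_pos hc h6]

lemma ZF.mul_sub {n : ℕ} {a : ℕ → ℝ} (h : ZF n a) {c : ℝ} (hc : 0 < c) :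
    ZF n (fun j => ((n - j : ℝ) + c) * a j) := by
  refine ⟨fun j hj => mul_pos (by have : (j:ℝ) ≤ n := by exact_mod_cast hj
                                  linarith) (h.1 j hj), fun v hv => ?_⟩
  obtain ⟨b, hb0, hb⟩ := h.factor
  have hne := (fun i => v_add_ne hv (hb0 i))
  have h1 := Sp_theta_factor hb (y := v ^ 2) hne
  have h2 : Sp n (fun j => ((n - j : ℝ) + c) * a j) (v ^ 2) = (n + c) * Sp n a (v ^ 2) - Sp n (fun j => j * a j) (v ^ 2) := by
    unfold Sp
    rw [Finset.mul_sum, ← Finset.sum_sub_distrib]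
    apply Finset.sum_congr rfl
    intro j _
    push_cast; ring
  rw [h2, h1, mul_comm (n + c : ℂ), ← _root_.mul_sub]
  refine mul_ne_zero (h.2 v hv) fun h3 => ?_
  have h7 : (n : ℂ) + c - ∑ i, v ^ 2 / (v ^ 2 + b i) = ∑ i, b i / (v ^ 2 + b i) + c := by
    have : ∑ i, (b i / (v ^ 2 + b i) : ℂ) = ∑ i, (1 - v ^ 2 / (v ^ 2 + b i)) := by
      apply Finset.sum_congr rfl
      intro i _
      have := hne i
      field_simp; ring
    rw [this, Finset.sum_sub_distrib]
    simp; ring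
  rw [h7] at h3
  have h4 : (v * (∑ i, b i / (v ^ 2 + b i) + c)).re = 0 := by rw [h3]; simp
  rw [_root_.mul_add, Finset.mul_sum, Complex.add_re, Complex.re_sum, mul_comm, Complex.re_ofReal_mul] at h4
  have h5 : 0 ≤ ∑ i, (v * (b i / (v ^ 2 + b i))).re := Finset.sum_nonneg fun i _ => re_aux2 hv (hb0 i)
  nlinarith [mul_pos hc hv]

/-- The coordinate on the unit disc. -/
noncomputable def Vf (ζ : ℂ) : ℂ := (1 + ζ) / (1 - ζ)

lemma one_sub_ne {ζ : ℂ} (h : ‖ζ‖ < 1) : 1 - ζ ≠ 0 := by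
  intro h'
  have : ζ = 1 := by linear_combination -h'
  rw [this] at h; simp at h

lemma one_add_ne {ζ : ℂ} (h : ‖ζ‖ < 1) : 1 + ζ ≠ 0 := by
  intro h'
  have : ζ = -1 := by linear_combination h'
  rw [this] at h; simp at h

lemma Vf_re {ζ : ℂ} (h : ‖ζ‖ < 1) : 0 < (Vf ζ).re := by
  have h1 := one_sub_ne h
  rw [Vf, Complex.div_re, ← add_div]
  apply div_pos _ (Complex.normSq_pos.mpr h1)
  have h2 : ‖ζ‖ ^ 2 < 1 := by nlinarith [norm_nonneg ζ]
  rw [← Complex.normSq_eq_norm_sq, Complex.normSq_apply] at h2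
  simp
  nlinarith

lemma Vf_surj {v : ℂ} (h : 0 < v.re) : ∃ ζ : ℂ, ‖ζ‖ < 1 ∧ Vf ζ = v := by
  have h1 : v + 1 ≠ 0 := by
    intro h'
    have := congrArg Complex.re h'
    simp at this; linarith
  refine ⟨(v - 1) / (v + 1), ?_, ?_⟩
  · rw [norm_div, div_lt_one (norm_pos_iff.mpr h1)]
    apply lt_of_pow_lt_pow_left₀ 2 (norm_nonneg _)
    rw [← Complex.normSq_eq_norm_sq, ← Complex.normSq_eq_norm_sq, Complex.normSq_apply, Complex.normSq_apply]
    simp; nlinarith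
  · unfold Vf
    have h3 : 1 + (v - 1) / (v + 1) = 2 * v / (v + 1) := by field_simp; ring
    have h4 : 1 - (v - 1) / (v + 1) = 2 / (v + 1) := by field_simp; ring
    rw [h3, h4]; field_simp

/-- The comparison constant. -/
noncomputable def qf (r : ℝ) : ℝ := ((1 - r) / (1 + r)) ^ 2

lemma qf_pos {r : ℝ} (h0 : 0 ≤ r) (h1 : r < 1) : 0 < qf r := by
  unfold qf
  have : 0 < 1 - r := by linarith
  positivity

lemma prod_form {ζ : ℂ} (h : ‖ζ‖ < 1) {b : ℝ} (hb : 0 ≤ b) :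
    (Vf ζ) ^ 2 + b = (((1 + ζ) + Complex.I * (√b : ℝ) * (1 - ζ)) * ((1 + ζ) - Complex.I * (√b : ℝ) * (1 - ζ))) / (1 - ζ) ^ 2 := by
  have h1 := one_sub_ne h
  have hs : ((√b : ℝ) : ℂ) ^ 2 = b := by exact_mod_cast Real.sq_sqrt hb
  unfold Vf
  field_simp
  ring_nf
  rw [hs, Complex.I_sq]
  ring

lemma fac_bd {ζ : ℂ} {r : ℝ} (hr : ‖ζ‖ ≤ r) (s : ℝ) :
    √(1 + s ^ 2) * (1 - r) ≤ ‖(1 + ζ) + Complex.I * s * (1 - ζ)‖ ∧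
    ‖(1 + ζ) + Complex.I * s * (1 - ζ)‖ ≤ √(1 + s ^ 2) * (1 + r) := by
  have e : (1 + ζ) + Complex.I * s * (1 - ζ) = (1 + Complex.I * s) + ζ * (1 - Complex.I * s) := by ring
  have n1 : ‖(1 + Complex.I * s : ℂ)‖ = √(1 + s ^ 2) := by
    rw [Complex.norm_def, Complex.normSq_apply]; simp; ring_nf
  have n2 : ‖(1 - Complex.I * s : ℂ)‖ = √(1 + s ^ 2) := by
    rw [Complex.norm_def, Complex.normSq_apply]; simp; ring_nf
  rw [e]
  have hs := Real.sqrt_nonneg (1 + s ^ 2)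
  have n3 : ‖ζ * (1 - Complex.I * s)‖ ≤ r * √(1 + s ^ 2) := by
    rw [norm_mul, n2]; gcongr
  constructor
  · have := norm_sub_norm_le (1 + Complex.I * s : ℂ) (-(ζ * (1 - Complex.I * s)))
    rw [norm_neg, sub_neg_eq_add, n1] at this
    nlinarith
  · have := norm_add_le (1 + Complex.I * s : ℂ) ((ζ * (1 - Complex.I * s)))
    rw [n1] at this
    nlinarith

lemma root_bd {ζ : ℂ} {r : ℝ} (hr : ‖ζ‖ ≤ r) (hr1 : r < 1) {b : ℝ} (hb : 0 ≤ b) :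
    qf r * (1 + b) ≤ ‖(Vf ζ) ^ 2 + b‖ ∧ ‖(Vf ζ) ^ 2 + b‖ ≤ (qf r)⁻¹ * (1 + b) := by
  have hz : ‖ζ‖ < 1 := hr.trans_lt hr1
  have hr0 : 0 ≤ r := (norm_nonneg _).trans hr
  rw [prod_form hz hb, norm_div, norm_mul, norm_pow]
  have h1 := fac_bd hr √b
  have h2 := fac_bd hr (-√b)
  have e : (1 + ζ) - Complex.I * (√b : ℝ) * (1 - ζ) = (1 + ζ) + Complex.I * (-√b : ℝ) * (1 - ζ) := by
    push_cast; ring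
  rw [e]
  have hsq : √b ^ 2 = b := Real.sq_sqrt hb
  rw [neg_sq] at h2
  rw [hsq] at h1 h2
  have hs1 : √(1 + b) ^ 2 = 1 + b := Real.sq_sqrt (by linarith)
  have hs0 := Real.sqrt_nonneg (1 + b)
  set A := ‖(1 + ζ) + Complex.I * (√b : ℝ) * (1 - ζ)‖
  set B := ‖(1 + ζ) + Complex.I * (-√b : ℝ) * (1 - ζ)‖
  set s := √(1 + b)
  have hd1 : 1 - r ≤ ‖1 - ζ‖ := by
    have := norm_sub_norm_le (1 : ℂ) ζ
    simp at this; linarith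
  have hd2 : ‖1 - ζ‖ ≤ 1 + r := by
    have := norm_sub_le (1 : ℂ) ζ
    simp at this; linarith
  set D := ‖1 - ζ‖
  have hr2 : 0 < 1 - r := by linarith
  have hDpos : 0 < D := by linarith
  have hab1 : (s * (1 - r)) * (s * (1 - r)) ≤ A * B := mul_le_mul h1.1 h2.1 (by positivity) (by positivity)
  have hab2 : A * B ≤ (s * (1 + r)) * (s * (1 + r)) := mul_le_mul h1.2 h2.2 (by positivity) (by positivity)
  have hD1 : (1 - r) ^ 2 ≤ D ^ 2 := by gcongr
  have hD2 : D ^ 2 ≤ (1 + r) ^ 2 := by gcongr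
  unfold qf
  constructor
  · rw [le_div_iff₀ (by positivity), div_pow, ← hs1, div_mul_eq_mul_div, div_mul_eq_mul_div, div_le_iff₀ (by positivity)]
    calc (1 - r) ^ 2 * s ^ 2 * D ^ 2 ≤ (1 - r) ^ 2 * s ^ 2 * (1 + r) ^ 2 := by gcongr
      _ = (s * (1 - r)) * (s * (1 - r)) * (1 + r) ^ 2 := by ring
      _ ≤ _ := by gcongr
  · rw [div_le_iff₀ (by positivity), div_pow, ← hs1, inv_div, div_mul_eq_mul_div, div_mul_eq_mul_div, le_div_iff₀ (by positivity)]
    calc A * B * (1 - r) ^ 2 ≤ (s * (1 + r)) * (s * (1 + r)) * (1 - r) ^ 2 := by gcongr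
      _ = (1 + r) ^ 2 * s ^ 2 * (1 - r) ^ 2 := by ring
      _ ≤ _ := by gcongr

lemma Sp_one_eq (n : ℕ) (a : ℕ → ℝ) : Sp n a 1 = ((∑ j ∈ Finset.range (n + 1), a j : ℝ) : ℂ) := by
  unfold Sp; simp

lemma ZF.lower {n : ℕ} {a : ℕ → ℝ} (h : ZF n a) {ζ : ℂ} {r : ℝ} (hr : ‖ζ‖ ≤ r) (hr1 : r < 1) :
    qf r ^ n * ∑ j ∈ Finset.range (n + 1), a j ≤ ‖Sp n a (Vf ζ ^ 2)‖ := by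
  obtain ⟨b, hb0, hb⟩ := h.factor
  have hr0 : 0 ≤ r := (norm_nonneg _).trans hr
  have h1 : (∑ j ∈ Finset.range (n + 1), a j) = a n * ∏ i, (1 + b i) := by
    have := hb 1
    rw [Sp_one_eq] at this
    exact_mod_cast this
  have han := h.1 n le_rfl
  rw [h1, hb, norm_mul, norm_prod, Complex.norm_of_nonneg han.le]
  calc qf r ^ n * (a n * ∏ i, (1 + b i)) = a n * ∏ i, (qf r * (1 + b i)) := by
        rw [Finset.prod_mul_distrib]; simp; ring
    _ ≤ _ := by
        gcongr with i
        · intro i _; have := qf_pos hr0 hr1; have := hb0 i; positivity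
        · exact (root_bd hr hr1 (hb0 i)).1

lemma ZF.lim {n : ℕ} {A : ℕ → ℕ → ℝ} {a : ℕ → ℝ} (h : ∀ N, ZF n (A N)) (ha : ∀ j ≤ n, 0 < a j)
    (hA : ∀ j ≤ n, Tendsto (fun N => A N j) atTop (𝓝 (a j))) : ZF n a := by
  refine ⟨ha, fun v hv => ?_⟩
  obtain ⟨ζ, hζ, rfl⟩ := Vf_surj hv
  have h1 : Tendsto (fun N => qf ‖ζ‖ ^ n * ∑ j ∈ Finset.range (n + 1), A N j) atTop
      (𝓝 (qf ‖ζ‖ ^ n * ∑ j ∈ Finset.range (n + 1), a j)) := by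
    apply Tendsto.const_mul
    apply tendsto_finsetSum
    intro j hj
    exact hA j (Nat.lt_succ_iff.mp (Finset.mem_range.mp hj))
  have h2 : Tendsto (fun N => ‖Sp n (A N) (Vf ζ ^ 2)‖) atTop (𝓝 ‖Sp n a (Vf ζ ^ 2)‖) := by
    apply Tendsto.norm
    apply tendsto_finsetSum
    intro j hj
    apply Tendsto.mul_const
    exact (Complex.continuous_ofReal.tendsto _).comp (hA j (Nat.lt_succ_iff.mp (Finset.mem_range.mp hj)))
  have h3 := le_of_tendsto_of_tendsto' h1 h2 (fun N => (h N).lower le_rfl hζ)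
  have h4 : 0 < qf ‖ζ‖ ^ n * ∑ j ∈ Finset.range (n + 1), a j := by
    apply mul_pos (pow_pos (qf_pos (norm_nonneg _) hζ) _)
    apply Finset.sum_pos
    · intro j hj; exact ha j (Nat.lt_succ_iff.mp (Finset.mem_range.mp hj))
    · simp
  exact norm_pos_iff.mp (h4.trans_le h3)

lemma ZF.congr {n : ℕ} {a a' : ℕ → ℝ} (h : ZF n a) (he : ∀ j ≤ n, a j = a' j) : ZF n a' := by
  refine ⟨fun j hj => he j hj ▸ h.1 j hj, fun v hv => ?_⟩
  have : Sp n a' (v ^ 2) = Sp n a (v ^ 2) := by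
    unfold Sp
    apply Finset.sum_congr rfl
    intro j hj
    rw [he j (Nat.lt_succ_iff.mp (Finset.mem_range.mp hj))]
  rw [this]; exact h.2 v hv

lemma ZF.const_mul {n : ℕ} {a : ℕ → ℝ} (h : ZF n a) {c : ℝ} (hc : 0 < c) : ZF n (fun j => c * a j) := by
  refine ⟨fun j hj => mul_pos hc (h.1 j hj), fun v hv => ?_⟩
  have : Sp n (fun j => c * a j) (v ^ 2) = c * Sp n a (v ^ 2) := by
    unfold Sp
    rw [Finset.mul_sum]
    apply Finset.sum_congr rfl
    intro j hj
    push_cast; ring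
  rw [this]
  exact mul_ne_zero (by exact_mod_cast hc.ne') (h.2 v hv)

lemma ZF_choose (n : ℕ) : ZF n (fun j => (n.choose j : ℝ)) := by
  refine ⟨fun j hj => Nat.cast_pos.mpr (Nat.choose_pos hj), fun v hv => ?_⟩
  have : Sp n (fun j => (n.choose j : ℝ)) (v ^ 2) = (v ^ 2 + 1) ^ n := by
    rw [add_pow]
    unfold Sp
    apply Finset.sum_congr rfl
    intro j _
    simp; ring
  rw [this]
  apply pow_ne_zero
  have := v_add_ne hv zero_le_one
  simpa using this

/-- The denominators. -/
noncomputable def mu (n : ℕ) (β : ℝ) (j : ℕ) : ℝ :=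
  (∏ i ∈ Finset.range j, ((i : ℝ) + 1 + β)) * ∏ i ∈ Finset.range (n - j), ((i : ℝ) + 1 - β)

lemma mu_pos (n : ℕ) {β : ℝ} (hβ : |β| < 1) (j : ℕ) : 0 < mu n β j := by
  have := abs_lt.mp hβ
  unfold mu
  apply mul_pos <;> apply Finset.prod_pos <;> intro i _ <;>
  · have : (0 : ℝ) ≤ i := Nat.cast_nonneg i
    linarith

lemma ZF.fin_mul {n : ℕ} {a : ℕ → ℝ} (h : ZF n a) {β : ℝ} (hβ : |β| < 1) (N : ℕ) :
    ZF n (fun j => (∏ i ∈ Finset.range N, (((j + i : ℕ) : ℝ) + 1 + β)) *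
      (∏ i ∈ Finset.range N, (((n - j + i : ℕ) : ℝ) + 1 - β)) * a j) := by
  have hb := abs_lt.mp hβ
  induction N with
  | zero => simpa using h
  | succ N ih =>
    have hN : (0 : ℝ) ≤ N := Nat.cast_nonneg N
    have := (ih.mul_add (c := N + 1 + β) (by linarith)).mul_sub (c := N + 1 - β) (by linarith)
    apply this.congr
    intro j hj
    rw [Finset.prod_range_succ, Finset.prod_range_succ]
    push_cast [Nat.cast_sub hj]
    ring

lemma prod_shift (N j : ℕ) (F : ℕ → ℝ) :
    (∏ i ∈ Finset.range j, F i) * ∏ i ∈ Finset.range N, F (j + i) =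
    (∏ i ∈ Finset.range N, F i) * ∏ i ∈ Finset.range j, F (N + i) := by
  rw [← Finset.prod_range_add, ← Finset.prod_range_add, add_comm]

lemma prod_lim (j : ℕ) (β : ℝ) :
    Tendsto (fun N : ℕ => ∏ i ∈ Finset.range j, ((((N + i : ℕ) : ℝ) + 1 + β) / (N + 1))) atTop (𝓝 1) := by
  have : 𝓝 (1 : ℝ) = 𝓝 (∏ i ∈ Finset.range j, 1) := by simp
  rw [this]
  apply tendsto_finsetProd
  intro i _
  have h1 : Tendsto (fun N : ℕ => 1 + (i + β) / ((N : ℝ) + 1)) atTop (𝓝 (1 + 0)) := by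
    apply Tendsto.const_add
    apply Tendsto.const_div_atTop
    exact tendsto_atTop_add_const_right _ _ tendsto_natCast_atTop_atTop
  rw [add_zero] at h1
  refine h1.congr fun N => ?_
  have : ((N : ℝ) + 1) ≠ 0 := by positivity
  push_cast
  field_simp
  ring

lemma ZF.div_mu {n : ℕ} {a : ℕ → ℝ} (h : ZF n a) {β : ℝ} (hβ : |β| < 1) :
    ZF n (fun j => a j / mu n β j) := by
  have hb := abs_lt.mp hβ
  set c : ℕ → ℝ := fun N => ((∏ i ∈ Finset.range N, ((i : ℝ) + 1 + β)) *
    (∏ i ∈ Finset.range N, ((i : ℝ) + 1 - β)) * ((N : ℝ) + 1) ^ n)⁻¹ with hc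
  have hp1 : ∀ N, 0 < ∏ i ∈ Finset.range N, ((i : ℝ) + 1 + β) := fun N =>
    Finset.prod_pos fun i _ => by have : (0 : ℝ) ≤ i := Nat.cast_nonneg i
                                  linarith
  have hp2 : ∀ N, 0 < ∏ i ∈ Finset.range N, ((i : ℝ) + 1 - β) := fun N =>
    Finset.prod_pos fun i _ => by have : (0 : ℝ) ≤ i := Nat.cast_nonneg i
                                  linarith
  have hcpos : ∀ N, 0 < c N := fun N => by
    have := hp1 N; have := hp2 N
    simp only [hc]; positivity
  refine ZF.lim (fun N => (h.fin_mul hβ N).const_mul (hcpos N)) (fun j hj => div_pos (h.1 j hj) (mu_pos n hβ j)) ?_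
  intro j hj
  have h1 := ((prod_lim j β).mul (prod_lim (n - j) (-β))).const_mul (a j / mu n β j)
  rw [mul_one, mul_one] at h1
  refine h1.congr fun N => ?_
  have e1 := prod_shift N j (fun i => (i : ℝ) + 1 + β)
  have e2 := prod_shift N (n - j) (fun i => (i : ℝ) + 1 - β)
  rw [Finset.prod_div_distrib, Finset.prod_div_distrib]
  simp only [Finset.prod_const, Finset.card_range, ← sub_eq_add_neg]
  have e3 : ((N : ℝ) + 1) ^ n = ((N : ℝ) + 1) ^ j * ((N : ℝ) + 1) ^ (n - j) := by
    rw [← pow_add]; congr 1; omega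
  have q1 := hp1 N; have q2 := hp2 N; have q3 := hp1 j; have q4 := hp2 (n - j)
  simp only [hc, mu, e3]
  have q5 : (0 : ℝ) < (N : ℝ) + 1 := by positivity
  rw [div_mul_div_comm, div_mul_div_comm, inv_mul_eq_div, div_eq_div_iff (by positivity) (by positivity)]
  linear_combination (-(a j) * ((N : ℝ) + 1) ^ j * ((N : ℝ) + 1) ^ (n - j)) * 
    (e1 * ((∏ i ∈ Finset.range N, ((i : ℝ) + 1 - β)) * ∏ i ∈ Finset.range (n-j), (((N + i : ℕ) : ℝ) + 1 - β)) + 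
    ((∏ i ∈ Finset.range j, ((i : ℝ) + 1 + β)) * ∏ i ∈ Finset.range N, (((j + i : ℕ) : ℝ) + 1 + β)) * e2)

lemma mu_zero (n : ℕ) (j : ℕ) : mu n 0 j = (j.factorial : ℝ) * (n - j).factorial := by
  unfold mu
  simp only [add_zero, sub_zero]
  rw [← Finset.prod_range_add_one_eq_factorial, ← Finset.prod_range_add_one_eq_factorial]
  push_cast
  rfl

lemma ZF_inv_mu_zero (n : ℕ) : ZF n (fun j => 1 / mu n 0 j) := by
  have := (ZF_choose n).const_mul (c := 1 / (n.factorial : ℝ)) (by positivity)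
  apply this.congr
  intro j hj
  rw [mu_zero, Nat.cast_choose ℝ hj]
  have : (n.factorial : ℝ) ≠ 0 := by positivity
  field_simp

/-- One step of Vitali: bound for the divided slope. -/
lemma dslope_bd {F : ℂ → ℂ} {R C : ℝ} (hR : 0 < R) (hF : DifferentiableOn ℂ F (Metric.ball 0 1)) (hR1 : R < 1)
    {η : ℝ} (hC : ∀ ζ, ‖ζ‖ ≤ R → ‖F ζ‖ ≤ C) (h0 : ‖F 0‖ ≤ η) :
    ∀ ζ, ‖ζ‖ ≤ R → ‖dslope F 0 ζ‖ ≤ (C + η) / R := by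
  intro ζ hζ
  have hd : DifferentiableOn ℂ (dslope F 0) (Metric.ball 0 1) :=
    (Complex.differentiableOn_dslope (Metric.ball_mem_nhds _ one_pos)).mpr hF
  have hsub : Metric.closedBall (0 : ℂ) R ⊆ Metric.ball 0 1 := Metric.closedBall_subset_ball hR1
  refine Complex.norm_le_of_forall_mem_frontier_norm_le (U := Metric.ball 0 R) Metric.isBounded_ball ?_ ?_ ?_
  · apply DifferentiableOn.diffContOnCl
    rw [closure_ball _ hR.ne']
    exact hd.mono hsub
  · intro z hz
    rw [frontier_ball _ hR.ne', mem_sphere_zero_iff_norm] at hz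
    have hz0 : z ≠ 0 := by rintro rfl; simp at hz; linarith
    rw [dslope_of_ne _ hz0, slope_def_field, sub_zero, norm_div, hz]
    gcongr
    exact (norm_sub_le _ _).trans (add_le_add (hC z hz.le) h0)
  · rw [closure_ball _ hR.ne']; simpa using hζ

lemma vitali_zero {F : ℕ → ℂ → ℂ} {R C : ℝ} (hR : 0 < R) (hR1 : R < 1)
    (hF : ∀ n, DifferentiableOn ℂ (F n) (Metric.ball 0 1))
    (hC : ∀ᶠ n in atTop, ∀ ζ, ‖ζ‖ ≤ R → ‖F n ζ‖ ≤ C)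
    (ht : ∀ t : ℝ, 0 < t → t < R → Tendsto (fun n => F n t) atTop (𝓝 0)) {η : ℝ} (hη : 0 < η) :
    ∀ᶠ n in atTop, ‖F n 0‖ ≤ η := by
  have hC0 : 0 ≤ C := by
    obtain ⟨n, hn⟩ := hC.exists
    exact (norm_nonneg _).trans (hn 0 (by simpa using hR.le))
  set t : ℝ := min (R / 2) (η * R / (4 * (C + 1))) with htdef
  have ht0 : 0 < t := by
    apply lt_min <;> positivity
  have htR : t < R := (min_le_left _ _).trans_lt (by linarith)
  have ht2 : t * (4 * (C + 1)) ≤ η * R := by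
    rw [← le_div_iff₀ (by positivity)]; exact min_le_right _ _
  have h1 : ∀ᶠ n in atTop, ‖F n t‖ < η / 2 := by
    have := (ht t ht0 htR).norm
    rw [norm_zero] at this
    exact this.eventually (gt_mem_nhds (by positivity))
  filter_upwards [hC, h1] with n hn hn1
  have h2 := dslope_bd hR (hF n) hR1 hn (hn 0 (by simpa using hR.le)) (t : ℂ) (by simpa [abs_of_pos ht0] using htR.le)
  have ht' : (t : ℂ) ≠ 0 := by exact_mod_cast ht0.ne'
  have h3 : F n 0 = F n t - t * dslope (F n) 0 t := by
    have := sub_smul_dslope (F n) 0 (t : ℂ)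
    simp only [sub_zero, smul_eq_mul] at this
    rw [this]; ring
  rw [h3]
  refine (norm_sub_le _ _).trans ?_
  rw [norm_mul, Complex.norm_real, Real.norm_of_nonneg ht0.le]
  have h4 : t * ‖dslope (F n) 0 t‖ ≤ t * ((C + C) / R) := by gcongr
  have h5 : t * ((C + C) / R) ≤ η / 2 := by
    rw [← mul_div_assoc, div_le_iff₀ hR]
    nlinarith
  linarith

lemma vitali_aux {r R : ℝ} (hr : 0 < r) (hrR : r < R) (hR1 : R < 1) (m : ℕ) :
    ∀ {F : ℕ → ℂ → ℂ} {C : ℝ}, (∀ n, DifferentiableOn ℂ (F n) (Metric.ball 0 1)) →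
    (∀ᶠ n in atTop, ∀ ζ, ‖ζ‖ ≤ R → ‖F n ζ‖ ≤ C) →
    (∀ t : ℝ, 0 < t → t < R → Tendsto (fun n => F n t) atTop (𝓝 0)) →
    ∀ ε > 0, ∀ᶠ n in atTop, ∀ ζ, ‖ζ‖ ≤ r → ‖F n ζ‖ ≤ (r / R) ^ m * C + ε := by
  have hR : 0 < R := hr.trans hrR
  induction m with
  | zero =>
    intro F C hF hC ht ε hε
    filter_upwards [hC] with n hn ζ hζ
    have := hn ζ (hζ.trans hrR.le)
    simp; linarith
  | succ m ih =>
    intro F C hF hC ht ε hε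
    set η : ℝ := ε * R / 4 with hη
    have hη0 : 0 < η := by positivity
    have h0 := vitali_zero hR hR1 hF hC ht hη0
    have h0t : Tendsto (fun n => F n 0) atTop (𝓝 0) := by
      rw [Metric.tendsto_nhds]
      intro e he
      filter_upwards [vitali_zero hR hR1 hF hC ht (half_pos he)] with n hn
      rw [dist_zero_right]; linarith
    have hG := ih (F := fun n => dslope (F n) 0) (C := (C + η) / R)
      (fun n => (Complex.differentiableOn_dslope (Metric.ball_mem_nhds _ one_pos)).mpr (hF n)) ?_ ?_ (ε / 4) (by positivity)
    · filter_upwards [hG, h0] with n hn hn0 ζ hζ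
      have h3 : F n ζ = F n 0 + ζ * dslope (F n) 0 ζ := by
        have := sub_smul_dslope (F n) 0 ζ
        simp only [sub_zero, smul_eq_mul] at this
        rw [this]; ring
      rw [h3]
      refine (norm_add_le _ _).trans ?_
      rw [norm_mul]
      have h4 : ‖ζ‖ * ‖dslope (F n) 0 ζ‖ ≤ r * ((r / R) ^ m * ((C + η) / R) + ε / 4) :=
        mul_le_mul hζ (hn ζ hζ) (norm_nonneg _) hr.le
      have hq : (r / R) ^ (m + 1) ≤ 1 := pow_le_one₀ (by positivity) ((div_le_one hR).mpr hrR.le)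
      have h5 : r * ((r / R) ^ m * ((C + η) / R) + ε / 4) = (r / R) ^ (m + 1) * C + (r / R) ^ (m + 1) * η + r * ε / 4 := by
        rw [pow_succ]; field_simp
      have h6 : (r / R) ^ (m + 1) * η ≤ 1 * η := by gcongr
      have h7 : r * ε / 4 ≤ ε / 4 := by nlinarith
      have h8 : η ≤ ε / 4 := by rw [hη]; nlinarith
      linarith
    · filter_upwards [hC, h0] with n hn hn0
      exact dslope_bd hR (hF n) hR1 hn hn0
    · intro t ht0 htR
      have ht' : (t : ℂ) ≠ 0 := by exact_mod_cast ht0.ne'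
      have : Tendsto (fun n => (F n t - F n 0) / (t : ℂ)) atTop (𝓝 ((0 - 0) / (t : ℂ))) :=
        ((ht t ht0 htR).sub h0t).div_const _
      simp only [sub_zero, zero_div] at this
      refine this.congr fun n => ?_
      rw [dslope_of_ne _ ht', slope_def_field, sub_zero]

lemma vitali {F : ℕ → ℂ → ℂ} (hF : ∀ n, DifferentiableOn ℂ (F n) (Metric.ball 0 1))
    (hC : ∀ R, 0 < R → R < 1 → ∃ C, ∀ᶠ n in atTop, ∀ ζ, ‖ζ‖ ≤ R → ‖F n ζ‖ ≤ C)
    (ht : ∀ t : ℝ, 0 < t → t < 1 → Tendsto (fun n => F n t) atTop (𝓝 0)) {r : ℝ} (hr : 0 < r) (hr1 : r < 1)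
    {ε : ℝ} (hε : 0 < ε) : ∀ᶠ n in atTop, ∀ ζ, ‖ζ‖ ≤ r → ‖F n ζ‖ ≤ ε := by
  obtain ⟨R, hrR, hR1⟩ := exists_between hr1
  have hR : 0 < R := hr.trans hrR
  obtain ⟨C, hC⟩ := hC R hR hR1
  have hlim : Tendsto (fun m : ℕ => (r / R) ^ m * C) atTop (𝓝 (0 * C)) :=
    (tendsto_pow_atTop_nhds_zero_of_lt_one (by positivity) ((div_lt_one hR).mpr hrR)).mul_const C
  rw [zero_mul] at hlim
  obtain ⟨m, hm⟩ := (hlim.eventually (gt_mem_nhds (half_pos hε))).exists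
  filter_upwards [vitali_aux hr hrR hR1 m hF hC (fun t h1 h2 => ht t h1 (h2.trans hR1)) (ε / 2) (by positivity)] with n hn ζ hζ
  have := hn ζ hζ
  linarith

/-- Two circles maximum principle with a monomial comparison. -/
lemma annulus_bd {A : ℂ → ℂ} (hA : DifferentiableOn ℂ A (Metric.ball 0 1)) {r₀ R : ℝ} (h0 : 0 < r₀)
    (hR1 : R < 1) {B₀ B₁ : ℝ} (hB0 : ∀ ζ, ‖ζ‖ ≤ r₀ → ‖A ζ‖ ≤ B₀)
    (hB1 : ∀ ζ, ‖ζ‖ ≤ R → ‖A ζ‖ ≤ B₁) (m : ℕ) {ζ : ℂ} (h1 : r₀ < ‖ζ‖) (h2 : ‖ζ‖ < R) :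
    ‖A ζ‖ ≤ ‖ζ‖ ^ m * max (B₀ / r₀ ^ m) (B₁ / R ^ m) := by
  have hz : 0 < ‖ζ‖ := h0.trans h1
  have hR : 0 < R := hz.trans h2
  have key : ‖A ζ / ζ ^ m‖ ≤ max (B₀ / r₀ ^ m) (B₁ / R ^ m) := by
    set U : Set ℂ := {z | r₀ < ‖z‖ ∧ ‖z‖ < R} with hU
    have hUo : IsOpen U := (isOpen_lt continuous_const continuous_norm).inter (isOpen_lt continuous_norm continuous_const)
    have hcl : closure U ⊆ {z | r₀ ≤ ‖z‖ ∧ ‖z‖ ≤ R} := by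
      apply closure_minimal
      · rintro z ⟨h, h'⟩; exact ⟨h.le, h'.le⟩
      · exact (isClosed_le continuous_const continuous_norm).inter (isClosed_le continuous_norm continuous_const)
    refine Complex.norm_le_of_forall_mem_frontier_norm_le (U := U) (f := fun z => A z / z ^ m) ?_ ?_ ?_ (subset_closure ⟨h1, h2⟩)
    · apply (Metric.isBounded_ball (x := (0 : ℂ)) (r := R)).subset
      rintro z ⟨_, h⟩; simpa using h
    · apply DifferentiableOn.diffContOnCl
      intro z hz'
      have hz' := hcl hz'
      have hz0 : z ≠ 0 := norm_pos_iff.mp (h0.trans_le hz'.1)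
      have hzb : z ∈ Metric.ball (0 : ℂ) 1 := by simpa using hz'.2.trans_lt hR1
      apply DifferentiableAt.differentiableWithinAt
      apply DifferentiableAt.div
      · exact hA.differentiableAt (Metric.isOpen_ball.mem_nhds hzb)
      · fun_prop
      · exact pow_ne_zero _ hz0
    · intro z hz'
      rw [hUo.frontier_eq] at hz'
      have hc := hcl hz'.1
      have hn : ¬ (r₀ < ‖z‖ ∧ ‖z‖ < R) := hz'.2
      rw [norm_div, norm_pow]
      by_cases h : r₀ < ‖z‖
      · have : ‖z‖ = R := le_antisymm hc.2 (not_lt.mp fun h' => hn ⟨h, h'⟩)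
        rw [this]
        refine le_trans ?_ (le_max_right _ _)
        gcongr
        exact hB1 z this.le
      · have : ‖z‖ = r₀ := le_antisymm (not_lt.mp h) hc.1
        rw [this]
        refine le_trans ?_ (le_max_left _ _)
        gcongr
        exact hB0 z this.le
  rw [norm_div, norm_pow, div_le_iff₀ (by positivity)] at key
  linarith [key, mul_comm (‖ζ‖ ^ m) (max (B₀ / r₀ ^ m) (B₁ / R ^ m))]

/-- Two constants: exponential decay near `0` and subexponential growth imply decay. -/
lemma two_const {A : ℕ → ℂ → ℂ} (hA : ∀ n, DifferentiableOn ℂ (A n) (Metric.ball 0 1)) {r₀ c : ℝ} (h0 : 0 < r₀)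
    (hc : 0 < c) (hB0 : ∀ᶠ n : ℕ in atTop, ∀ ζ, ‖ζ‖ ≤ r₀ → ‖A n ζ‖ ≤ Real.exp (-c * n))
    (hB1 : ∀ R, 0 < R → R < 1 → ∀ ε > 0, ∀ᶠ n : ℕ in atTop, ∀ ζ, ‖ζ‖ ≤ R → ‖A n ζ‖ ≤ Real.exp (ε * n))
    {r : ℝ} (hr : 0 < r) (hr1 : r < 1) {η : ℝ} (hη : 0 < η) :
    ∀ᶠ n in atTop, ∀ ζ, ‖ζ‖ ≤ r → ‖A n ζ‖ ≤ η := by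
  obtain ⟨R, hrR, hR1⟩ := exists_between hr1
  have hR : 0 < R := hr.trans hrR
  -- `δ` with `δ * log (R / r₀) ≤ c / 2`
  set l : ℝ := |Real.log (R / r₀)| + 1 with hl
  have hl0 : 0 < l := by positivity
  set δ : ℝ := c / (2 * l) with hδ
  have hδ0 : 0 < δ := by positivity
  set ε : ℝ := δ * Real.log (R / r) / 2 with hε
  have hlog : 0 < Real.log (R / r) := Real.log_pos ((one_lt_div hr).mpr hrR)
  have hε0 : 0 < ε := by positivity
  have hlim : ∀ d : ℝ, 0 < d → ∀ K : ℝ, 0 < K → Tendsto (fun n : ℕ => K * Real.exp (-d * n)) atTop (𝓝 0) := by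
    intro d hd K hK
    have : Tendsto (fun n : ℕ => K * Real.exp (-(d * n))) atTop (𝓝 (K * 0)) := by
      apply Tendsto.const_mul
      apply Real.tendsto_exp_neg_atTop_nhds_zero.comp
      exact Tendsto.const_mul_atTop hd tendsto_natCast_atTop_atTop
    simpa using this
  have e0 := (hlim c hc 1 one_pos).eventually (gt_mem_nhds hη)
  have e1 := (hlim (c / 2) (by positivity) 1 one_pos).eventually (gt_mem_nhds hη)
  have e2 := (hlim ε hε0 (R / r) (by positivity)).eventually (gt_mem_nhds hη)
  filter_upwards [hB0, hB1 R hR hR1 ε hε0, e0, e1, e2] with n h1 h2 e0 e1 e2 ζ hζ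
  by_cases hcase : ‖ζ‖ ≤ r₀
  · refine (h1 ζ hcase).trans ?_
    rw [one_mul] at e0; exact e0.le
  push Not at hcase
  have hz : 0 < ‖ζ‖ := h0.trans hcase
  have hzR : ‖ζ‖ < R := hζ.trans_lt hrR
  set m : ℕ := ⌊δ * n⌋₊ with hm
  have hm1 : (m : ℝ) ≤ δ * n := Nat.floor_le (by positivity)
  have hm2 : δ * n < m + 1 := Nat.lt_floor_add_one _
  refine (annulus_bd (hA n) h0 hR1 h1 h2 m hcase hzR).trans ?_
  rw [mul_max_of_nonneg _ _ (by positivity)]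
  apply max_le
  · have : ‖ζ‖ ^ m * (Real.exp (-c * n) / r₀ ^ m) = (‖ζ‖ / r₀) ^ m * Real.exp (-c * n) := by
      rw [div_pow]; ring
    rw [this]
    have h3 : (‖ζ‖ / r₀) ^ m ≤ Real.exp (c / 2 * n) := by
      have q1 : (‖ζ‖ / r₀) ≤ Real.exp l := by
        calc ‖ζ‖ / r₀ ≤ R / r₀ := by gcongr
          _ = Real.exp (Real.log (R / r₀)) := (Real.exp_log (by positivity)).symm
          _ ≤ _ := Real.exp_le_exp.mpr (by rw [hl]; linarith [le_abs_self (Real.log (R / r₀))])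
      calc (‖ζ‖ / r₀) ^ m ≤ (Real.exp l) ^ m := by gcongr
        _ = Real.exp (m * l) := by rw [← Real.exp_nat_mul]
        _ ≤ _ := by
          apply Real.exp_le_exp.mpr
          calc (m : ℝ) * l ≤ δ * n * l := by gcongr
            _ = c / 2 * n := by rw [hδ]; field_simp
    calc _ ≤ Real.exp (c / 2 * n) * Real.exp (-c * n) := by gcongr
      _ = 1 * Real.exp (-(c / 2) * n) := by rw [← Real.exp_add, one_mul]; ring_nf
      _ ≤ η := e1.le
  · have : ‖ζ‖ ^ m * (Real.exp (ε * n) / R ^ m) = (‖ζ‖ / R) ^ m * Real.exp (ε * n) := by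
      rw [div_pow]; ring
    rw [this]
    have h3 : (‖ζ‖ / R) ^ m ≤ (R / r) * Real.exp (-(2 * ε) * n) := by
      have q1 : Real.log (r / R) = - Real.log (R / r) := by rw [← Real.log_inv, inv_div]
      calc (‖ζ‖ / R) ^ m ≤ (r / R) ^ m := by gcongr
        _ = Real.exp (m * Real.log (r / R)) := by
          rw [Real.exp_nat_mul, Real.exp_log (by positivity)]
        _ ≤ Real.exp (Real.log (R / r) + -(2 * ε) * n) := by
          apply Real.exp_le_exp.mpr
          rw [q1, hε]
          nlinarith
        _ = _ := by rw [Real.exp_add, Real.exp_log (by positivity)]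
    calc _ ≤ (R / r) * Real.exp (-(2 * ε) * n) * Real.exp (ε * n) := by gcongr
      _ = (R / r) * Real.exp (-ε * n) := by rw [mul_assoc, ← Real.exp_add]; ring_nf
      _ ≤ η := e2.le

lemma expsum_K {ι : Type*} [DecidableEq ι] (s : Finset ι) (lam c : ι → ℂ)
    (h : ∀ m, m + 1 < s.card → ∑ i ∈ s, c i * lam i ^ m = 0) :
    ∀ i ∈ s, c i * ∏ l ∈ s.erase i, (lam i - lam l) = ∑ j ∈ s, c j * lam j ^ (s.card - 1) := by
  intro i hi
  set p : ℂ[X] := ∏ l ∈ s.erase i, (X - C (lam l)) with hp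
  have hm : p.Monic := monic_prod_of_monic _ _ fun l _ => monic_X_sub_C _
  have hd : p.natDegree = s.card - 1 := by
    rw [hp, natDegree_prod_of_monic _ _ fun l _ => monic_X_sub_C _]
    simp [Finset.card_erase_of_mem hi]
  have h1 : ∑ j ∈ s, c j * p.eval (lam j) = c i * ∏ l ∈ s.erase i, (lam i - lam l) := by
    rw [Finset.sum_eq_single i]
    · simp [hp, eval_prod]
    · intro j hj hji
      have : p.eval (lam j) = 0 := by
        rw [hp, eval_prod]
        exact Finset.prod_eq_zero (Finset.mem_erase.2 ⟨hji, hj⟩) (by simp)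
      simp [this]
    · intro h'; exact absurd hi h'
  rw [← h1]
  have h2 : ∀ j, p.eval (lam j) = lam j ^ (s.card - 1) + ∑ m ∈ Finset.range (s.card - 1), p.coeff m * lam j ^ m := by
    intro j
    rw [eval_eq_sum_range, Finset.sum_range_succ, hm.coeff_natDegree, hd]; ring
  simp_rw [h2, mul_add, Finset.sum_add_distrib, Finset.mul_sum]
  rw [Finset.sum_comm]
  rw [add_eq_left]
  apply Finset.sum_eq_zero
  intro m hm
  have := h m (by have := Finset.mem_range.1 hm; omega)
  calc _ = p.coeff m * ∑ i ∈ s, c i * lam i ^ m := by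
        rw [Finset.mul_sum]; exact Finset.sum_congr rfl fun _ _ => by ring
    _ = 0 := by rw [this, mul_zero]

lemma expsum_bd {ι : Type*} [DecidableEq ι] (lam : ι → ℝ) (Λ : ℝ) (hL : ∀ i, |lam i| ≤ Λ)
    (s : Finset ι) (hs : s.Nonempty) : ∀ (c : ι → ℂ),
    (∀ m, m + 1 < s.card → ∑ i ∈ s, c i * (lam i : ℂ) ^ m = 0) → ∀ L : ℂ,
    ‖∑ i ∈ s, c i * Complex.exp (lam i * L)‖ ≤
      ‖∑ i ∈ s, c i * (lam i : ℂ) ^ (s.card - 1)‖ * ‖L‖ ^ (s.card - 1) / (s.card - 1).factorial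
        * Real.exp (Λ * |L.re|) := by
  induction hs using Finset.Nonempty.cons_induction with
  | singleton a =>
    intro c _ L
    have h1 : lam a * L.re ≤ Λ * |L.re| := by
      calc _ ≤ |lam a * L.re| := le_abs_self _
        _ = |lam a| * |L.re| := abs_mul _ _
        _ ≤ _ := mul_le_mul_of_nonneg_right (hL a) (abs_nonneg _)
    simp only [Finset.sum_singleton, Finset.card_singleton, norm_mul, Complex.norm_exp]
    simp
    gcongr
  | cons a t ha hne ih =>
    intro c h L
    obtain ⟨k, hk⟩ : ∃ k, t.card = k + 1 := ⟨t.card - 1, by have := hne.card_pos; omega⟩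
    have hc : (Finset.cons a t ha).card = k + 2 := by rw [Finset.card_cons, hk]
    set s := Finset.cons a t ha with hs
    set d : ι → ℂ := fun i => c i * (lam i - lam a) with hd
    have hsum : ∀ g : ι → ℂ, ∑ i ∈ t, d i * g i = ∑ i ∈ s, c i * (lam i - lam a) * g i := by
      intro g
      rw [hs, Finset.sum_cons]; simp [hd]
    have hsum2 : ∀ m, ∑ i ∈ t, d i * (lam i : ℂ) ^ m = ∑ i ∈ s, c i * (lam i : ℂ) ^ (m + 1)
        - lam a * ∑ i ∈ s, c i * (lam i : ℂ) ^ m := by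
      intro m
      rw [hsum, Finset.mul_sum, ← Finset.sum_sub_distrib]
      exact Finset.sum_congr rfl fun _ _ => by ring
    have ih' := ih d (fun m hm => by
      rw [hsum2, h _ (by omega), h _ (by omega)]; simp)
    rw [hk] at ih'
    rw [hc]
    simp only [Nat.add_sub_cancel] at ih'
    rw [show k + 2 - 1 = k + 1 by omega]
    rw [hsum2, h k (by omega), mul_zero, sub_zero] at ih'
    set K := ‖∑ i ∈ s, c i * (lam i : ℂ) ^ (k + 1)‖ with hK
    set W := K * ‖L‖ ^ (k + 1) * Real.exp (Λ * |L.re|) / (k + 1).factorial with hW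
    set φ : ℝ → ℂ := fun τ => ∑ i ∈ s, c i * Complex.exp (lam a * L + τ * ((lam i - lam a) * L)) with hφ
    set φ' : ℝ → ℂ := fun τ => ∑ i ∈ s, c i * (Complex.exp (lam a * L + τ * ((lam i - lam a) * L)) * (((lam i - lam a) * L))) with hφ'
    have hder : ∀ τ : ℝ, HasDerivAt φ (φ' τ) τ := by
      intro τ
      apply HasDerivAt.fun_sum
      intro i _
      apply HasDerivAt.const_mul
      apply HasDerivAt.cexp
      have h1 : HasDerivAt (fun τ : ℝ => (τ : ℂ)) 1 τ := Complex.ofRealCLM.hasDerivAt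
      simpa using (h1.mul_const ((lam i - lam a) * L)).const_add (lam a * L)
    have key : ∀ ⦃x : ℝ⦄, x ∈ Set.Icc (0:ℝ) 1 → ‖φ x‖ ≤ W * x ^ (k + 1) := by
      refine image_norm_le_of_norm_deriv_right_le_deriv_boundary (f := φ) (f' := φ') (B := fun x => W * x ^ (k + 1))
        (B' := fun x => W * ((k + 1 : ℕ) * x ^ k)) ?_ ?_ ?_ ?_ ?_
      · exact fun x _ => (hder x).continuousAt.continuousWithinAt
      · exact fun x _ => (hder x).hasDerivWithinAt
      · have : φ 0 = Complex.exp (lam a * L) * ∑ i ∈ s, c i * (lam i : ℂ) ^ 0 := by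
          rw [Finset.mul_sum]; refine Finset.sum_congr rfl fun i _ => ?_
          simp [mul_comm]
        rw [this, h 0 (by omega)]; simp
      · intro x
        simpa using (hasDerivAt_pow (k + 1) x).const_mul W
      · intro x hx
        have e1 : φ' x = L * (Complex.exp (lam a * L * (1 - x)) * ∑ i ∈ t, d i * Complex.exp (lam i * (x * L))) := by
          rw [hsum, hφ', Finset.mul_sum, Finset.mul_sum]
          refine Finset.sum_congr rfl fun i _ => ?_
          have : Complex.exp (lam a * L + x * ((lam i - lam a) * L)) =
            Complex.exp (lam a * L * (1 - x)) * Complex.exp (lam i * (x * L)) := by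
              rw [← Complex.exp_add]; congr 1; ring
          rw [this]; ring
        rw [e1, norm_mul, norm_mul, Complex.norm_exp]
        have h2 : (lam a * L * (1 - x)).re ≤ Λ * |L.re| * (1 - x) := by
          have : (lam a * L * (1 - x)).re = (lam a * L.re) * (1 - x) := by
            rw [show (lam a * L * (1 - x) : ℂ) = ((lam a * (1 - x) : ℝ) : ℂ) * L by push_cast; ring, Complex.re_ofReal_mul]; ring
          rw [this]
          apply mul_le_mul_of_nonneg_right _ (by linarith [hx.2])
          calc _ ≤ |lam a * L.re| := le_abs_self _
            _ = |lam a| * |L.re| := abs_mul _ _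
            _ ≤ _ := mul_le_mul_of_nonneg_right (hL a) (abs_nonneg _)
        have h3 := ih' (x * L)
        have hn : ‖(x * L : ℂ)‖ = x * ‖L‖ := by rw [norm_mul, Complex.norm_real, Real.norm_of_nonneg hx.1]
        have hr : |(x * L : ℂ).re| = x * |L.re| := by rw [Complex.re_ofReal_mul, abs_mul, abs_of_nonneg hx.1]
        rw [hn, hr] at h3
        calc _ ≤ ‖L‖ * (Real.exp (Λ * |L.re| * (1 - x)) * (K * (x * ‖L‖) ^ k / k.factorial * Real.exp (Λ * (x * |L.re|)))) := by
              gcongr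
          _ = ‖L‖ * (K * (x * ‖L‖) ^ k / k.factorial) * Real.exp (Λ * |L.re|) := by
              rw [show Λ * |L.re| = Λ * |L.re| * (1 - x) + Λ * (x * |L.re|) by ring, Real.exp_add]
              ring_nf
          _ = W * ((k + 1 : ℕ) * x ^ k) := by
              rw [hW, Nat.factorial_succ]
              have : (k.factorial : ℝ) ≠ 0 := by positivity
              have : ((k : ℝ) + 1) ≠ 0 := by positivity
              push_cast
              field_simp
              ring
    have := key (x := 1) (by simp)
    have e : φ 1 = ∑ i ∈ s, c i * Complex.exp (lam i * L) := by
      refine Finset.sum_congr rfl fun i _ => ?_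
      congr 2; push_cast; ring
    rw [e, hW] at this
    calc _ ≤ _ := this
      _ = _ := by simp; ring

lemma order_of_bigO {E : ℂ → ℂ} (hE : AnalyticAt ℂ E 0) (N : ℕ)
    (hO : E =O[𝓝[≠] (0:ℂ)] fun L => L ^ N) : ∀ m < N, iteratedDeriv m E 0 = 0 := by
  rw [← natCast_le_analyticOrderAt_iff_iteratedDeriv_eq_zero hE]
  by_contra hlt
  rw [not_le] at hlt
  obtain ⟨k, hk⟩ := ENat.ne_top_iff_exists.1 (ne_top_of_lt hlt)
  rw [← hk] at hlt
  have hkN : k < N := by exact_mod_cast hlt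
  obtain ⟨g, hg, hg0, hgE⟩ := (hE.analyticOrderAt_eq_natCast).1 hk.symm
  have h1 : g =O[𝓝[≠] (0:ℂ)] fun L => L ^ (N - k) := by
    obtain ⟨C, hC⟩ := hO.bound
    refine IsBigO.of_bound C ?_
    filter_upwards [hC, hgE.filter_mono nhdsWithin_le_nhds, self_mem_nhdsWithin] with L h1 h2 h3
    have h3 : L ≠ 0 := h3
    rw [h2] at h1
    simp only [sub_zero, smul_eq_mul, norm_mul, norm_pow] at h1 ⊢
    rw [show N = k + (N - k) by omega, pow_add] at h1
    have : 0 < ‖L‖ ^ k := by positivity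
    have h4 : ‖L‖ ^ k * ‖g L‖ ≤ ‖L‖ ^ k * (C * ‖L‖ ^ (N - k)) := by
      calc _ ≤ _ := h1
        _ = _ := by ring_nf
    exact le_of_mul_le_mul_left h4 this
  have h2 : Tendsto (fun L : ℂ => L ^ (N - k)) (𝓝[≠] (0:ℂ)) (𝓝 0) := by
    have : Tendsto (fun L : ℂ => L ^ (N - k)) (𝓝 (0:ℂ)) (𝓝 (0 ^ (N - k))) := (continuous_pow _).tendsto 0
    rw [zero_pow (by omega)] at this
    exact this.mono_left nhdsWithin_le_nhds
  have h3 := h1.trans_tendsto h2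
  have h4 : Tendsto g (𝓝[≠] (0:ℂ)) (𝓝 (g 0)) := hg.continuousAt.tendsto.mono_left nhdsWithin_le_nhds
  exact hg0 (tendsto_nhds_unique h4 h3)

lemma moments_zero {ι : Type*} (s : Finset ι) (c lam : ι → ℂ) (N : ℕ)
    (hO : (fun L : ℂ => ∑ i ∈ s, c i * Complex.exp (lam i * L)) =O[𝓝[≠] (0:ℂ)] fun L => L ^ N) :
    ∀ m < N, ∑ i ∈ s, c i * lam i ^ m = 0 := by
  intro m hm
  have := order_of_bigO (by fun_prop) N hO m hm
  rw [iteratedDeriv_fun_sum (fun i _ => by fun_prop)] at this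
  simp only [iteratedDeriv_const_mul_field, iteratedDeriv_cexp_const_mul] at this
  simpa using this

/-- The variable `z` as a function of `L`. -/
noncomputable def zL (L : ℂ) : ℂ := (1 + Complex.exp L) / (1 - Complex.exp L)

lemma exp_ne_one {L : ℂ} (h0 : L ≠ 0) (h1 : ‖L‖ < 1) : 1 - Complex.exp L ≠ 0 := by
  intro h
  have h2 := Complex.norm_exp_sub_one_sub_id_le h1.le
  rw [show Complex.exp L - 1 - L = -L - (1 - Complex.exp L) by ring, h, sub_zero, norm_neg] at h2
  have : 0 < ‖L‖ := norm_pos_iff.2 h0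
  nlinarith

lemma exp_re_pos {L : ℂ} (h1 : ‖L‖ < 1) : 0 < (Complex.exp L).re := by
  rw [Complex.exp_re]
  have h2 := abs_lt.1 ((Complex.abs_im_le_norm L).trans_lt h1)
  have := Real.pi_gt_three
  exact mul_pos (Real.exp_pos _) (Real.cos_pos_of_mem_Ioo ⟨by linarith, by linarith⟩)

lemma zL_mem {L : ℂ} (h0 : L ≠ 0) (h1 : ‖L‖ < 1) : zL L ∈ {z : ℂ | ¬(z.im = 0 ∧ |z.re| ≤ 1)} := by
  rintro ⟨hi, hr⟩
  have hz : zL L * (1 - Complex.exp L) = 1 + Complex.exp L := div_mul_cancel₀ _ (exp_ne_one h0 h1)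
  have h2 := exp_re_pos h1
  have h3 := congrArg Complex.re hz
  rw [Complex.mul_re, hi] at h3
  simp at h3
  have := abs_le.1 hr
  have h4 : 0 ≤ (Complex.exp L).re * (1 + (zL L).re) := mul_nonneg h2.le (by linarith)
  have h5 : (zL L).re = 1 := by nlinarith
  rw [h5] at h3
  linarith

lemma zL_tendsto : Tendsto zL (𝓝[≠] 0) (cobounded ℂ) := by
  have h1 : Tendsto (fun L : ℂ => 1 - Complex.exp L) (𝓝[≠] 0) (𝓝[≠] 0) := by
    apply tendsto_nhdsWithin_of_tendsto_nhds_of_eventually_within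
    · have : Continuous (fun L : ℂ => 1 - Complex.exp L) := by fun_prop
      have := this.tendsto 0
      simp only [Complex.exp_zero, sub_self] at this
      exact this.mono_left nhdsWithin_le_nhds
    · filter_upwards [self_mem_nhdsWithin, nhdsWithin_le_nhds (Metric.ball_mem_nhds (0:ℂ) one_pos)] with L h h'
      exact exp_ne_one h (by simpa using h')
  have h2 := (tendsto_norm_atTop_iff_cobounded (E := ℂ)).2 (tendsto_inv₀_nhdsNE_zero.comp h1)
  rw [← tendsto_norm_atTop_iff_cobounded]
  refine tendsto_atTop_mono' _ ?_ h2
  filter_upwards [nhdsWithin_le_nhds (Metric.ball_mem_nhds (0:ℂ) one_pos)] with L h'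
  have h3 := exp_re_pos (L := L) (by simpa using h')
  simp only [zL, Function.comp, norm_div, norm_inv]
  rw [inv_eq_one_div]
  gcongr
  calc (1:ℝ) ≤ (1 + Complex.exp L).re := by simp; linarith
    _ ≤ _ := Complex.re_le_norm _

lemma isOpen_dom : IsOpen {z : ℂ | ¬(z.im = 0 ∧ |z.re| ≤ 1)} := by
  have : IsClosed {z : ℂ | z.im = 0 ∧ |z.re| ≤ 1} :=
    (isClosed_eq Complex.continuous_im continuous_const).inter
      (isClosed_le Complex.continuous_re.abs continuous_const)
  exact this.isOpen_compl

lemma f_zL (α : ℝ) (f : ℂ → ℂ)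
    (hf_dom : DifferentiableOn ℂ f {z : ℂ | ¬(z.im = 0 ∧ |z.re| ≤ 1)})
    (hf_pearson : ∀ z ∈ {z : ℂ | ¬(z.im = 0 ∧ |z.re| ≤ 1)},
      (z ^ 2 - 1) * deriv f z = 2 * (α : ℂ) * f z)
    (hf_inf : Tendsto f (cobounded ℂ) (𝓝 1)) {L : ℂ} (h0 : L ≠ 0) (h1 : ‖L‖ < 1) :
    f (zL L) = Complex.exp (α * L) := by
  have hd : ∀ L : ℂ, L ≠ 0 → ‖L‖ < 1 → HasDerivAt (fun L => f (zL L) * Complex.exp (-(α * L))) 0 L := by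
    intro L h0 h1
    have hm := zL_mem h0 h1
    have hne := exp_ne_one h0 h1
    have hz : HasDerivAt zL (2 * Complex.exp L / (1 - Complex.exp L) ^ 2) L := by
      have e := Complex.hasDerivAt_exp L
      have := (e.const_add 1).div (e.const_sub 1) hne
      refine this.congr_deriv ?_
      congr 1; ring
    have hf : HasDerivAt f (deriv f (zL L)) (zL L) :=
      (hf_dom.differentiableAt (isOpen_dom.mem_nhds hm)).hasDerivAt
    have he : HasDerivAt (fun L : ℂ => Complex.exp (-(α * L))) (Complex.exp (-(α * L)) * (-α)) L := by
      have h := ((hasDerivAt_id L).const_mul (α:ℂ)).neg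
      simpa using h.cexp
    have := (hf.comp L hz).mul he
    refine this.congr_deriv ?_
    have hp := hf_pearson _ hm
    have e1 : zL L ^ 2 - 1 = 4 * Complex.exp L / (1 - Complex.exp L) ^ 2 := by
      rw [zL]; field_simp; ring
    rw [e1] at hp
    rw [Function.comp_apply]
    linear_combination (Complex.exp (-(α * L)) / 2) * hp
  have hc : ∀ t ∈ Set.Ioo (0:ℝ) (1 / ‖L‖), HasDerivAt (fun t : ℝ => f (zL (t * L)) * Complex.exp (-(α * (t * L)))) 0 t := by
    intro t ht
    have hLp : 0 < ‖L‖ := norm_pos_iff.2 h0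
    have h2 := hd (t * L) (mul_ne_zero (by exact_mod_cast ht.1.ne') h0) (by
      rw [norm_mul, Complex.norm_real, Real.norm_of_nonneg ht.1.le]
      have := ht.2
      rwa [lt_div_iff₀ hLp] at this)
    have h3 : HasDerivAt (fun τ : ℝ => (τ : ℂ) * L) (1 * L) t :=
      (Complex.ofRealCLM.hasDerivAt (x := t)).mul_const L
    have h4 := HasDerivAt.scomp t h2 h3
    rw [smul_zero] at h4
    exact h4
  obtain ⟨a, ha⟩ := isOpen_Ioo.exists_is_const_of_deriv_eq_zero isPreconnected_Ioo
    (fun t ht => (hc t ht).differentiableAt.differentiableWithinAt) (fun t ht => (hc t ht).deriv)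
  have hLp : 0 < ‖L‖ := norm_pos_iff.2 h0
  have hmem : (1:ℝ) ∈ Set.Ioo (0:ℝ) (1 / ‖L‖) := ⟨one_pos, by rw [lt_div_iff₀ hLp]; simpa⟩
  have ht0 : Tendsto (fun t : ℝ => (t : ℂ) * L) (𝓝[>] 0) (𝓝[≠] 0) := by
    apply tendsto_nhdsWithin_of_tendsto_nhds_of_eventually_within
    · have : Continuous (fun t : ℝ => (t : ℂ) * L) := by fun_prop
      have := this.tendsto 0
      simp only [Complex.ofReal_zero, zero_mul] at this
      exact this.mono_left nhdsWithin_le_nhds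
    · filter_upwards [self_mem_nhdsWithin] with t ht
      exact mul_ne_zero (by exact_mod_cast (ne_of_gt ht)) h0
  have hlim : Tendsto (fun t : ℝ => f (zL (t * L)) * Complex.exp (-(α * (t * L)))) (𝓝[>] 0) (𝓝 (1 * 1)) := by
    refine ((hf_inf.comp zL_tendsto).comp ht0).mul ?_
    have : Continuous (fun t : ℝ => Complex.exp (-(α * (t * L)))) := by fun_prop
    have := this.tendsto 0
    simp only [Complex.ofReal_zero, zero_mul, mul_zero, neg_zero, Complex.exp_zero] at this
    exact this.mono_left nhdsWithin_le_nhds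
  have hlim2 : Tendsto (fun t : ℝ => f (zL (t * L)) * Complex.exp (-(α * (t * L)))) (𝓝[>] 0) (𝓝 a) := by
    refine tendsto_const_nhds.congr' ?_
    filter_upwards [Ioo_mem_nhdsGT (hmem.1.trans hmem.2)] with t ht
    exact (ha t ht).symm
  have h5 := ha 1 hmem
  rw [tendsto_nhds_unique hlim2 hlim] at h5
  simp only [Complex.ofReal_one, one_mul, Complex.exp_neg] at h5
  have := Complex.exp_ne_zero (α * L)
  field_simp at h5
  exact h5

/-- The polynomial transported to the variable `x = (z-1)/(z+1)`. -/
noncomputable def Pn (n : ℕ) (q : ℂ[X]) : ℂ[X] :=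
  ∑ i ∈ Finset.range (n + 1), C (q.coeff i) * ((1 + X) ^ i * (1 - X) ^ (n - i))

lemma Pn_eval {n : ℕ} {q : ℂ[X]} (hq : q.natDegree ≤ n) {x : ℂ} (hx : 1 - x ≠ 0) :
    (Pn n q).eval x = (1 - x) ^ n * q.eval ((1 + x) / (1 - x)) := by
  rw [eval_eq_sum_range' (Nat.lt_succ_of_le hq), Pn, eval_finsetSum, Finset.mul_sum]
  refine Finset.sum_congr rfl fun i hi => ?_
  have hi : i ≤ n := by have := Finset.mem_range.1 hi; omega
  have : (1 - x) ^ n = (1 - x) ^ i * (1 - x) ^ (n - i) := by rw [← pow_add]; congr 1; omega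
  rw [this]
  simp only [eval_mul, eval_C, eval_pow, eval_add, eval_sub, eval_one, eval_X, div_pow]
  field_simp

lemma Pn_natDegree (n : ℕ) (q : ℂ[X]) : (Pn n q).natDegree ≤ n := by
  apply natDegree_sum_le_of_forall_le
  intro i hi
  have hi : i ≤ n := by have := Finset.mem_range.1 hi; omega
  refine (natDegree_C_mul_le _ _).trans ?_
  refine natDegree_mul_le.trans ?_
  have h1 : ((1 + X : ℂ[X]) ^ i).natDegree ≤ i := by
    refine natDegree_pow_le.trans ?_
    have : (1 + X : ℂ[X]).natDegree ≤ 1 := by compute_degree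
    nlinarith
  have h2 : ((1 - X : ℂ[X]) ^ (n - i)).natDegree ≤ n - i := by
    refine natDegree_pow_le.trans ?_
    have : (1 - X : ℂ[X]).natDegree ≤ 1 := by compute_degree
    nlinarith
  omega

lemma Pn_ne {n : ℕ} {q : ℂ[X]} (hq : q.natDegree ≤ n) (h : q ≠ 0) : Pn n q ≠ 0 := by
  intro hP
  apply h
  apply Polynomial.eq_zero_of_infinite_isRoot
  refine Set.Infinite.mono (s := {(-1 : ℂ)}ᶜ) ?_ (Set.finite_singleton _).infinite_compl
  intro z hz
  have hz1 : z + 1 ≠ 0 := by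
    intro h; exact hz (by simpa using eq_neg_of_add_eq_zero_left h)
  have e1 : 1 - (z - 1) / (z + 1) = 2 / (z + 1) := by field_simp; ring
  have hx : 1 - (z - 1) / (z + 1) ≠ 0 := by rw [e1]; exact div_ne_zero two_ne_zero hz1
  have := Pn_eval hq hx
  rw [hP, eval_zero] at this
  have e2 : (1 + (z - 1) / (z + 1)) / (1 - (z - 1) / (z + 1)) = z := by
    rw [e1]; field_simp; ring
  rw [e2] at this
  rcases mul_eq_zero.1 this.symm with h | h
  · exact absurd h (pow_ne_zero _ hx)
  · exact h

lemma prod_mu (n j : ℕ) (hj : j ≤ n) (β : ℝ) :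
    ∏ i ∈ (Finset.range (n + 1)).erase j, (β + j - i : ℝ) = (-1) ^ (n - j) * mu n β j := by
  have h1 : (Finset.range (n + 1)).erase j = Finset.range j ∪ Finset.Ico (j + 1) (n + 1) := by
    ext i; simp; omega
  have hd : Disjoint (Finset.range j) (Finset.Ico (j + 1) (n + 1)) := by
    rw [Finset.disjoint_left]; intro i; simp; omega
  rw [h1, Finset.prod_union hd, Finset.prod_Ico_eq_prod_range, ← Finset.prod_range_reflect, mu]
  have e1 : ∏ i ∈ Finset.range j, (β + j - ((j - 1 - i : ℕ) : ℝ)) = ∏ i ∈ Finset.range j, ((i : ℝ) + 1 + β) := by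
    refine Finset.prod_congr rfl fun i hi => ?_
    have := Finset.mem_range.1 hi
    rw [show j - 1 - i = j - (i + 1) by omega, Nat.cast_sub (by omega)]
    push_cast; ring
  have e2 : ∏ i ∈ Finset.range (n + 1 - (j + 1)), (β + j - ((j + 1 + i : ℕ) : ℝ)) =
      (-1) ^ (n - j) * ∏ i ∈ Finset.range (n - j), ((i : ℝ) + 1 - β) := by
    rw [show n + 1 - (j + 1) = n - j by omega]
    have : ∀ i ∈ Finset.range (n - j), (β + j - ((j + 1 + i : ℕ) : ℝ)) = (-1) * ((i : ℝ) + 1 - β) := by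
      intro i _; push_cast; ring
    rw [Finset.prod_congr rfl this, Finset.prod_mul_distrib, Finset.prod_const, Finset.card_range]
  rw [e1, e2]; ring

lemma prod_mu_full (n j : ℕ) (hj : j ≤ n) (β : ℝ) :
    ∏ i : Fin (n + 1), (β + j - (i : ℕ) : ℝ) = β * ((-1) ^ (n - j) * mu n β j) := by
  rw [← prod_mu n j hj, Finset.prod_range (fun i => (β + j - i : ℝ)) |>.symm,
    ← Finset.mul_prod_erase (Finset.range (n + 1)) _ (Finset.mem_range.2 (Nat.lt_succ_of_le hj))]
  congr 1; ring

lemma prod_mu_ite (n : ℕ) (j : Fin (n + 1)) :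
    ∏ i : Fin (n + 1), (if i = j then (1:ℝ) else ((j : ℕ) - (i : ℕ) : ℝ)) = (-1) ^ (n - j) * mu n 0 j := by
  rw [← prod_mu n j (by omega)]
  have : ∏ i : Fin (n + 1), (if i = j then (1:ℝ) else ((j : ℕ) - (i : ℕ) : ℝ)) =
     ∏ i : Fin (n + 1), (fun i : ℕ => if i = (j : ℕ) then (1:ℝ) else ((j : ℕ) - (i : ℕ) : ℝ)) i := by
    simp [Fin.ext_iff]
  rw [this, ← Finset.prod_range (fun i : ℕ => if i = (j : ℕ) then (1:ℝ) else ((j : ℕ) - (i : ℕ) : ℝ)),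
    ← Finset.mul_prod_erase (Finset.range (n + 1)) _ (Finset.mem_range.2 j.2)]
  simp only [if_true, one_mul]
  refine Finset.prod_congr rfl fun i hi => ?_
  rw [if_neg (Finset.ne_of_mem_erase hi)]; ring

/-- Nodes. -/
def nd (α : ℝ) (n : ℕ) (p : Fin 3 × Fin (n + 1)) : ℝ := (p.1 : ℕ) * α + (p.2 : ℕ)

/-- Coefficients. -/
noncomputable def sk (α : ℝ) (n : ℕ) (k : Fin 3) (j : ℕ) : ℝ :=
  1 / mu n (((k : ℕ) - (0:ℝ)) * α) j / mu n (((k : ℕ) - (1:ℝ)) * α) j / mu n (((k : ℕ) - (2:ℝ)) * α) j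

/-- Constants. -/
noncomputable def Bk (α : ℝ) (k : Fin 3) : ℝ := if k = 1 then -α ^ 2 else 2 * α ^ 2

lemma Bk_ne {α : ℝ} (h : 0 < |α|) (k : Fin 3) : Bk α k ≠ 0 := by
  have : α ≠ 0 := abs_pos.1 h
  rw [Bk]; split_ifs <;> simp [this]

lemma prod_nd (α : ℝ) (n : ℕ) (k : Fin 3) (j : Fin (n + 1)) :
    ∏ p ∈ Finset.univ.erase (k, j), (nd α n (k, j) - nd α n p) =
      Bk α k * (-1) ^ (n - j) * (mu n (((k : ℕ) - (0:ℝ)) * α) j * mu n (((k : ℕ) - (1:ℝ)) * α) j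
        * mu n (((k : ℕ) - (2:ℝ)) * α) j) := by
  have h1 : ∏ p ∈ Finset.univ.erase (k, j), (nd α n (k, j) - nd α n p) =
      ∏ p, (if p = (k, j) then 1 else (nd α n (k, j) - nd α n p)) := by
    rw [← Finset.mul_prod_erase Finset.univ _ (Finset.mem_univ (k, j))]
    simp only [if_true, one_mul]
    refine Finset.prod_congr rfl fun i hi => ?_
    rw [if_neg (Finset.ne_of_mem_erase hi)]
  rw [h1, Fintype.prod_prod_type, Fin.prod_univ_three]
  have hj : (j : ℕ) ≤ n := by omega
  have hs : ((-1 : ℝ) ^ (n - j)) ^ 2 = 1 := by rw [← pow_mul, mul_comm, pow_mul]; simp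
  have h2 : ∀ k k' : Fin 3, k' ≠ k → ∏ i : Fin (n + 1), (if (k', i) = (k, j) then (1:ℝ) else (nd α n (k, j) - nd α n (k', i)))
      = (((k : ℕ) : ℝ) - ((k' : ℕ) : ℝ)) * α * ((-1) ^ (n - j) * mu n ((((k : ℕ) : ℝ) - ((k' : ℕ) : ℝ)) * α) j) := by
    intro k k' hk
    rw [← prod_mu_full n j hj]
    refine Finset.prod_congr rfl fun i _ => ?_
    rw [if_neg (by simp [hk])]; simp only [nd]; ring
  have h3 : ∀ k : Fin 3, ∏ i : Fin (n + 1), (if (k, i) = (k, j) then (1:ℝ) else (nd α n (k, j) - nd α n (k, i)))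
      = ((-1) ^ (n - j) * mu n ((((k : ℕ) : ℝ) - ((k : ℕ) : ℝ)) * α) j) := by
    intro k
    rw [sub_self, zero_mul, ← prod_mu_ite n j]
    refine Finset.prod_congr rfl fun i _ => ?_
    simp [nd]
  fin_cases k
  · have a0 := h3 0
    have a1 := h2 0 1 (by decide)
    have a2 := h2 0 2 (by decide)
    simp only [Fin.zero_eta, Fin.isValue] at *
    rw [a0, a1, a2]
    simp only [Bk, Fin.isValue, Fin.val_zero, Fin.val_one, Fin.val_two, Nat.cast_zero, Nat.cast_one, Nat.cast_ofNat]
    simp only [Fin.isValue, zero_ne_one, if_false]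
    linear_combination (2 * α ^ 2 * (-1) ^ (n - j) * (mu n ((0 - 0) * α) j * mu n ((0 - 1) * α) j * mu n ((0 - 2) * α) j)) * hs
  · have a0 := h2 1 0 (by decide)
    have a1 := h3 1
    have a2 := h2 1 2 (by decide)
    simp only [Fin.mk_one, Fin.isValue] at *
    rw [a0, a1, a2]
    simp only [Bk, Fin.isValue, Fin.val_zero, Fin.val_one, Fin.val_two, Nat.cast_zero, Nat.cast_one, Nat.cast_ofNat]
    simp only [if_true]
    linear_combination (-α ^ 2 * (-1) ^ (n - j) * (mu n ((1 - 0) * α) j * mu n ((1 - 1) * α) j * mu n ((1 - 2) * α) j)) * hs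
  · have a0 := h2 2 0 (by decide)
    have a1 := h2 2 1 (by decide)
    have a2 := h3 2
    simp only [Fin.reduceFinMk, Fin.isValue] at *
    rw [a0, a1, a2]
    simp only [Bk, Fin.isValue, Fin.val_zero, Fin.val_one, Fin.val_two, Nat.cast_zero, Nat.cast_one, Nat.cast_ofNat]
    rw [if_neg (by decide)]
    linear_combination (2 * α ^ 2 * (-1) ^ (n - j) * (mu n ((2 - 0) * α) j * mu n ((2 - 1) * α) j * mu n ((2 - 2) * α) j)) * hs

lemma hp_bigO (α : ℝ) (f : ℂ → ℂ)
    (hf_dom : DifferentiableOn ℂ f {z : ℂ | ¬(z.im = 0 ∧ |z.re| ≤ 1)})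
    (hf_pearson : ∀ z ∈ {z : ℂ | ¬(z.im = 0 ∧ |z.re| ≤ 1)},
      (z ^ 2 - 1) * deriv f z = 2 * (α : ℂ) * f z)
    (hf_inf : Tendsto f (cobounded ℂ) (𝓝 1))
    (n : ℕ) (Q : Fin 3 → Polynomial ℂ)
    (hdeg : ∀ k, (Q k).natDegree ≤ n)
    (hHP : (fun z : ℂ => (Q 0).eval z + (Q 1).eval z * f z + (Q 2).eval z * f z ^ 2)
      =O[cobounded ℂ] fun z => (z ^ (2 * n + 2))⁻¹) :
    (fun L : ℂ => ∑ k : Fin 3, (Pn n (Q k)).eval (Complex.exp L) * Complex.exp (((k : ℕ) * α : ℝ) * L))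
      =O[𝓝[≠] (0:ℂ)] fun L => L ^ (3 * n + 2) := by
  have h1 := hHP.comp_tendsto zL_tendsto
  have h2 : (fun L : ℂ => 1 - Complex.exp L) =O[𝓝[≠] (0:ℂ)] fun L => L := by
    have := ((Complex.hasDerivAt_exp 0).const_sub 1).differentiableAt.isBigO_sub
    simp only [Complex.exp_zero, sub_self, sub_zero] at this
    exact this.mono nhdsWithin_le_nhds
  have hev : ∀ᶠ L : ℂ in 𝓝[≠] 0, L ≠ 0 ∧ ‖L‖ < 1 := by
    filter_upwards [self_mem_nhdsWithin, nhdsWithin_le_nhds (Metric.ball_mem_nhds (0:ℂ) one_pos)] with L h h'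
    exact ⟨h, by simpa using h'⟩
  have h3 : ((fun z : ℂ => (z ^ (2 * n + 2))⁻¹) ∘ zL) =O[𝓝[≠] (0:ℂ)] fun L => (1 - Complex.exp L) ^ (2 * n + 2) := by
    refine IsBigO.of_bound 1 ?_
    filter_upwards [hev] with L ⟨hL0, hL⟩
    have h3 := exp_re_pos hL
    have h4 : (1:ℝ) ≤ ‖1 + Complex.exp L‖ := by
      calc (1:ℝ) ≤ (1 + Complex.exp L).re := by simp; linarith
        _ ≤ _ := Complex.re_le_norm _
    have h5 : (0:ℝ) < ‖1 - Complex.exp L‖ := norm_pos_iff.2 (exp_ne_one hL0 hL)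
    simp only [Function.comp, zL, norm_pow, norm_div, one_mul, ← inv_pow, inv_div]
    gcongr
    exact div_le_self h5.le h4
  have h4 : (fun L : ℂ => (1 - Complex.exp L) ^ n) =O[𝓝[≠] (0:ℂ)] fun L => L ^ n := h2.pow n
  have h5 := h4.mul ((h1.trans h3).trans (h2.pow (2 * n + 2)))
  have e2 : (fun L : ℂ => L ^ n * L ^ (2 * n + 2)) = fun L => L ^ (3 * n + 2) := by
    funext L; rw [← pow_add]; congr 1; ring
  rw [e2] at h5
  refine h5.congr' ?_ EventuallyEq.rfl
  filter_upwards [hev] with L ⟨hL0, hL⟩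
  have hne := exp_ne_one hL0 hL
  have hf := f_zL α f hf_dom hf_pearson hf_inf hL0 hL
  rw [Fin.sum_univ_three, Pn_eval (hdeg 0) hne, Pn_eval (hdeg 1) hne, Pn_eval (hdeg 2) hne]
  simp only [Function.comp, hf]
  rw [← zL, ← Complex.exp_nat_mul]
  simp
  ring_nf

lemma kb0 {α : ℝ} (hα2 : |α| < 1 / 2) (k : Fin 3) : |((k : ℕ) - (0 : ℝ)) * α| < 1 := by
  have := abs_lt.1 hα2
  rw [abs_lt]
  fin_cases k <;> simp <;> constructor <;> linarith

lemma kb1 {α : ℝ} (hα2 : |α| < 1 / 2) (k : Fin 3) : |((k : ℕ) - (1 : ℝ)) * α| < 1 := by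
  have := abs_lt.1 hα2
  rw [abs_lt]
  fin_cases k <;> norm_num <;> constructor <;> linarith

lemma kb2 {α : ℝ} (hα2 : |α| < 1 / 2) (k : Fin 3) : |((k : ℕ) - (2 : ℝ)) * α| < 1 := by
  have := abs_lt.1 hα2
  rw [abs_lt]
  fin_cases k <;> norm_num <;> constructor <;> linarith

lemma ZF_sk {α : ℝ} (hα2 : |α| < 1 / 2) (n : ℕ) (k : Fin 3) : ZF n (sk α n k) := by
  have h0 := kb0 hα2 k
  have h1 := kb1 hα2 k
  have h2 := kb2 hα2 k
  have hz := ZF_inv_mu_zero n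
  fin_cases k
  · refine ((hz.div_mu h1).div_mu h2).congr fun j _ => ?_
    simp [sk]
  · refine ((hz.div_mu h0).div_mu h2).congr fun j _ => ?_
    simp [sk]; ring_nf
  · refine ((hz.div_mu h0).div_mu h1).congr fun j _ => ?_
    simp [sk]; ring_nf

lemma hp_coeffs (α : ℝ) (hα0 : 0 < |α|) (hα2 : |α| < 1 / 2) (f : ℂ → ℂ)
    (hf_dom : DifferentiableOn ℂ f {z : ℂ | ¬(z.im = 0 ∧ |z.re| ≤ 1)})
    (hf_pearson : ∀ z ∈ {z : ℂ | ¬(z.im = 0 ∧ |z.re| ≤ 1)},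
      (z ^ 2 - 1) * deriv f z = 2 * (α : ℂ) * f z)
    (hf_inf : Tendsto f (cobounded ℂ) (𝓝 1))
    (n : ℕ) (Q : Fin 3 → Polynomial ℂ) (hQ : ∃ k, Q k ≠ 0)
    (hdeg : ∀ k, (Q k).natDegree ≤ n)
    (hHP : (fun z : ℂ => (Q 0).eval z + (Q 1).eval z * f z + (Q 2).eval z * f z ^ 2)
      =O[cobounded ℂ] fun z => (z ^ (2 * n + 2))⁻¹) :
    ∃ K : ℂ, K ≠ 0 ∧ (∀ k y, (Pn n (Q k)).eval (-y) = K / Bk α k * Sp n (sk α n k) y) ∧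
      ∀ L : ℂ, ‖∑ k : Fin 3, (Pn n (Q k)).eval (Complex.exp L) * Complex.exp (((k : ℕ) * α : ℝ) * L)‖
        ≤ ‖K‖ * ‖L‖ ^ (3 * n + 2) / (3 * n + 2).factorial * Real.exp ((n + 1) * |L.re|) := by
  set c : Fin 3 × Fin (n + 1) → ℂ := fun p => (Pn n (Q p.1)).coeff p.2 with hc
  have heq : ∀ L : ℂ, ∑ k : Fin 3, (Pn n (Q k)).eval (Complex.exp L) * Complex.exp (((k : ℕ) * α : ℝ) * L)
      = ∑ p, c p * Complex.exp ((nd α n p : ℂ) * L) := by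
    intro L
    rw [Fintype.sum_prod_type]
    refine Finset.sum_congr rfl fun k _ => ?_
    rw [eval_eq_sum_range' (Nat.lt_succ_of_le (Pn_natDegree n (Q k))), Finset.sum_mul, Finset.sum_range]
    refine Finset.sum_congr rfl fun j _ => ?_
    rw [← Complex.exp_nat_mul, mul_assoc, ← Complex.exp_add]
    simp only [hc, nd]
    congr 2; push_cast; ring
  have hcard : (Finset.univ : Finset (Fin 3 × Fin (n + 1))).card = 3 * n + 3 := by
    simp; ring
  have hO := hp_bigO α f hf_dom hf_pearson hf_inf n Q hdeg hHP
  simp_rw [heq] at hO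
  have hm := moments_zero _ _ _ _ hO
  have hm' : ∀ m, m + 1 < (Finset.univ : Finset (Fin 3 × Fin (n + 1))).card →
      ∑ i, c i * (nd α n i : ℂ) ^ m = 0 := by
    intro m h; rw [hcard] at h; exact hm m (by omega)
  have hK := expsum_K _ _ _ hm'
  have hB := expsum_bd (nd α n) (n + 1) (by
    rintro ⟨k, j⟩
    rw [abs_le]
    have := abs_lt.1 hα2
    have hj : ((j : ℕ) : ℝ) ≤ n := by exact_mod_cast (by omega : (j:ℕ) ≤ n)
    have hj0 : (0:ℝ) ≤ ((j : ℕ) : ℝ) := by positivity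
    have hn : (0:ℝ) ≤ n := by positivity
    simp only [nd]
    fin_cases k <;> simp <;> constructor <;> linarith) Finset.univ ⟨(0, 0), Finset.mem_univ _⟩ c hm'
  rw [hcard] at hK hB
  rw [show 3 * n + 3 - 1 = 3 * n + 2 by omega] at hK hB
  set K := ∑ i, c i * (nd α n i : ℂ) ^ (3 * n + 2) with hKdef
  have hcoef : ∀ (k : Fin 3) (j : Fin (n + 1)), c (k, j) = (-1) ^ (n - j) * K / Bk α k * sk α n k j := by
    intro k j
    have h := hK (k, j) (Finset.mem_univ _)
    have h2 : ∏ l ∈ Finset.univ.erase (k, j), ((nd α n (k, j) : ℂ) - nd α n l) =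
       ((∏ l ∈ Finset.univ.erase (k, j), (nd α n (k, j) - nd α n l) : ℝ) : ℂ) := by push_cast; rfl
    rw [h2, prod_nd] at h
    have m0 : ((mu n (((k : ℕ) - (0:ℝ)) * α) j : ℝ) : ℂ) ≠ 0 := by exact_mod_cast (mu_pos n (kb0 hα2 k) j).ne'
    have m1 : ((mu n (((k : ℕ) - (1:ℝ)) * α) j : ℝ) : ℂ) ≠ 0 := by exact_mod_cast (mu_pos n (kb1 hα2 k) j).ne'
    have m2 : ((mu n (((k : ℕ) - (2:ℝ)) * α) j : ℝ) : ℂ) ≠ 0 := by exact_mod_cast (mu_pos n (kb2 hα2 k) j).ne'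
    have hb : ((Bk α k : ℝ) : ℂ) ≠ 0 := by exact_mod_cast Bk_ne hα0 k
    have hs : ((-1 : ℂ) ^ (n - j : ℕ)) ^ 2 = 1 := by rw [← pow_mul, mul_comm, pow_mul]; simp
    rw [← h, sk]
    push_cast
    generalize (-1 : ℂ) ^ (n - j : ℕ) = u at *
    generalize ((mu n (((k : ℕ) - (0:ℝ)) * α) j : ℝ) : ℂ) = M0 at *
    generalize ((mu n (((k : ℕ) - (1:ℝ)) * α) j : ℝ) : ℂ) = M1 at *
    generalize ((mu n (((k : ℕ) - (2:ℝ)) * α) j : ℝ) : ℂ) = M2 at *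
    field_simp
    linear_combination (-c (k, j)) * hs
  refine ⟨(-1) ^ n * K, ?_, ?_, ?_⟩
  · refine mul_ne_zero (by simp) ?_
    intro h0
    obtain ⟨k, hk⟩ := hQ
    apply Pn_ne (hdeg k) hk
    ext j
    rw [coeff_zero]
    by_cases hj : j ≤ n
    · have := hcoef k ⟨j, by omega⟩
      rw [h0] at this
      simpa [hc] using this
    · exact coeff_eq_zero_of_natDegree_lt ((Pn_natDegree n (Q k)).trans_lt (by omega))
  · intro k y
    rw [eval_eq_sum_range' (Nat.lt_succ_of_le (Pn_natDegree n (Q k))), Sp, Finset.mul_sum]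
    refine Finset.sum_congr rfl fun j hj => ?_
    have hj : j < n + 1 := Finset.mem_range.1 hj
    have := hcoef k ⟨j, hj⟩
    simp only [hc] at this
    rw [this, show (-y) ^ j = (-1) ^ j * y ^ j by rw [← mul_pow]; ring]
    have : (-1 : ℂ) ^ n = (-1) ^ (n - j) * (-1) ^ j := by rw [← pow_add]; congr 1; omega
    rw [this]; ring
  · intro L
    rw [heq]
    simpa using hB L

lemma slit_add {v : ℂ} (hv : 0 < v.re) {b : ℝ} (hb : 0 ≤ b) : v ^ 2 + b ∈ Complex.slitPlane := by
  rw [Complex.mem_slitPlane_iff]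
  by_cases h : v.im = 0
  · left; simp [pow_two, h]; nlinarith [mul_pos hv hv]
  · right; simp [pow_two]
    intro h2
    have : v.re * v.im ≠ 0 := mul_ne_zero hv.ne' h
    apply this; linarith

lemma Vf_diff : DifferentiableOn ℂ Vf (Metric.ball 0 1) := by
  intro ζ hζ
  have h : ‖ζ‖ < 1 := by simpa using hζ
  unfold Vf
  exact (DifferentiableAt.div (by fun_prop) (by fun_prop) (one_sub_ne h)).differentiableWithinAt

lemma ZF.loglift {n : ℕ} {a : ℕ → ℝ} (h : ZF n a) :
    ∃ g : ℂ → ℂ, DifferentiableOn ℂ g (Metric.ball 0 1) ∧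
      (∀ ζ, ‖ζ‖ < 1 → Complex.exp (g ζ) * Sp n a 1 = Sp n a (Vf ζ ^ 2)) ∧
      (∀ r < 1, ∀ ζ, ‖ζ‖ ≤ r → ‖g ζ‖ ≤ n * (Real.pi - Real.log (qf r))) ∧
      ∀ t : ℝ, 0 < t → t < 1 → (g t).im = 0 := by
  obtain ⟨b, hb0, hb⟩ := h.factor
  refine ⟨fun ζ => ∑ i, (Complex.log (Vf ζ ^ 2 + b i) - (Real.log (1 + b i) : ℝ)), ?_, ?_, ?_, ?_⟩
  · apply DifferentiableOn.fun_sum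
    intro i _
    refine DifferentiableOn.sub_const ?_ _
    refine DifferentiableOn.clog ((Vf_diff.pow 2).add_const _) ?_
    intro ζ hζ
    exact slit_add (Vf_re (by simpa using hζ)) (hb0 i)
  · intro ζ hζ
    rw [hb, hb, Complex.exp_sum]
    have : ∀ i, Complex.exp (Complex.log (Vf ζ ^ 2 + b i) - (Real.log (1 + b i) : ℝ)) = (Vf ζ ^ 2 + b i) / (1 + b i) := by
      intro i
      have h1 : (0:ℝ) < 1 + b i := by linarith [hb0 i]
      rw [Complex.exp_sub, Complex.exp_log (v_add_ne (Vf_re hζ) (hb0 i)), ← Complex.ofReal_exp, Real.exp_log h1]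
      push_cast; rfl
    simp_rw [this]
    rw [Finset.prod_div_distrib]
    have : ∏ i, ((1:ℂ) + b i) ≠ 0 := by
      rw [Finset.prod_ne_zero_iff]
      intro i _
      exact_mod_cast (by linarith [hb0 i] : (0:ℝ) < 1 + b i).ne'
    field_simp
  · intro r hr ζ hζ
    have hlog : ∀ i : Fin n, ‖Complex.log (Vf ζ ^ 2 + b i) - (Real.log (1 + b i) : ℝ)‖ ≤ Real.pi - Real.log (qf r) := by
      intro i
      have hr0 : 0 ≤ r := (norm_nonneg _).trans hζ
      have h1 : (0:ℝ) < 1 + b i := by linarith [hb0 i]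
      obtain ⟨h2, h3⟩ := root_bd hζ hr (hb0 i)
      have hq : 0 < qf r := by apply qf_pos <;> assumption
      refine (Complex.norm_le_abs_re_add_abs_im _).trans ?_
      simp only [Complex.sub_re, Complex.sub_im, Complex.log_re, Complex.log_im, Complex.ofReal_re, Complex.ofReal_im, sub_zero]
      have h4 := Complex.abs_arg_le_pi (Vf ζ ^ 2 + b i)
      have h5 : 0 < ‖Vf ζ ^ 2 + (b i : ℂ)‖ := lt_of_lt_of_le (by positivity) h2
      have h6 := Real.log_le_log (by positivity) h2
      have h7 := Real.log_le_log h5 h3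
      rw [Real.log_mul hq.ne' h1.ne'] at h6
      rw [Real.log_mul (inv_pos.2 hq).ne' h1.ne', Real.log_inv] at h7
      have : |Real.log ‖Vf ζ ^ 2 + (b i : ℂ)‖ - Real.log (1 + b i)| ≤ - Real.log (qf r) := by
        rw [abs_le]; constructor <;> linarith
      linarith
    calc _ ≤ ∑ i : Fin n, (Real.pi - Real.log (qf r)) := norm_sum_le_of_le _ fun i _ => hlog i
      _ = _ := by simp; ring
  · intro t ht ht1
    rw [Complex.im_sum]
    apply Finset.sum_eq_zero
    intro i _
    have h1 : (Vf t ^ 2 + b i : ℂ) = (((1 + t) / (1 - t)) ^ 2 + b i : ℝ) := by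
      unfold Vf; push_cast; ring
    rw [h1, Complex.sub_im, Complex.ofReal_im, sub_zero, Complex.log_im, Complex.arg_ofReal_of_nonneg]
    have := hb0 i
    positivity

lemma Sp_real (n : ℕ) (a : ℕ → ℝ) (y : ℝ) (hy : 0 ≤ y) (ha : ∀ j ≤ n, 0 < a j) :
    ‖Sp n a y‖ = ∑ j ∈ Finset.range (n + 1), a j * y ^ j := by
  have : Sp n a y = ((∑ j ∈ Finset.range (n + 1), a j * y ^ j : ℝ) : ℂ) := by
    unfold Sp; push_cast; rfl
  rw [this, Complex.norm_real, Real.norm_of_nonneg]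
  apply Finset.sum_nonneg
  intro j hj
  have := ha j (by have := Finset.mem_range.1 hj; omega)
  positivity

lemma Sp_comp {n : ℕ} {a a' : ℕ → ℝ} (h : ZF n a) (h' : ZF n a') {C : ℝ}
    (hC : ∀ j ≤ n, a j ≤ C * a' j) {y : ℝ} (hy : 0 ≤ y) : ‖Sp n a y‖ ≤ C * ‖Sp n a' y‖ := by
  rw [Sp_real n a y hy h.1, Sp_real n a' y hy h'.1, Finset.mul_sum]
  apply Finset.sum_le_sum
  intro j hj
  have := hC j (by have := Finset.mem_range.1 hj; omega)
  calc _ ≤ C * a' j * y ^ j := by gcongr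
    _ = _ := by ring

lemma Sp_one_pos {n : ℕ} {a : ℕ → ℝ} (h : ZF n a) : 0 < ‖Sp n a 1‖ := by
  have := h.2 1 (by simp)
  rw [one_pow] at this
  exact norm_pos_iff.2 this

lemma compare {a a' : ℕ → ℕ → ℝ} (h : ∀ n, ZF n (a n)) (h' : ∀ n, ZF n (a' n)) {C : ℕ → ℝ}
    (hC1 : ∀ n, 1 ≤ C n)
    (hC : ∀ n, ∀ j ≤ n, a n j ≤ C n * a' n j) (hC' : ∀ n, ∀ j ≤ n, a' n j ≤ C n * a n j)
    (hCe : ∀ ε > 0, ∀ᶠ n : ℕ in atTop, C n ≤ Real.exp (ε * n))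
    {r : ℝ} (hr : 0 < r) (hr1 : r < 1) {ε : ℝ} (hε : 0 < ε) :
    ∀ᶠ n : ℕ in atTop, ∀ ζ : ℂ, ‖ζ‖ ≤ r → ‖Sp n (a n) (Vf ζ ^ 2)‖ ≤ Real.exp (ε * n) * ‖Sp n (a' n) (Vf ζ ^ 2)‖ := by
  choose g hgd hge hgb hgi using fun n => (h n).loglift
  choose g' hgd' hge' hgb' hgi' using fun n => (h' n).loglift
  have hre : ∀ n ζ, ‖ζ‖ < 1 → Real.exp (g n ζ).re * ‖Sp n (a n) 1‖ = ‖Sp n (a n) (Vf ζ ^ 2)‖ := by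
    intro n ζ hζ
    rw [← hge n ζ hζ, norm_mul, Complex.norm_exp]
  have hre' : ∀ n ζ, ‖ζ‖ < 1 → Real.exp (g' n ζ).re * ‖Sp n (a' n) 1‖ = ‖Sp n (a' n) (Vf ζ ^ 2)‖ := by
    intro n ζ hζ
    rw [← hge' n ζ hζ, norm_mul, Complex.norm_exp]
  have hbase : ∀ n, ‖Sp n (a n) 1‖ ≤ C n * ‖Sp n (a' n) 1‖ := fun n => by
    simpa using Sp_comp (h n) (h' n) (hC n) (y := 1) zero_le_one
  have hbase' : ∀ n, ‖Sp n (a' n) 1‖ ≤ C n * ‖Sp n (a n) 1‖ := fun n => by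
    simpa using Sp_comp (h' n) (h n) (hC' n) (y := 1) zero_le_one
  have V := vitali (F := fun n ζ => (g n ζ - g' n ζ) / n)
    (fun n => ((hgd n).sub (hgd' n)).div_const _) (by
      intro R hR hR1
      refine ⟨2 * (Real.pi - Real.log (qf R)), ?_⟩
      filter_upwards [eventually_gt_atTop 0] with n hn ζ hζ
      have hn' : (0:ℝ) < n := by exact_mod_cast hn
      rw [norm_div, Complex.norm_natCast, div_le_iff₀ hn']
      have h1 := hgb n R hR1 ζ hζ
      have h2 := hgb' n R hR1 ζ hζ
      have h3 := norm_sub_le (g n ζ) (g' n ζ)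
      linarith) (by
      intro t ht ht1
      rw [Metric.tendsto_atTop']
      intro δ hδ
      obtain ⟨N, hN⟩ := eventually_atTop.1 (hCe (δ / 4) (by positivity))
      refine ⟨N, fun n hn => ?_⟩
      have hC := hC n
      have hC' := hC' n
      have hCn := hN n hn.le
      have hn' : (0:ℝ) < n := by exact_mod_cast (by omega : 0 < n)
      have htn : ‖(t:ℂ)‖ < 1 := by rw [Complex.norm_real, Real.norm_of_nonneg ht.le]; exact ht1
      have hC0 : 0 < C n := by linarith [hC1 n]
      have e1 := hre n t htn
      have e2 := hre' n t htn
      have hV : (Vf t ^ 2 : ℂ) = ((((1 + t) / (1 - t)) ^ 2 : ℝ) : ℂ) := by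
        unfold Vf; push_cast; ring
      rw [hV] at e1 e2
      have b1 := Sp_comp (h n) (h' n) hC (y := ((1 + t) / (1 - t)) ^ 2) (by positivity)
      have b2 := Sp_comp (h' n) (h n) hC' (y := ((1 + t) / (1 - t)) ^ 2) (by positivity)
      have c1 := hbase n
      have c2 := hbase' n
      rw [← e1, ← e2] at b1 b2
      have p1 := Sp_one_pos (h n)
      have p2 := Sp_one_pos (h' n)
      have d1 : Real.exp (g n t).re ≤ C n * C n * Real.exp (g' n t).re := by
        have := (Real.exp_pos (g' n t).re)
        refine le_of_mul_le_mul_right ?_ p1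
        calc _ ≤ _ := b1
          _ ≤ C n * (Real.exp (g' n t).re * (C n * ‖Sp n (a n) 1‖)) := by gcongr
          _ = _ := by ring
      have d2 : Real.exp (g' n t).re ≤ C n * C n * Real.exp (g n t).re := by
        have := (Real.exp_pos (g n t).re)
        refine le_of_mul_le_mul_right ?_ p2
        calc _ ≤ _ := b2
          _ ≤ C n * (Real.exp (g n t).re * (C n * ‖Sp n (a' n) 1‖)) := by gcongr
          _ = _ := by ring
      have hCC : C n * C n ≤ Real.exp (δ / 2 * n) := by
        calc _ ≤ Real.exp (δ / 4 * n) * Real.exp (δ / 4 * n) := by gcongr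
          _ = _ := by rw [← Real.exp_add]; congr 1; ring
      have f1 : (g n t).re ≤ δ / 2 * n + (g' n t).re := by
        rw [← Real.exp_le_exp, Real.exp_add]
        exact d1.trans (by gcongr)
      have f2 : (g' n t).re ≤ δ / 2 * n + (g n t).re := by
        rw [← Real.exp_le_exp, Real.exp_add]
        exact d2.trans (by gcongr)
      have i1 : g n t - g' n t = (((g n t).re - (g' n t).re : ℝ) : ℂ) := by
        apply Complex.ext <;> simp [hgi n t ht ht1, hgi' n t ht ht1]
      rw [dist_zero_right, norm_div, Complex.norm_natCast, div_lt_iff₀ hn', i1, Complex.norm_real, Real.norm_eq_abs, abs_lt]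
      have : 0 < δ * n := by positivity
      constructor <;> linarith)
    hr hr1 (ε := ε / 2) (by positivity)
  filter_upwards [V, hCe (ε / 2) (by positivity), eventually_gt_atTop 0] with n hn hCn hn0 ζ hζ
  have hz : ‖ζ‖ < 1 := hζ.trans_lt hr1
  have hn' : (0:ℝ) < n := by exact_mod_cast hn0
  have h1 := hn ζ hζ
  rw [norm_div, Complex.norm_natCast, div_le_iff₀ hn'] at h1
  have h2 := (Complex.re_le_norm _).trans h1
  rw [Complex.sub_re] at h2
  rw [← hre n ζ hz, ← hre' n ζ hz]
  have h3 : Real.exp (g n ζ).re ≤ Real.exp (ε / 2 * n) * Real.exp (g' n ζ).re := by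
    rw [← Real.exp_add, Real.exp_le_exp]; linarith
  calc _ ≤ (Real.exp (ε / 2 * n) * Real.exp (g' n ζ).re) * (Real.exp (ε / 2 * n) * ‖Sp n (a' n) 1‖) := by
        gcongr
        exact (hbase n).trans (by gcongr)
    _ = (Real.exp (ε / 2 * n) * Real.exp (ε / 2 * n)) * (Real.exp (g' n ζ).re * ‖Sp n (a' n) 1‖) := by ring
    _ = _ := by rw [← Real.exp_add]; congr 2; ring

lemma pb {b β : ℝ} (hb : b < 1) (hβ : |β| ≤ b) {j n : ℕ} (hj : j ≤ n) :
    (1 - b) / (n + 1) * j.factorial ≤ ∏ i ∈ Finset.range j, ((i : ℝ) + 1 + β) ∧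
    ∏ i ∈ Finset.range j, ((i : ℝ) + 1 + β) ≤ (n + 1) * j.factorial := by
  have hβ' := abs_le.1 hβ
  have hb0 : 0 ≤ b := (abs_nonneg _).trans hβ
  have hjn : (j : ℝ) ≤ n := by exact_mod_cast hj
  constructor
  · have key : ∀ j : ℕ, (1 - b) * (j + 1).factorial ≤ (j + 1) * ∏ i ∈ Finset.range (j + 1), ((i : ℝ) + 1 + β) := by
      intro j
      induction j with
      | zero => simp; linarith
      | succ j ih =>
        rw [Finset.prod_range_succ, Nat.factorial_succ]
        push_cast
        have hp : 0 ≤ ∏ i ∈ Finset.range (j + 1), ((i : ℝ) + 1 + β) :=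
          Finset.prod_nonneg fun i _ => by have : (0:ℝ) ≤ i := by positivity
                                           linarith
        have h2 : (j:ℝ) + 1 ≤ (j:ℝ) + 1 + 1 + β := by linarith
        calc _ = ((j:ℝ) + 1 + 1) * ((1 - b) * (j + 1).factorial) := by ring
          _ ≤ ((j:ℝ) + 1 + 1) * ((j + 1) * ∏ i ∈ Finset.range (j + 1), ((i : ℝ) + 1 + β)) := by gcongr
          _ ≤ ((j:ℝ) + 1 + 1) * (((j:ℝ) + 1 + 1 + β) * ∏ i ∈ Finset.range (j + 1), ((i : ℝ) + 1 + β)) := by gcongr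
          _ = _ := by ring
    have hp : 0 ≤ ∏ i ∈ Finset.range j, ((i : ℝ) + 1 + β) :=
          Finset.prod_nonneg fun i _ => by have : (0:ℝ) ≤ i := by positivity
                                           linarith
    rw [div_mul_eq_mul_div, div_le_iff₀ (by positivity)]
    rcases j with _ | j
    · simp; nlinarith
    · have := key j
      push_cast at hjn
      calc _ ≤ _ := this
        _ ≤ _ := by rw [mul_comm]; gcongr; linarith
  · have key : ∀ j : ℕ, ∏ i ∈ Finset.range j, ((i : ℝ) + 1 + β) ≤ (j + 1) * j.factorial := by
      intro j
      induction j with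
      | zero => simp
      | succ j ih =>
        rw [Finset.prod_range_succ, Nat.factorial_succ]
        push_cast
        have : (0:ℝ) ≤ j := by positivity
        calc _ ≤ ((j + 1) * j.factorial) * ((j:ℝ) + 1 + 1) := by
              gcongr
              · linarith
              · linarith
          _ = _ := by ring
    exact (key j).trans (by gcongr)

lemma mu_bd {b β : ℝ} (hb : b < 1) (hβ : |β| ≤ b) {j n : ℕ} (hj : j ≤ n) :
    ((1 - b) / (n + 1)) ^ 2 * mu n 0 j ≤ mu n β j ∧ mu n β j ≤ (n + 1) ^ 2 * mu n 0 j := by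
  rw [mu_zero]
  have h1 := pb hb hβ hj
  have h2 := pb hb (β := -β) (by simpa using hβ) (Nat.sub_le n j)
  have h1b : 0 < 1 - b := by linarith
  unfold mu
  simp only [← sub_eq_add_neg] at h2
  have p1 : (0:ℝ) ≤ (1 - b) / (n + 1) * j.factorial := by positivity
  have p2 : (0:ℝ) ≤ (1 - b) / (n + 1) * (n - j).factorial := by positivity
  constructor
  · calc _ = ((1 - b) / (n + 1) * j.factorial) * ((1 - b) / (n + 1) * (n - j).factorial) := by ring
      _ ≤ _ := mul_le_mul h1.1 h2.1 p2 (p1.trans h1.1)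
  · calc _ ≤ ((n + 1) * j.factorial : ℝ) * ((n + 1) * (n - j).factorial) :=
          mul_le_mul h1.2 h2.2 (p2.trans h2.1) (by positivity)
      _ = _ := by ring

/-- Lower weight constant. -/
lemma sk_bd {α : ℝ} (hα2 : |α| < 1 / 2) {n j : ℕ} (hj : j ≤ n) (k : Fin 3) :
    (((n:ℝ) + 1) ^ 6)⁻¹ * (1 / mu n 0 j) ^ 3 ≤ sk α n k j ∧
    sk α n k j ≤ ((n + 1) / (1 - 2 * |α|)) ^ 6 * (1 / mu n 0 j) ^ 3 := by
  have h1b : 0 < 1 - 2 * |α| := by linarith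
  have hk : ∀ x : ℝ, |x| ≤ 2 → |x * α| ≤ 2 * |α| := by
    intro x hx; rw [abs_mul]; gcongr
  have kx : ∀ m : ℝ, 0 ≤ m → m ≤ 2 → |((k : ℕ) : ℝ) - m| ≤ 2 := by
    intro m h0 h2
    have : ((k : ℕ) : ℝ) ≤ 2 := by exact_mod_cast (by omega : (k:ℕ) ≤ 2)
    have : (0:ℝ) ≤ ((k : ℕ) : ℝ) := by positivity
    rw [abs_le]; constructor <;> linarith
  have b0 := mu_bd (by linarith) (hk _ (kx 0 (by norm_num) (by norm_num))) hj
  have b1 := mu_bd (by linarith) (hk _ (kx 1 (by norm_num) (by norm_num))) hj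
  have b2 := mu_bd (by linarith) (hk _ (kx 2 (by norm_num) (by norm_num))) hj
  have hw : 0 < mu n 0 j := mu_pos n (by simp) j
  have p0 := mu_pos n (kb0 hα2 k) j
  have p1 := mu_pos n (kb1 hα2 k) j
  have p2 := mu_pos n (kb2 hα2 k) j
  have e : sk α n k j = (1 / mu n (((k : ℕ) - (0:ℝ)) * α) j) * (1 / mu n (((k : ℕ) - (1:ℝ)) * α) j) * (1 / mu n (((k : ℕ) - (2:ℝ)) * α) j) := by
    rw [sk]; field_simp
  rw [e]
  generalize mu n (((k : ℕ) - (0:ℝ)) * α) j = M0 at *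
  generalize mu n (((k : ℕ) - (1:ℝ)) * α) j = M1 at *
  generalize mu n (((k : ℕ) - (2:ℝ)) * α) j = M2 at *
  generalize mu n 0 j = w at *
  have lo : ∀ M, 0 < M → M ≤ ((n:ℝ) + 1) ^ 2 * w → (((n:ℝ) + 1) ^ 2)⁻¹ * (1 / w) ≤ 1 / M := by
    intro M hM h
    calc _ = 1 / (((n:ℝ) + 1) ^ 2 * w) := by field_simp
      _ ≤ _ := by gcongr
  have hi : ∀ M, 0 < M → ((1 - 2 * |α|) / ((n:ℝ) + 1)) ^ 2 * w ≤ M → 1 / M ≤ (((n:ℝ) + 1) / (1 - 2 * |α|)) ^ 2 * (1 / w) := by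
    intro M hM h
    calc _ ≤ 1 / (((1 - 2 * |α|) / ((n:ℝ) + 1)) ^ 2 * w) := by gcongr
      _ = _ := by field_simp
  constructor
  · calc _ = ((((n:ℝ) + 1) ^ 2)⁻¹ * (1 / w)) * ((((n:ℝ) + 1) ^ 2)⁻¹ * (1 / w)) * ((((n:ℝ) + 1) ^ 2)⁻¹ * (1 / w)) := by
          field_simp
      _ ≤ _ := by
          have q0 := lo M0 p0 b0.2
          have q1 := lo M1 p1 b1.2
          have q2 := lo M2 p2 b2.2
          gcongr
  · calc _ ≤ ((((n:ℝ) + 1) / (1 - 2 * |α|)) ^ 2 * (1 / w)) * ((((n:ℝ) + 1) / (1 - 2 * |α|)) ^ 2 * (1 / w)) * ((((n:ℝ) + 1) / (1 - 2 * |α|)) ^ 2 * (1 / w)) := by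
          have q0 := hi M0 p0 b0.1
          have q1 := hi M1 p1 b1.1
          have q2 := hi M2 p2 b2.1
          gcongr
      _ = _ := by ring

/-- Polynomial comparison constant. -/
noncomputable def Cn (α : ℝ) (n : ℕ) : ℝ := ((n + 1) / (1 - 2 * |α|)) ^ 6 * ((n:ℝ) + 1) ^ 6

lemma Cn_one {α : ℝ} (hα2 : |α| < 1 / 2) (n : ℕ) : 1 ≤ Cn α n := by
  have h1b : 0 < 1 - 2 * |α| := by linarith
  have h2 : (1:ℝ) ≤ n + 1 := by have : (0:ℝ) ≤ n := by positivity
                                linarith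
  have h3 : (1:ℝ) ≤ (n + 1) / (1 - 2 * |α|) := by
    rw [le_div_iff₀ h1b]; linarith [abs_nonneg α]
  exact one_le_mul_of_one_le_of_one_le (one_le_pow₀ h3) (one_le_pow₀ h2)

lemma sk_comp {α : ℝ} (hα2 : |α| < 1 / 2) {n j : ℕ} (hj : j ≤ n) (k k' : Fin 3) :
    sk α n k j ≤ Cn α n * sk α n k' j := by
  have h1b : 0 < 1 - 2 * |α| := by linarith
  refine (sk_bd hα2 hj k).2.trans ?_
  have := (sk_bd hα2 hj k').1
  rw [Cn]
  calc _ = ((n + 1) / (1 - 2 * |α|)) ^ 6 * ((n:ℝ) + 1) ^ 6 * ((((n:ℝ) + 1) ^ 6)⁻¹ * (1 / mu n 0 j) ^ 3) := by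
        field_simp
    _ ≤ _ := by gcongr

lemma poly_le_exp (A : ℝ) (d : ℕ) {ε : ℝ} (hε : 0 < ε) :
    ∀ᶠ n : ℕ in atTop, A * ((n:ℝ) + 1) ^ d ≤ Real.exp (ε * n) := by
  have h1 : Tendsto (fun x : ℝ => x ^ d / Real.exp (ε * x)) atTop (𝓝 0) := by
    have := Real.tendsto_pow_mul_exp_neg_atTop_nhds_zero d
    have h2 := this.comp (tendsto_id.const_mul_atTop hε)
    have h3 := h2.mul_const ((ε ^ d)⁻¹)
    rw [zero_mul] at h3
    refine h3.congr fun x => ?_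
    simp only [Function.comp, id, mul_pow, Real.exp_neg]
    field_simp
  have h2 : Tendsto (fun n : ℕ => A * Real.exp ε * (((n:ℝ) + 1) ^ d / Real.exp (ε * ((n:ℝ) + 1)))) atTop (𝓝 (A * Real.exp ε * 0)) := by
    refine Tendsto.const_mul _ ?_
    exact h1.comp (tendsto_atTop_add_const_right _ _ tendsto_natCast_atTop_atTop)
  rw [mul_zero] at h2
  filter_upwards [h2.eventually_le_const (zero_lt_one)] with n hn
  rw [mul_add, Real.exp_add, mul_one] at hn
  have p1 := Real.exp_pos (ε * n)
  have p2 := Real.exp_pos ε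
  have : A * Real.exp ε * (((n:ℝ) + 1) ^ d / (Real.exp (ε * n) * Real.exp ε)) = A * ((n:ℝ) + 1) ^ d / Real.exp (ε * n) := by
    field_simp
  rw [this, div_le_one p1] at hn
  exact hn

lemma compare_sk {α : ℝ} (hα2 : |α| < 1 / 2) (k k' : Fin 3) {r : ℝ} (hr : 0 < r) (hr1 : r < 1) {ε : ℝ} (hε : 0 < ε) :
    ∀ᶠ n : ℕ in atTop, ∀ ζ : ℂ, ‖ζ‖ ≤ r → ‖Sp n (sk α n k) (Vf ζ ^ 2)‖ ≤ Real.exp (ε * n) * ‖Sp n (sk α n k') (Vf ζ ^ 2)‖ := by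
  refine compare (a := fun n => sk α n k) (a' := fun n => sk α n k') (C := Cn α) (fun n => ZF_sk hα2 n k) (fun n => ZF_sk hα2 n k')
    (Cn_one hα2) (fun n j hj => sk_comp hα2 hj k k') (fun n j hj => sk_comp hα2 hj k' k) ?_ hr hr1 hε
  intro ε hε
  filter_upwards [poly_le_exp ((1 / (1 - 2 * |α|)) ^ 6) 12 hε] with n hn
  refine le_trans (le_of_eq ?_) hn
  rw [Cn]; ring

/-- Lower bound for the sum of the coefficients. -/
lemma sum_sk_lower {α : ℝ} (hα2 : |α| < 1 / 2) (n : ℕ) (k : Fin 3) :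
    (((n:ℝ) + 1) ^ 8)⁻¹ * (8 ^ n / (n.factorial : ℝ) ^ 3) ≤ ∑ j ∈ Finset.range (n + 1), sk α n k j := by
  have h1 : ∑ j ∈ Finset.range (n + 1), 1 / mu n 0 j = 2 ^ n / (n.factorial : ℝ) := by
    have : ∀ j ∈ Finset.range (n + 1), 1 / mu n 0 j = (n.choose j : ℝ) / n.factorial := by
      intro j hj
      have hj : j ≤ n := by have := Finset.mem_range.1 hj; omega
      rw [mu_zero, Nat.cast_choose ℝ hj]
      have : (n.factorial : ℝ) ≠ 0 := by positivity
      field_simp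
    rw [Finset.sum_congr rfl this, ← Finset.sum_div]
    congr 1
    exact_mod_cast Nat.sum_range_choose n
  have h2 := pow_sum_div_card_le_sum_pow (s := Finset.range (n + 1)) (f := fun j => 1 / mu n 0 j)
    (fun j _ => by have := mu_pos n (β := 0) (by simp) j; positivity) 2
  rw [h1, Finset.card_range] at h2
  calc _ = (((n:ℝ) + 1) ^ 6)⁻¹ * ((2 ^ n / (n.factorial : ℝ)) ^ (2 + 1) / ((n + 1 : ℕ) : ℝ) ^ 2) := by
        have : (8:ℝ) ^ n = (2 ^ n) ^ 3 := by rw [← pow_mul, mul_comm, pow_mul]; norm_num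
        rw [this]; push_cast; field_simp
    _ ≤ (((n:ℝ) + 1) ^ 6)⁻¹ * ∑ j ∈ Finset.range (n + 1), (1 / mu n 0 j) ^ (2 + 1) := by gcongr
    _ ≤ _ := by
        rw [Finset.mul_sum]
        apply Finset.sum_le_sum
        intro j hj
        exact (sk_bd hα2 (by have := Finset.mem_range.1 hj; omega) k).1

lemma fact3 (n : ℕ) : (27:ℝ) ^ n * (n.factorial : ℝ) ^ 3 ≤ 5 * (n + 1) * (3 * n).factorial := by
  have key : ∀ n : ℕ, (27:ℝ) ^ (n + 1) * ((n + 1).factorial : ℝ) ^ 3 ≤ 5 * (n + 1) * (3 * (n + 1)).factorial := by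
    intro n
    induction n with
    | zero => norm_num [Nat.factorial]
    | succ n ih =>
      have e1 : ((3 * (n + 1 + 1)).factorial : ℝ) = (3 * n + 6) * ((3 * n + 5) * ((3 * n + 4) * (3 * (n + 1)).factorial)) := by
        rw [show 3 * (n + 1 + 1) = 3 * (n + 1) + 1 + 1 + 1 by ring, Nat.factorial_succ, Nat.factorial_succ, Nat.factorial_succ]
        push_cast; ring
      rw [e1, Nat.factorial_succ (n + 1)]
      push_cast
      have hF : (0:ℝ) ≤ ((3 * (n + 1)).factorial : ℝ) := by positivity
      generalize ((3 * (n + 1)).factorial : ℝ) = F at *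
      generalize ((n + 1).factorial : ℝ) = G at *
      have hn : (0:ℝ) ≤ n := by positivity
      calc (27:ℝ) ^ (n + 1 + 1) * (((n:ℝ) + 1 + 1) * G) ^ 3 = 27 * ((n:ℝ) + 2) ^ 3 * (27 ^ (n + 1) * G ^ 3) := by ring
        _ ≤ 27 * ((n:ℝ) + 2) ^ 3 * (5 * (n + 1) * F) := by gcongr
        _ = 15 * F * ((n:ℝ) + 2) ^ 2 * (9 * ((n + 2) * (n + 1))) := by ring
        _ ≤ 15 * F * ((n:ℝ) + 2) ^ 2 * ((3 * n + 5) * (3 * n + 4)) :=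
            mul_le_mul_of_nonneg_left (by nlinarith) (by positivity)
        _ = _ := by ring
  rcases n with _ | n
  · norm_num
  · refine (key n).trans ?_
    push_cast
    gcongr
    linarith

/-- The logarithm of `y`. -/
noncomputable def Mf (ζ : ℂ) : ℂ := 2 * Complex.log (Vf ζ)

lemma Vf_ne {ζ : ℂ} (h : ‖ζ‖ < 1) : Vf ζ ≠ 0 := by
  intro h0; have := Vf_re h; rw [h0] at this; simp at this

lemma exp_Mf {ζ : ℂ} (h : ‖ζ‖ < 1) : Complex.exp (Mf ζ) = Vf ζ ^ 2 := by
  rw [Mf, show (2:ℂ) = ((2:ℕ):ℂ) by norm_num, Complex.exp_nat_mul, Complex.exp_log (Vf_ne h)]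

lemma Mf_diff : DifferentiableOn ℂ Mf (Metric.ball 0 1) := by
  refine DifferentiableOn.const_mul (Vf_diff.clog ?_) _
  intro ζ hζ
  exact Complex.mem_slitPlane_iff.2 (Or.inl (Vf_re (by simpa using hζ)))

/-- The normalised remainder. -/
noncomputable def GG (α : ℝ) (w : ℂ) (n : ℕ) (ζ : ℂ) : ℂ :=
  ∑ k : Fin 3, ((Bk α 2 / Bk α k : ℝ) : ℂ) * (Sp n (sk α n k) (Vf ζ ^ 2) / Sp n (sk α n 2) (Vf ζ ^ 2)) *
    Complex.exp (((k : ℕ) * α : ℝ) * (Mf ζ + w))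

lemma Sp_diff (n : ℕ) (a : ℕ → ℝ) : Differentiable ℂ (Sp n a) := by
  unfold Sp; fun_prop

lemma Sp_ne {α : ℝ} (hα2 : |α| < 1 / 2) (n : ℕ) (k : Fin 3) {ζ : ℂ} (h : ‖ζ‖ < 1) :
    Sp n (sk α n k) (Vf ζ ^ 2) ≠ 0 := (ZF_sk hα2 n k).2 _ (Vf_re h)

lemma GG_diff {α : ℝ} (hα2 : |α| < 1 / 2) (w : ℂ) (n : ℕ) :
    DifferentiableOn ℂ (GG α w n) (Metric.ball 0 1) := by
  have hS : ∀ k : Fin 3, DifferentiableOn ℂ (fun ζ => Sp n (sk α n k) (Vf ζ ^ 2)) (Metric.ball 0 1) := fun k =>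
    (Sp_diff n (sk α n k)).comp_differentiableOn (Vf_diff.pow 2)
  apply DifferentiableOn.fun_sum
  intro k _
  refine DifferentiableOn.mul (DifferentiableOn.const_mul (DifferentiableOn.div (hS k) (hS 2) ?_) _) ?_
  · intro ζ hζ; exact Sp_ne hα2 n 2 (by simpa using hζ)
  · exact ((Mf_diff.add_const w).const_mul _).cexp

lemma GG_near {α : ℝ} (hα0 : 0 < |α|) (hα2 : |α| < 1 / 2) {w : ℂ} (hw : Complex.exp w = -1) (hwn : ‖w‖ = Real.pi) (hwr : w.re = 0)
    (hb : ∀ (n : ℕ) (L : ℂ), ‖∑ k : Fin 3, (1 / (Bk α k : ℂ)) * Sp n (sk α n k) (-Complex.exp L) *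
      Complex.exp (((k : ℕ) * α : ℝ) * L)‖ ≤
        ‖L‖ ^ (3 * n + 2) / (3 * n + 2).factorial * Real.exp ((n + 1) * |L.re|)) (n : ℕ)
    {ζ : ℂ} (hζ : ‖ζ‖ ≤ 1 / 10) (hM : ‖Mf ζ‖ ≤ 1 / 4) :
    ‖GG α w n ζ‖ ≤ |Bk α 2| * 12 * 2 * 5 * (n + 1) ^ 9 * (1 / 2) ^ n := by
  have hz : ‖ζ‖ < 1 := by linarith
  have hSne := Sp_ne hα2 n 2 hz
  have heq : GG α w n ζ = (Bk α 2 : ℂ) / Sp n (sk α n 2) (Vf ζ ^ 2) * ∑ k : Fin 3, (1 / (Bk α k : ℂ)) * Sp n (sk α n k) (-Complex.exp (Mf ζ + w)) *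
      Complex.exp (((k : ℕ) * α : ℝ) * (Mf ζ + w)) := by
    rw [Complex.exp_add, hw, exp_Mf hz, mul_neg_one, neg_neg, GG, Finset.mul_sum]
    refine Finset.sum_congr rfl fun k _ => ?_
    push_cast; ring
  have hlow := (ZF_sk hα2 n 2).lower hζ (by norm_num)
  have hsum := sum_sk_lower hα2 n 2
  have hq : (1/2 : ℝ) ≤ qf (1/10) := by rw [qf]; norm_num
  have hlow2 : (1/2) ^ n * ((((n:ℝ) + 1) ^ 8)⁻¹ * (8 ^ n / (n.factorial : ℝ) ^ 3)) ≤ ‖Sp n (sk α n 2) (Vf ζ ^ 2)‖ := by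
    refine le_trans ?_ hlow
    gcongr
  have hpi : Real.pi ≤ 3.15 := Real.pi_lt_d2.le
  have hL : ‖Mf ζ + w‖ ≤ 3.4 := by
    refine (norm_add_le _ _).trans ?_
    rw [hwn]; linarith
  have hLr : |(Mf ζ + w).re| ≤ 1 / 4 := by
    rw [Complex.add_re, hwr, add_zero]
    exact (Complex.abs_re_le_norm _).trans hM
  have hexp : Real.exp ((n + 1) * |(Mf ζ + w).re|) ≤ 1.3 ^ (n + 1) := by
    have h1 : Real.exp (1 / 4) ≤ 1.3 := by
      have := Real.exp_bound' (x := 1/4) (by norm_num) (by norm_num) (n := 4) (by norm_num)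
      refine this.trans ?_
      norm_num [Finset.sum_range_succ, Nat.factorial]
    calc _ ≤ Real.exp ((n + 1) * (1 / 4)) := by gcongr
      _ = Real.exp (1 / 4) ^ (n + 1) := by rw [← Real.exp_nat_mul]; push_cast; ring_nf
      _ ≤ _ := by gcongr
  have hfac : ((3 * n).factorial : ℝ) ≤ (3 * n + 2).factorial := by
    exact_mod_cast Nat.factorial_le (by omega)
  have h27 := fact3 n
  rw [heq, norm_mul, norm_div, Complex.norm_real, Real.norm_eq_abs]
  have hfp : (0:ℝ) < (3 * n).factorial := by positivity
  have hnp : (0:ℝ) < n.factorial := by positivity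
  have hlp : 0 < (1/2:ℝ) ^ n * ((((n:ℝ) + 1) ^ 8)⁻¹ * (8 ^ n / (n.factorial : ℝ) ^ 3)) := by positivity
  calc _ ≤ |Bk α 2| / ((1/2) ^ n * ((((n:ℝ) + 1) ^ 8)⁻¹ * (8 ^ n / (n.factorial : ℝ) ^ 3))) *
        (3.4 ^ (3 * n + 2) / (3 * n).factorial * 1.3 ^ (n + 1)) := by
        gcongr
        refine (hb n _).trans ?_
        gcongr
    _ = |Bk α 2| * (3.4 ^ 2 * 1.3) * (n + 1) ^ 8 * ((3.4 ^ 3 * 1.3 / (4 * 27)) ^ n) * ((27 ^ n * (n.factorial : ℝ) ^ 3) / (3 * n).factorial) := by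
        have hid : (3.4 ^ 3 * 1.3 / (4 * 27) : ℝ) ^ n * 27 ^ n * (1 / 2) ^ n * 8 ^ n = (3.4 ^ 3) ^ n * 1.3 ^ n := by
          rw [← mul_pow, ← mul_pow, ← mul_pow, ← mul_pow]; norm_num
        rw [pow_add, pow_mul, pow_succ (1.3:ℝ)]
        have h2p : (0:ℝ) < (1 / 2) ^ n := by positivity
        generalize (3.4 ^ 3 * 1.3 / (4 * 27) : ℝ) ^ n = a1 at *
        generalize ((3.4:ℝ) ^ 3) ^ n = a2 at *
        generalize ((1.3:ℝ)) ^ n = a3 at *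
        generalize ((1 / 2:ℝ)) ^ n = a4 at *
        have h8p : (0:ℝ) < 8 ^ n := by positivity
        generalize (8:ℝ) ^ n = a5 at *
        field_simp
        linear_combination (-|Bk α 2|) * hid
    _ ≤ |Bk α 2| * (12 * 2) * (n + 1) ^ 8 * ((1/2) ^ n) * (5 * (n + 1)) := by
        have h1 : (3.4 ^ 2 * 1.3 : ℝ) ≤ 12 * 2 := by norm_num
        have h2 : (3.4 ^ 3 * 1.3 / (4 * 27) : ℝ) ≤ 1 / 2 := by norm_num
        have h3 : (27 ^ n * (n.factorial : ℝ) ^ 3) / (3 * n).factorial ≤ 5 * (n + 1) := by rwa [div_le_iff₀ hfp]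
        exact mul_le_mul (mul_le_mul (mul_le_mul_of_nonneg_right (mul_le_mul_of_nonneg_left h1 (abs_nonneg _)) (by positivity))
          (pow_le_pow_left₀ (by norm_num) h2 n) (by positivity) (by positivity)) h3 (by positivity) (by positivity)
    _ = _ := by ring

lemma Mf_zero : Mf 0 = 0 := by simp [Mf, Vf]

lemma Mf_bdd {R : ℝ} (hR : R < 1) : ∃ C, 0 ≤ C ∧ ∀ ζ, ‖ζ‖ ≤ R → ‖Mf ζ‖ ≤ C := by
  obtain ⟨C, hC⟩ := (isCompact_closedBall (0:ℂ) R).exists_bound_of_continuousOn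
    (Mf_diff.continuousOn.mono (Metric.closedBall_subset_ball hR))
  exact ⟨max C 0, le_max_right _ _, fun ζ h => (hC ζ (by simpa using h)).trans (le_max_left _ _)⟩

lemma Bk_ratio {α : ℝ} (hα0 : 0 < |α|) (k : Fin 3) : |Bk α 2 / Bk α k| ≤ 2 := by
  have : α ≠ 0 := abs_pos.1 hα0
  have h2 : α ^ 2 ≠ 0 := pow_ne_zero 2 this
  fin_cases k <;> simp [Bk]
  · field_simp; norm_num
  · rw [abs_div]; simp; field_simp; norm_num
  · field_simp; norm_num

lemma GG_small {α : ℝ} (hα0 : 0 < |α|) (hα2 : |α| < 1 / 2) {w : ℂ} (hw : Complex.exp w = -1) (hwn : ‖w‖ = Real.pi) (hwr : w.re = 0)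
    (hb : ∀ (n : ℕ) (L : ℂ), ‖∑ k : Fin 3, (1 / (Bk α k : ℂ)) * Sp n (sk α n k) (-Complex.exp L) *
      Complex.exp (((k : ℕ) * α : ℝ) * L)‖ ≤
        ‖L‖ ^ (3 * n + 2) / (3 * n + 2).factorial * Real.exp ((n + 1) * |L.re|))
    {r : ℝ} (hr : 0 < r) (hr1 : r < 1) {η : ℝ} (hη : 0 < η) :
    ∀ᶠ n in atTop, ∀ ζ, ‖ζ‖ ≤ r → ‖GG α w n ζ‖ ≤ η := by
  have hl2 : 0 < Real.log 2 := Real.log_pos (by norm_num)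
  have hcont : ContinuousAt Mf 0 := (Mf_diff.differentiableAt (Metric.ball_mem_nhds _ one_pos)).continuousAt
  obtain ⟨ρ, hρ, hρM⟩ := Metric.continuousAt_iff.1 hcont (1/4) (by norm_num)
  refine two_const (fun n => GG_diff hα2 w n) (r₀ := min (ρ / 2) (1 / 10)) (c := Real.log 2 / 2) (by positivity) (by positivity) ?_ ?_ hr hr1 hη
  · filter_upwards [poly_le_exp (|Bk α 2| * 12 * 2 * 5) 9 (half_pos hl2)] with n hn ζ hζ
    have h1 : ‖ζ‖ ≤ 1 / 10 := hζ.trans (min_le_right _ _)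
    have h2 : ‖Mf ζ‖ ≤ 1 / 4 := by
      have := @hρM ζ (by rw [dist_zero_right]; exact (hζ.trans (min_le_left _ _)).trans_lt (by linarith))
      rw [Mf_zero, dist_zero_right] at this; exact this.le
    refine (GG_near hα0 hα2 hw hwn hwr hb n h1 h2).trans ?_
    have e : ((1:ℝ) / 2) ^ n = Real.exp (-(Real.log 2 * n)) := by
      rw [Real.exp_neg, mul_comm, Real.exp_nat_mul, Real.exp_log (by norm_num)]; simp
    calc _ ≤ Real.exp (Real.log 2 / 2 * n) * (1 / 2) ^ n := by gcongr
      _ = _ := by rw [e, ← Real.exp_add]; congr 1; ring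
  · intro R hR hR1 ε hε
    obtain ⟨C, hC0, hC⟩ := Mf_bdd hR1
    have hcs : ∀ k : Fin 3, _ := fun k => compare_sk hα2 k 2 hR hR1 (half_pos hε)
    have hall := (eventually_all (ι := Fin 3)).2 hcs
    filter_upwards [hall, poly_le_exp (3 * (2 * Real.exp (C + Real.pi))) 0 (half_pos hε)] with n hn hn2 ζ hζ
    have hz : ‖ζ‖ < 1 := hζ.trans_lt hR1
    have hterm : ∀ k : Fin 3, ‖((Bk α 2 / Bk α k : ℝ) : ℂ) * (Sp n (sk α n k) (Vf ζ ^ 2) / Sp n (sk α n 2) (Vf ζ ^ 2)) *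
        Complex.exp (((k : ℕ) * α : ℝ) * (Mf ζ + w))‖ ≤ 2 * Real.exp (ε / 2 * n) * Real.exp (C + Real.pi) := by
      intro k
      rw [norm_mul, norm_mul, Complex.norm_real, Real.norm_eq_abs]
      have hpos : 0 < ‖Sp n (sk α n 2) (Vf ζ ^ 2)‖ := norm_pos_iff.2 (Sp_ne hα2 n 2 hz)
      have h1 := Bk_ratio hα0 k
      have h2 : ‖Sp n (sk α n k) (Vf ζ ^ 2) / Sp n (sk α n 2) (Vf ζ ^ 2)‖ ≤ Real.exp (ε / 2 * n) := by
        rw [norm_div, div_le_iff₀ hpos]; exact hn k ζ hζ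
      have h3 : ‖Complex.exp (((k : ℕ) * α : ℝ) * (Mf ζ + w))‖ ≤ Real.exp (C + Real.pi) := by
        rw [Complex.norm_exp]
        apply Real.exp_le_exp.2
        refine (Complex.re_le_norm _).trans ?_
        rw [norm_mul, Complex.norm_real, Real.norm_eq_abs, abs_mul]
        have hk : |((k:ℕ):ℝ)| ≤ 2 := by
          rw [abs_of_nonneg (by positivity)]; exact_mod_cast (by omega : (k:ℕ) ≤ 2)
        have hk2 : |((k:ℕ):ℝ)| * |α| ≤ 1 := by nlinarith [abs_nonneg α]
        have : ‖Mf ζ + w‖ ≤ C + Real.pi := (norm_add_le _ _).trans (by rw [hwn]; linarith [hC ζ hζ])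
        nlinarith [norm_nonneg (Mf ζ + w)]
      gcongr
    refine (norm_sum_le _ _).trans ((Finset.sum_le_sum fun k _ => hterm k).trans ?_)
    rw [Finset.sum_const, Finset.card_univ, Fintype.card_fin, nsmul_eq_mul]
    calc _ = Real.exp (ε / 2 * n) * (3 * (2 * Real.exp (C + Real.pi)) * ((n:ℝ) + 1) ^ 0) := by push_cast; ring
      _ ≤ Real.exp (ε / 2 * n) * Real.exp (ε / 2 * n) := by gcongr
      _ = _ := by rw [← Real.exp_add]; congr 1; ring

/-- Normalised ratio. -/
noncomputable def pk (α : ℝ) (n : ℕ) (k : Fin 3) (ζ : ℂ) : ℂ :=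
  ((Bk α 2 / Bk α k : ℝ) : ℂ) * (Sp n (sk α n k) (Vf ζ ^ 2) / Sp n (sk α n 2) (Vf ζ ^ 2))

lemma GG_eq {α : ℝ} (hα0 : 0 < |α|) (hα2 : |α| < 1 / 2) (w : ℂ) (n : ℕ) {ζ : ℂ} (hζ : ‖ζ‖ < 1) :
    GG α w n ζ = pk α n 0 ζ + pk α n 1 ζ * (Complex.exp (α * Mf ζ) * Complex.exp (α * w)) +
      (Complex.exp (α * Mf ζ) * Complex.exp (α * w)) ^ 2 := by
  have h2 : pk α n 2 ζ = 1 := by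
    rw [pk, div_self (Bk_ne hα0 2), div_self (Sp_ne hα2 n 2 hζ)]; simp
  have e : ∀ k : ℕ, Complex.exp (((k * α : ℝ) : ℂ) * (Mf ζ + w)) = (Complex.exp (α * Mf ζ) * Complex.exp (α * w)) ^ k := by
    intro k
    rw [← Complex.exp_add, ← Complex.exp_nat_mul]; congr 1; push_cast; ring
  have : GG α w n ζ = ∑ k : Fin 3, pk α n k ζ * (Complex.exp (α * Mf ζ) * Complex.exp (α * w)) ^ (k:ℕ) := by
    rw [GG]; refine Finset.sum_congr rfl fun k _ => ?_
    rw [e, pk]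
  rw [this, Fin.sum_univ_three, h2]; simp

lemma pk_conv {α : ℝ} (hα0 : 0 < |α|) (hα2 : |α| < 1 / 2)
    (hb : ∀ (n : ℕ) (L : ℂ), ‖∑ k : Fin 3, (1 / (Bk α k : ℂ)) * Sp n (sk α n k) (-Complex.exp L) *
      Complex.exp (((k : ℕ) * α : ℝ) * L)‖ ≤
        ‖L‖ ^ (3 * n + 2) / (3 * n + 2).factorial * Real.exp ((n + 1) * |L.re|))
    {r : ℝ} (hr : 0 < r) (hr1 : r < 1) {η : ℝ} (hη : 0 < η) :
    ∀ᶠ n in atTop, ∀ ζ, ‖ζ‖ ≤ r →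
      ‖pk α n 1 ζ + ((2 * Real.cos (α * Real.pi) : ℝ) : ℂ) * Complex.exp (α * Mf ζ)‖ ≤ η ∧
      ‖pk α n 0 ζ - Complex.exp (α * Mf ζ) ^ 2‖ ≤ η := by
  obtain ⟨C, hC0, hC⟩ := Mf_bdd hr1
  set w : ℂ := Real.pi * Complex.I with hw
  set E₁ : ℂ := Complex.exp (α * w) with hE1
  set E₂ : ℂ := Complex.exp (α * (-w)) with hE2
  have hprod : E₁ * E₂ = 1 := by rw [hE1, hE2, ← Complex.exp_add]; simp
  have hn1 : ‖E₁‖ = 1 := by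
    rw [hE1, hw, ← mul_assoc, ← Complex.ofReal_mul, Complex.norm_exp_ofReal_mul_I]
  have hn2 : ‖E₂‖ = 1 := by
    rw [hE2, hw, ← neg_mul, ← mul_assoc, ← Complex.ofReal_neg, ← Complex.ofReal_mul, Complex.norm_exp_ofReal_mul_I]
  have hcos : E₁ + E₂ = ((2 * Real.cos (α * Real.pi) : ℝ) : ℂ) := by
    rw [Complex.ofReal_mul, Complex.ofReal_cos, Complex.cos, hE1, hE2, hw]
    push_cast; ring_nf
  set D : ℂ := E₁ - E₂ with hD
  have hDne : D ≠ 0 := by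
    have : D = 2 * Real.sin (α * Real.pi) * Complex.I := by
      rw [hD, hE1, hE2, hw, show (α:ℂ) * (Real.pi * Complex.I) = (α * Real.pi : ℝ) * Complex.I by push_cast; ring,
        show (α:ℂ) * -(Real.pi * Complex.I) = -(α * Real.pi : ℝ) * Complex.I by push_cast; ring,
        Complex.exp_mul_I, Complex.exp_mul_I, Complex.cos_neg, Complex.sin_neg, Complex.ofReal_sin]
      ring
    rw [this]
    have hs : Real.sin (α * Real.pi) ≠ 0 := by
      have hα : α ≠ 0 := abs_pos.1 hα0
      have hpi := Real.pi_pos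
      have := abs_lt.1 hα2
      intro h0
      rw [Real.sin_eq_zero_iff_of_lt_of_lt (by nlinarith) (by nlinarith)] at h0
      exact (mul_ne_zero hα hpi.ne') h0
    exact mul_ne_zero (mul_ne_zero two_ne_zero (by exact_mod_cast hs)) Complex.I_ne_zero
  have hDp : 0 < ‖D‖ := norm_pos_iff.2 hDne
  have hnw : ‖w‖ = Real.pi := by rw [hw]; simp [abs_of_pos Real.pi_pos]
  set δ : ℝ := η * ‖D‖ / (2 * Real.exp C) with hδ
  have hδp : 0 < δ := by positivity
  have g1 := GG_small hα0 hα2 (w := w) Complex.exp_pi_mul_I hnw (by simp [hw]) hb hr hr1 hδp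
  have g2 := GG_small hα0 hα2 (w := -w) (by rw [Complex.exp_neg, Complex.exp_pi_mul_I]; norm_num)
    (by rw [norm_neg, hnw]) (by simp [hw]) hb hr hr1 hδp
  filter_upwards [g1, g2] with n h1 h2 ζ hζ
  have hz : ‖ζ‖ < 1 := hζ.trans_lt hr1
  have k1 := h1 ζ hζ
  have k2 := h2 ζ hζ
  have hXne : Complex.exp (α * Mf ζ) ≠ 0 := Complex.exp_ne_zero _
  have hXlow : Real.exp (-C) ≤ ‖Complex.exp (α * Mf ζ)‖ := by
    rw [Complex.norm_exp]
    apply Real.exp_le_exp.2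
    have h3 : ‖(α:ℂ) * Mf ζ‖ ≤ C := by
      rw [norm_mul, Complex.norm_real, Real.norm_eq_abs]
      nlinarith [hC ζ hζ, norm_nonneg (Mf ζ), abs_nonneg α]
    have := (abs_le.1 (Complex.abs_re_le_norm ((α:ℂ) * Mf ζ))).1
    linarith
  have ge1 := GG_eq hα0 hα2 w n hz
  have ge2 := GG_eq hα0 hα2 (-w) n hz
  rw [← hE1] at ge1
  rw [← hE2] at ge2
  generalize Complex.exp (α * Mf ζ) = X at *
  generalize GG α w n ζ = G₁ at *
  generalize GG α (-w) n ζ = G₂ at *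
  rw [← hcos]
  have hexp1 : 1 ≤ Real.exp C := Real.one_le_exp hC0
  have hδ2 : 2 * δ * Real.exp C = η * ‖D‖ := by rw [hδ]; field_simp
  constructor
  · have e : (pk α n 1 ζ + (E₁ + E₂) * X) * (X * D) = G₁ - G₂ := by
      rw [ge1, ge2, hD]; ring
    have hn : ‖pk α n 1 ζ + (E₁ + E₂) * X‖ * (‖X‖ * ‖D‖) ≤ 2 * δ := by
      rw [← norm_mul, ← norm_mul, e]
      exact (norm_sub_le _ _).trans (by linarith)
    rw [Real.exp_neg] at hXlow
    have h4 : 1 ≤ ‖X‖ * Real.exp C := by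
      rw [inv_le_iff_one_le_mul₀ (Real.exp_pos C)] at hXlow; exact hXlow
    have h5 : ‖pk α n 1 ζ + (E₁ + E₂) * X‖ * ‖D‖ ≤ η * ‖D‖ := by
      calc _ ≤ ‖pk α n 1 ζ + (E₁ + E₂) * X‖ * ‖D‖ * (‖X‖ * Real.exp C) := le_mul_of_one_le_right (by positivity) h4
        _ = (‖pk α n 1 ζ + (E₁ + E₂) * X‖ * (‖X‖ * ‖D‖)) * Real.exp C := by ring
        _ ≤ 2 * δ * Real.exp C := by gcongr
        _ = _ := hδ2
    exact le_of_mul_le_mul_right h5 hDp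
  · have e : (pk α n 0 ζ - X ^ 2) * D = E₁ * G₂ - E₂ * G₁ := by
      rw [ge1, ge2, hD]
      linear_combination (- X ^ 2 * E₂ + X ^ 2 * E₁) * hprod
    have hn : ‖pk α n 0 ζ - X ^ 2‖ * ‖D‖ ≤ η * ‖D‖ := by
      rw [← norm_mul, e]
      refine (norm_sub_le _ _).trans ?_
      rw [norm_mul, norm_mul, hn1, hn2]
      nlinarith
    exact le_of_mul_le_mul_right hn hDp

/-- The point `z` attached to `ζ`. -/
noncomputable def zz (ζ : ℂ) : ℂ := -2 * ζ / (1 + ζ ^ 2)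

lemma sq_ne {ζ : ℂ} (h : ‖ζ‖ < 1) : 1 + ζ ^ 2 ≠ 0 := by
  apply one_add_ne
  rw [norm_pow]; exact pow_lt_one₀ (norm_nonneg _) h two_ne_zero

lemma zz_mem {ζ : ℂ} (h : ‖ζ‖ < 1) : ¬ ((zz ζ).im = 0 ∧ 1 ≤ |(zz ζ).re|) := by
  rintro ⟨him, hre⟩
  have h2 : ‖-ζ ^ 2‖ < 1 := by
    rw [norm_neg, norm_pow]; exact pow_lt_one₀ (norm_nonneg _) h two_ne_zero
  have hs := Vf_re h2
  have e : Vf (-ζ ^ 2) ^ 2 = 1 - zz ζ ^ 2 := by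
    rw [Vf, zz, sub_neg_eq_add]
    have := sq_ne h
    field_simp; ring
  have ez : zz ζ = ((zz ζ).re : ℂ) := by
    apply Complex.ext <;> simp [him]
  rw [ez] at e
  have e1 := congrArg Complex.re e
  have e2 := congrArg Complex.im e
  simp [pow_two] at e1 e2
  have h1 : 1 ≤ (zz ζ).re ^ 2 := (one_le_sq_iff_one_le_abs _).2 hre
  rw [show -ζ ^ 2 = -(ζ * ζ) by ring] at hs
  generalize (Vf (-(ζ * ζ))) = s at *
  have h3 : s.im = 0 := by
    rcases mul_eq_zero.1 (by linarith : s.re * s.im = 0) with h | h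
    · exact absurd h hs.ne'
    · exact h
  rw [h3] at e1
  nlinarith

lemma f0_zz {α : ℝ} (f₀ : ℂ → ℂ)
    (hf₀_dom : DifferentiableOn ℂ f₀ {z : ℂ | ¬(z.im = 0 ∧ 1 ≤ |z.re|)})
    (hf₀_pearson : ∀ z ∈ {z : ℂ | ¬(z.im = 0 ∧ 1 ≤ |z.re|)},
      (z ^ 2 - 1) * deriv f₀ z = 2 * (α : ℂ) * f₀ z)
    (hf₀_0 : f₀ 0 = 1) {ζ : ℂ} (hζ : ‖ζ‖ < 1) :
    f₀ (zz ζ) = Complex.exp (α * Mf ζ) := by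
  have hopen : IsOpen {z : ℂ | ¬(z.im = 0 ∧ 1 ≤ |z.re|)} := by
    have : IsClosed {z : ℂ | z.im = 0 ∧ 1 ≤ |z.re|} :=
      (isClosed_eq Complex.continuous_im continuous_const).inter
        (isClosed_le continuous_const Complex.continuous_re.abs)
    exact this.isOpen_compl
  have hder : ∀ ζ : ℂ, ‖ζ‖ < 1 → HasDerivAt (fun ζ => f₀ (zz ζ) * Complex.exp (-(α * Mf ζ))) 0 ζ := by
    intro ζ hζ
    have hne := sq_ne hζ
    have h1 := one_sub_ne hζ
    have h2 := one_add_ne hζ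
    have hz : HasDerivAt zz ((-2 * (1 - ζ ^ 2)) / (1 + ζ ^ 2) ^ 2) ζ := by
      have := ((hasDerivAt_id ζ).const_mul (-2 : ℂ)).div (((hasDerivAt_id ζ).pow 2).const_add 1) hne
      refine this.congr_deriv ?_
      simp; field_simp; ring
    have hV : HasDerivAt Vf (2 / (1 - ζ) ^ 2) ζ := by
      have := ((hasDerivAt_id ζ).const_add 1).div ((hasDerivAt_id ζ).const_sub 1) h1
      refine this.congr_deriv ?_
      simp; field_simp; ring
    have hM : HasDerivAt Mf (4 / (1 - ζ ^ 2)) ζ := by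
      have := (hV.clog (Complex.mem_slitPlane_iff.2 (Or.inl (Vf_re hζ)))).const_mul (2:ℂ)
      refine this.congr_deriv ?_
      have h3 : 1 - ζ ^ 2 ≠ 0 := by
        rw [show 1 - ζ ^ 2 = (1 - ζ) * (1 + ζ) by ring]; exact mul_ne_zero h1 h2
      rw [Vf]; field_simp; ring
    have hmem : zz ζ ∈ {z : ℂ | ¬(z.im = 0 ∧ 1 ≤ |z.re|)} := zz_mem hζ
    have hf := (hf₀_dom.differentiableAt (hopen.mem_nhds hmem)).hasDerivAt
    have hp := hf₀_pearson _ hmem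
    have hc := (hf.comp ζ hz).mul ((hM.const_mul (α:ℂ)).neg.cexp)
    refine hc.congr_deriv ?_
    have h3 : 1 - ζ ^ 2 ≠ 0 := by
      rw [show 1 - ζ ^ 2 = (1 - ζ) * (1 + ζ) by ring]; exact mul_ne_zero h1 h2
    have hzs : zz ζ ^ 2 - 1 = -((1 - ζ ^ 2) / (1 + ζ ^ 2)) ^ 2 := by
      rw [zz]; field_simp; ring
    rw [hzs] at hp
    have hd : deriv f₀ (zz ζ) = -(2 * α * f₀ (zz ζ)) * (1 + ζ ^ 2) ^ 2 / (1 - ζ ^ 2) ^ 2 := by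
      rw [← hp]; field_simp
    simp only [Function.comp]
    rw [hd]
    field_simp
    ring
  have hconst := (convex_ball (0:ℂ) 1).is_const_of_fderivWithin_eq_zero (𝕜 := ℂ)
    (f := fun ζ => f₀ (zz ζ) * Complex.exp (-(α * Mf ζ)))
    (fun x hx => (hder x (by simpa using hx)).differentiableAt.differentiableWithinAt)
    (fun x hx => by
      rw [fderivWithin_of_isOpen Metric.isOpen_ball hx]
      have := (hder x (by simpa using hx)).hasFDerivAt.fderiv
      rw [this]; ext; simp)
    (x := ζ) (y := 0) (by simpa using hζ) (by simp)
  have h0 : zz 0 = 0 := by simp [zz]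
  simp only [h0, hf₀_0, Mf_zero] at hconst
  rw [Complex.exp_neg] at hconst
  have := Complex.exp_ne_zero (α * Mf ζ)
  field_simp at hconst
  simpa using hconst

/-- The inverse map. -/
noncomputable def zi (z : ℂ) : ℂ := -z / (1 + Complex.exp (Complex.log (1 - z ^ 2) / 2))

lemma slit_of {z : ℂ} (hz : ¬(z.im = 0 ∧ 1 ≤ |z.re|)) : 1 - z ^ 2 ∈ Complex.slitPlane := by
  rw [Complex.mem_slitPlane_iff]
  by_contra! hcon
  obtain ⟨h1, h2⟩ := hcon
  simp [pow_two] at h1 h2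
  have h3 : z.re * z.im = 0 := by linarith
  rcases mul_eq_zero.1 h3 with h | h
  · rw [h] at h1; nlinarith
  · exact hz ⟨h, (one_le_sq_iff_one_le_abs _).1 (by rw [h] at h1; nlinarith)⟩

lemma sqrt_re {z : ℂ} (hz : z ∈ Complex.slitPlane) : 0 < (Complex.exp (Complex.log z / 2)).re := by
  rw [Complex.exp_re]
  apply mul_pos (Real.exp_pos _)
  have h1 := Complex.mem_slitPlane_iff_arg.1 hz
  have h2 := Complex.neg_pi_lt_arg z
  have h3 := (Complex.arg_le_pi z).lt_of_ne h1.1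
  have e : (Complex.log z / 2).im = z.arg / 2 := by
    rw [show (Complex.log z / 2) = Complex.log z / (2:ℝ) by norm_num, Complex.div_ofReal_im, Complex.log_im]
  rw [e]
  exact Real.cos_pos_of_mem_Ioo ⟨by linarith, by linarith⟩

lemma sqrt_sq {z : ℂ} (hz : z ∈ Complex.slitPlane) : Complex.exp (Complex.log z / 2) ^ 2 = z := by
  rw [← Complex.exp_nat_mul, show ((2:ℕ):ℂ) * (Complex.log z / 2) = Complex.log z by push_cast; ring,
    Complex.exp_log (Complex.slitPlane_ne_zero hz)]

lemma one_add_ne_of_re {s : ℂ} (h : 0 < s.re) : 1 + s ≠ 0 := by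
  intro h0
  have := congrArg Complex.re h0
  simp at this; linarith

lemma zi_props {z : ℂ} (hz : ¬(z.im = 0 ∧ 1 ≤ |z.re|)) : ‖zi z‖ < 1 ∧ zz (zi z) = z ∧ ContinuousAt zi z := by
  have hsl := slit_of hz
  have hre := sqrt_re hsl
  have hsq := sqrt_sq hsl
  have hcont : ContinuousAt zi z := by
    have h1 : ContinuousAt (fun z : ℂ => Complex.log (1 - z ^ 2)) z :=
      ContinuousAt.clog (by fun_prop) hsl
    have h2 : ContinuousAt (fun z : ℂ => 1 + Complex.exp (Complex.log (1 - z ^ 2) / 2)) z :=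
      continuousAt_const.add ((h1.div_const 2).cexp)
    exact ContinuousAt.div continuous_neg.continuousAt h2 (one_add_ne_of_re hre)
  refine ⟨?_, ?_, hcont⟩
  · rw [zi]
    generalize Complex.exp (Complex.log (1 - z ^ 2) / 2) = s at *
    have hne := one_add_ne_of_re hre
    have h2 : (-z / (1 + s)) ^ 2 = (1 - s) / (1 + s) := by
      field_simp
      linear_combination hsq
    have h3 : ‖-z / (1 + s)‖ ^ 2 < 1 := by
      rw [← norm_pow, h2, norm_div, div_lt_one (norm_pos_iff.2 hne)]
      rw [← sq_lt_sq₀ (norm_nonneg _) (norm_nonneg _), ← Complex.normSq_eq_norm_sq, ← Complex.normSq_eq_norm_sq,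
        Complex.normSq_apply, Complex.normSq_apply]
      simp; nlinarith
    nlinarith [norm_nonneg (-z / (1 + s))]
  · rw [zz, zi]
    generalize Complex.exp (Complex.log (1 - z ^ 2) / 2) = s at *
    have hne := one_add_ne_of_re hre
    have h2 : (-z / (1 + s)) ^ 2 = (1 - s) / (1 + s) := by
      field_simp
      linear_combination hsq
    rw [h2]
    have h3 : 1 + (1 - s) / (1 + s) = 2 / (1 + s) := by field_simp; ring
    rw [h3]; field_simp

lemma ratio_eq {α : ℝ} (hα0 : 0 < |α|) (hα2 : |α| < 1 / 2) {n : ℕ} {Q : Fin 3 → Polynomial ℂ}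
    (hdeg : ∀ k, (Q k).natDegree ≤ n) {K : ℂ} (hK : K ≠ 0)
    (h : ∀ k y, (Pn n (Q k)).eval (-y) = K / Bk α k * Sp n (sk α n k) y) {ζ : ℂ} (hζ : ‖ζ‖ < 1) (k : Fin 3) :
    (Q k).eval (zz ζ) / (Q 2).eval (zz ζ) = pk α n k ζ := by
  have h1 := one_sub_ne hζ
  have hs := sq_ne hζ
  have hy : 1 - -(Vf ζ ^ 2) ≠ 0 := by
    rw [Vf]
    have : 1 - -((1 + ζ) / (1 - ζ)) ^ 2 = 2 * (1 + ζ ^ 2) / (1 - ζ) ^ 2 := by field_simp; ring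
    rw [this]
    exact div_ne_zero (mul_ne_zero two_ne_zero hs) (pow_ne_zero 2 h1)
  have hzz : (1 + -(Vf ζ ^ 2)) / (1 - -(Vf ζ ^ 2)) = zz ζ := by
    rw [div_eq_iff hy, zz, Vf]
    field_simp; ring
  have e : ∀ k, (Q k).eval (zz ζ) = K / Bk α k * Sp n (sk α n k) (Vf ζ ^ 2) / (1 - -(Vf ζ ^ 2)) ^ n := by
    intro k
    rw [← h, Pn_eval (hdeg k) hy, hzz]
    have := pow_ne_zero n hy
    field_simp
  rw [e, e, pk]
  have := pow_ne_zero n hy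
  have hS := Sp_ne hα2 n 2 hζ
  have hB2 : (Bk α 2 : ℂ) ≠ 0 := by exact_mod_cast Bk_ne hα0 2
  have hBk : (Bk α k : ℂ) ≠ 0 := by exact_mod_cast Bk_ne hα0 k
  push_cast
  field_simp

lemma transfer {P : ℕ → ℂ → ℂ} {g : ℂ → ℂ}
    (h : ∀ r, 0 < r → r < 1 → ∀ η > 0, ∀ᶠ n in atTop, ∀ ζ, ‖ζ‖ ≤ r → ‖P n (zz ζ) - g (zz ζ)‖ ≤ η) :
    TendstoLocallyUniformlyOn P g atTop {z : ℂ | ¬(z.im = 0 ∧ 1 ≤ |z.re|)} := by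
  rw [Metric.tendstoLocallyUniformlyOn_iff]
  intro ε hε z hz
  obtain ⟨h1, h2, h3⟩ := zi_props hz
  obtain ⟨r, hr, hr1⟩ := exists_between h1
  have hev : ∀ᶠ x in 𝓝 z, ‖zi x‖ < r := h3.norm.eventually (gt_mem_nhds hr)
  refine ⟨{x | ‖zi x‖ < r} ∩ {z : ℂ | ¬(z.im = 0 ∧ 1 ≤ |z.re|)}, inter_mem (mem_nhdsWithin_of_mem_nhds hev) self_mem_nhdsWithin, ?_⟩
  filter_upwards [h r ((norm_nonneg _).trans_lt hr) hr1 (ε / 2) (half_pos hε)] with n hn x hx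
  have := hn (zi x) (le_of_lt hx.1)
  rw [(zi_props hx.2).2.1] at this
  rw [dist_comm, dist_eq_norm]
  linarith

/-- With `f` the branch of `((z−1)/(z+1))^α` (`α ∈ ℝ`, `|α| ∈ (0,1/2)`) on
`ℂ∖[−1,1]` with `f(∞)=1`, `f₀` the branch of `((1−z)/(1+z))^α` on `ℂ∖F` with `f₀(0)=1`,
and `Q_{n,0}, Q_{n,1}, Q_{n,2}` type I Hermite–Padé polynomials of order `n` for
`(1,f,f²)`, the ratios `Q_{n,1}/Q_{n,2}` converge to `−2cos(απ) f₀` and `Q_{n,0}/Q_{n,2}`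
converge to `f₀²`, locally uniformly on `ℂ∖F`. -/
theorem stmt_7 (α : ℝ) (hα0 : 0 < |α|) (hα2 : |α| < 1 / 2)
    (f : ℂ → ℂ)
    (hf_dom : DifferentiableOn ℂ f {z : ℂ | ¬(z.im = 0 ∧ |z.re| ≤ 1)})
    (hf_pearson : ∀ z ∈ {z : ℂ | ¬(z.im = 0 ∧ |z.re| ≤ 1)},
      (z ^ 2 - 1) * deriv f z = 2 * (α : ℂ) * f z)
    (hf_inf : Tendsto f (cobounded ℂ) (𝓝 1))
    (f₀ : ℂ → ℂ)
    (hf₀_dom : DifferentiableOn ℂ f₀ {z : ℂ | ¬(z.im = 0 ∧ 1 ≤ |z.re|)})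
    (hf₀_pearson : ∀ z ∈ {z : ℂ | ¬(z.im = 0 ∧ 1 ≤ |z.re|)},
      (z ^ 2 - 1) * deriv f₀ z = 2 * (α : ℂ) * f₀ z)
    (hf₀_0 : f₀ 0 = 1)
    (Q : ℕ → Fin 3 → Polynomial ℂ)
    (hQ : ∀ n, ∃ k, Q n k ≠ 0)
    (hdeg : ∀ n k, (Q n k).natDegree ≤ n)
    (hHP : ∀ n, (fun z : ℂ =>
        (Q n 0).eval z + (Q n 1).eval z * f z + (Q n 2).eval z * f z ^ 2)
      =O[cobounded ℂ] fun z => (z ^ (2 * n + 2))⁻¹) :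
    TendstoLocallyUniformlyOn (fun (n : ℕ) (z : ℂ) => (Q n 1).eval z / (Q n 2).eval z)
      (fun z => -((2 * Real.cos (α * Real.pi) : ℝ) : ℂ) * f₀ z) atTop
      {z : ℂ | ¬(z.im = 0 ∧ 1 ≤ |z.re|)} ∧
    TendstoLocallyUniformlyOn (fun (n : ℕ) (z : ℂ) => (Q n 0).eval z / (Q n 2).eval z)
      (fun z => f₀ z ^ 2) atTop
      {z : ℂ | ¬(z.im = 0 ∧ 1 ≤ |z.re|)} := by
  have hc := fun n => hp_coeffs α hα0 hα2 f hf_dom hf_pearson hf_inf n (Q n) (hQ n) (hdeg n) (hHP n)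
  choose K hK hS hL using hc
  have hb : ∀ (n : ℕ) (L : ℂ), ‖∑ k : Fin 3, (1 / (Bk α k : ℂ)) * Sp n (sk α n k) (-Complex.exp L) *
      Complex.exp (((k : ℕ) * α : ℝ) * L)‖ ≤
        ‖L‖ ^ (3 * n + 2) / (3 * n + 2).factorial * Real.exp ((n + 1) * |L.re|) := by
    intro n L
    have hKp : 0 < ‖K n‖ := norm_pos_iff.2 (hK n)
    have h1 := hL n L
    have h2 : ∑ k : Fin 3, (Pn n (Q n k)).eval (Complex.exp L) * Complex.exp (((k : ℕ) * α : ℝ) * L) =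
        K n * ∑ k : Fin 3, (1 / (Bk α k : ℂ)) * Sp n (sk α n k) (-Complex.exp L) *
          Complex.exp (((k : ℕ) * α : ℝ) * L) := by
      rw [Finset.mul_sum]
      refine Finset.sum_congr rfl fun k _ => ?_
      have := hS n k (-Complex.exp L)
      rw [neg_neg] at this
      rw [this]; ring
    rw [h2, norm_mul] at h1
    refine le_of_mul_le_mul_left (h1.trans (le_of_eq ?_)) hKp
    ring
  constructor
  · apply transfer
    intro r hr hr1 η hη
    filter_upwards [pk_conv hα0 hα2 hb hr hr1 hη] with n hn ζ hζ
    have hz : ‖ζ‖ < 1 := hζ.trans_lt hr1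
    have := (hn ζ hζ).1
    rw [ratio_eq hα0 hα2 (hdeg n) (hK n) (hS n) hz 1, f0_zz f₀ hf₀_dom hf₀_pearson hf₀_0 hz, neg_mul, sub_neg_eq_add]
    exact this
  · apply transfer
    intro r hr hr1 η hη
    filter_upwards [pk_conv hα0 hα2 hb hr hr1 hη] with n hn ζ hζ
    have hz : ‖ζ‖ < 1 := hζ.trans_lt hr1
    have := (hn ζ hζ).2
    rw [ratio_eq hα0 hα2 (hdeg n) (hK n) (hS n) hz 0, f0_zz f₀ hf₀_dom hf₀_pearson hf₀_0 hz]
    exact this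
end

section
/- Let A = {a_1,…,a_p}, p ≥ 2, be distinct points, f ∈ 𝓛_A, A(z) = ∏_{j=1}^p (z − a_j), and B = A f'/f ∈ 𝒫_{p−2}. Let P_n, Q_n ∈ 𝒫_n, Q_n not identically zero, be Padé polynomials of order n for f, i.e. R_n(z) = Q_n(z) f(z) − P_n(z) = O(z^{−(n+1)}) as z → ∞. Then there exist polynomials H_n, C_n and a constant N (all depending on n), with H_n not identically zero and deg C_n − deg H_n ≤ p − 2, such that each of the three functions w = P_n, w = Q_n f, w = R_n satisfies A(z) H_n(z) w'' + [ (A'(z) − B(z)) H_n(z) − A(z) H_n'(z) ] w' − N C_n(z) w = 0 on every simply connected subdomain of ℂ∖A and for every holomorphic branch of f. If moreover the index n is normal (deg Q_n = n and z^{n+1} R_n(z) tends to a nonzero limit as z → ∞), then N = n(n+1), H_n is monic of degree p−2 and C_n is monic of degree 2p−4. -/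
open Polynomial Filter Asymptotics Bornology Topology

/-- The Wronskian polynomial. -/
noncomputable def wH (A B P Q : Polynomial ℂ) : Polynomial ℂ :=
  A * (P * derivative Q - derivative P * Q) + B * P * Q

/-- The zeroth-order coefficient. -/
noncomputable def wD (A B P Q : Polynomial ℂ) : Polynomial ℂ :=
  derivative P * (A ^ 2 * derivative (derivative Q) + 2 * A * B * derivative Q
    + Q * (derivative B * A - B * derivative A + B ^ 2))
  - derivative (derivative P) * (A ^ 2 * derivative Q + A * B * Q)

lemma ode_P (A B P Q : Polynomial ℂ) :
    A * wH A B P Q * derivative (derivative P)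
      + ((derivative A - B) * wH A B P Q - A * derivative (wH A B P Q)) * derivative P
      + wD A B P Q * P = 0 := by
  simp only [wH, wD, derivative_add, derivative_mul, derivative_sub]
  ring

lemma ode_Q (A B P Q : Polynomial ℂ) (U : Set ℂ) (hU : IsOpen U)
    (hA : ∀ z ∈ U, A.eval z ≠ 0) (g : ℂ → ℂ) (hg : DifferentiableOn ℂ g U)
    (hgd : ∀ z ∈ U, A.eval z * deriv g z = B.eval z * g z) (z : ℂ) (hz : z ∈ U) :
    ∃ d e : ℂ, (∀ᶠ y in 𝓝 z, HasDerivAt (fun z => Q.eval z * g z)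
        (((A * derivative Q + Q * B).eval y / A.eval y) * g y) y) ∧
      ((A * derivative Q + Q * B).eval z / A.eval z) * g z = d ∧
      HasDerivAt (fun y => ((A * derivative Q + Q * B).eval y / A.eval y) * g y) e z ∧
      A.eval z * (wH A B P Q).eval z * e
      + ((derivative A - B) * wH A B P Q - A * derivative (wH A B P Q)).eval z * d
      + (wD A B P Q).eval z * (Q.eval z * g z) = 0 := by
  have hgder : ∀ y ∈ U, HasDerivAt g (B.eval y / A.eval y * g y) y := by
    intro y hy
    have h1 := (hg.differentiableAt (hU.mem_nhds hy)).hasDerivAt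
    have h2 : deriv g y = B.eval y / A.eval y * g y := by
      have := hgd y hy
      have := hA y hy
      field_simp
      linear_combination hgd y hy
    rwa [h2] at h1
  have hz0 := hA z hz
  refine ⟨_, _, ?_, rfl, (((A * derivative Q + Q * B).hasDerivAt z).div (A.hasDerivAt z) hz0).mul (hgder z hz), ?_⟩
  · filter_upwards [hU.mem_nhds hz] with y hy
    have hy0 := hA y hy
    refine ((Q.hasDerivAt y).fun_mul (hgder y hy)).congr_deriv ?_
    simp only [eval_add, eval_mul]
    field_simp
  · simp only [wH, wD, derivative_add, derivative_mul, derivative_sub, eval_add, eval_mul, eval_sub, eval_pow, eval_ofNat, Pi.div_apply]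
    field_simp
    ring

lemma X_deriv (P : Polynomial ℂ) (n : ℕ) (h : P.natDegree ≤ n) :
    (X * derivative P).natDegree ≤ n ∧ (X * derivative P).coeff n = n * P.coeff n := by
  constructor
  · rw [natDegree_le_iff_coeff_eq_zero] at h ⊢
    intro N hN
    obtain ⟨k, rfl⟩ : ∃ k, N = k + 1 := ⟨N - 1, by omega⟩
    rw [coeff_X_mul, coeff_derivative, h _ hN, zero_mul]
  · cases n with
    | zero => simp
    | succ k => rw [coeff_X_mul, coeff_derivative]; push_cast; ring

lemma X_deriv2 (P : Polynomial ℂ) (n : ℕ) (h : P.natDegree ≤ n) :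
    (X ^ 2 * derivative (derivative P)).natDegree ≤ n ∧
      (X ^ 2 * derivative (derivative P)).coeff n = n * (n - 1) * P.coeff n := by
  have h1 := X_deriv P n h
  have h2 := X_deriv _ n h1.1
  have e : X ^ 2 * derivative (derivative P) =
      X * derivative (X * derivative P) - X * derivative P := by
    simp only [derivative_mul, derivative_X]; ring
  rw [e]
  refine ⟨natDegree_sub_le_of_le h2.1 h1.1 |>.trans (by simp), ?_⟩
  rw [coeff_sub, h2.2, h1.2]; ring

lemma deg_aux (A B H D P : Polynomial ℂ) (p h n : ℕ) (hA : A.natDegree ≤ p)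
    (hB : (X * B).natDegree ≤ p) (hH : H.natDegree ≤ h) (hP : P.natDegree ≤ n)
    (hB0 : (X * B).coeff p = 0)
    (hode : A * H * derivative (derivative P)
      + ((derivative A - B) * H - A * derivative H) * derivative P + D * P = 0) :
    (X ^ 2 * (D * P)).natDegree ≤ p + h + n ∧
    (X ^ 2 * (D * P)).coeff (p + h + n) =
      - (A.coeff p * H.coeff h * P.coeff n * (n * (n - 1) + (p - h) * n)) := by
  have e : X ^ 2 * (D * P) = - (A * H * (X ^ 2 * derivative (derivative P))
      + ((X * derivative A - X * B) * H - A * (X * derivative H)) * (X * derivative P)) := by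
    linear_combination X ^ 2 * hode
  have a1 := X_deriv A p hA
  have h1 := X_deriv H h hH
  have p1 := X_deriv P n hP
  have p2 := X_deriv2 P n hP
  have d1 : (A * H).natDegree ≤ p + h := natDegree_mul_le_of_le hA hH
  have d2 : (X * derivative A - X * B).natDegree ≤ p :=
    (natDegree_sub_le_of_le a1.1 hB).trans (by simp)
  have d3 : ((X * derivative A - X * B) * H).natDegree ≤ p + h := natDegree_mul_le_of_le d2 hH
  have d4 : (A * (X * derivative H)).natDegree ≤ p + h := natDegree_mul_le_of_le hA h1.1
  have d5 : ((X * derivative A - X * B) * H - A * (X * derivative H)).natDegree ≤ p + h :=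
    (natDegree_sub_le_of_le d3 d4).trans (by simp)
  rw [e]
  constructor
  · rw [natDegree_neg]
    exact (natDegree_add_le_of_le (natDegree_mul_le_of_le d1 p2.1)
      (natDegree_mul_le_of_le d5 p1.1)).trans (by simp)
  · rw [coeff_neg, coeff_add, coeff_mul_add_eq_of_natDegree_le d1 p2.1,
      coeff_mul_add_eq_of_natDegree_le d5 p1.1, coeff_mul_add_eq_of_natDegree_le hA hH, coeff_sub,
      coeff_mul_add_eq_of_natDegree_le d2 hH, coeff_mul_add_eq_of_natDegree_le hA h1.1, coeff_sub, hB0,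
      a1.2, h1.2, p1.2, p2.2]
    ring

lemma H_ne (A1 A B E P Q : Polynomial ℂ) (a c : ℂ) (hc : ∀ m : ℤ, c ≠ (m : ℂ))
    (hA : A = (X - C a) * A1) (hA1 : A1.eval a ≠ 0) (hB : B = C c * A1 + (X - C a) * E)
    (hP : P ≠ 0) (hQ : Q ≠ 0) : wH A B P Q ≠ 0 := by
  intro hH
  obtain ⟨P1, hP1, hP0⟩ := exists_eq_pow_rootMultiplicity_mul_and_not_dvd P hP a
  obtain ⟨Q1, hQ1, hQ0⟩ := exists_eq_pow_rootMultiplicity_mul_and_not_dvd Q hQ a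
  generalize rootMultiplicity a P = m at *
  generalize rootMultiplicity a Q = l at *
  rw [dvd_iff_isRoot, IsRoot.def] at hP0 hQ0
  have key : ∀ (m : ℕ) (P1 : Polynomial ℂ), (X - C a) * derivative ((X - C a) ^ m * P1) =
      (X - C a) ^ m * ((m : Polynomial ℂ) * P1 + (X - C a) * derivative P1) := by
    intro m P1
    rw [derivative_mul, derivative_X_sub_C_pow]
    cases m with
    | zero => simp
    | succ k => simp only [Nat.add_sub_cancel, map_natCast]; ring
  have kP := key m P1
  have kQ := key l Q1
  rw [← hP1] at kP
  rw [← hQ1] at kQ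
  have : (X - C a) ^ (m + l) * (A1 * (P1 * ((l : Polynomial ℂ) * Q1 + (X - C a) * derivative Q1)
      - Q1 * ((m : Polynomial ℂ) * P1 + (X - C a) * derivative P1))
      + B * P1 * Q1) = 0 := by
    rw [← hH, wH, hA]
    have : (X - C a) * A1 * (P * derivative Q - derivative P * Q) + B * P * Q =
      A1 * (P * ((X - C a) * derivative Q) - ((X - C a) * derivative P) * Q) + B * P * Q := by ring
    rw [this, kP, kQ, hP1, hQ1]
    ring
  have h2 := (mul_eq_zero.mp this).resolve_left (pow_ne_zero _ (X_sub_C_ne_zero a))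
  have h3 := congrArg (eval a) h2
  rw [hB] at h3
  simp only [eval_add, eval_mul, eval_sub, eval_X, eval_C, eval_natCast, eval_zero, sub_self,
    zero_mul, add_zero] at h3
  have h4 : (A1.eval a * P1.eval a * Q1.eval a) * (l - m + c) = 0 := by linear_combination h3
  have h5 := (mul_eq_zero.mp h4).resolve_left (mul_ne_zero (mul_ne_zero hA1 hP0) hQ0)
  refine hc ((m : ℤ) - l) ?_
  push_cast
  linear_combination h5

lemma inv_pow_tendsto (k : ℕ) (hk : k ≠ 0) :
    Tendsto (fun z : ℂ => (z ^ k)⁻¹) (cobounded ℂ) (𝓝 0) := by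
  have h := (tendsto_inv₀_cobounded (α := ℂ)).pow k
  simpa [hk] using h

lemma eventually_ne : ∀ᶠ z : ℂ in cobounded ℂ, z ≠ 0 := by
  filter_upwards [tendsto_norm_cobounded_atTop.eventually (eventually_gt_atTop (0 : ℝ))] with z hz
  exact norm_pos_iff.mp hz

lemma eval_tendsto (P : Polynomial ℂ) (k : ℕ) (h : P.natDegree ≤ k) :
    Tendsto (fun z : ℂ => P.eval z / z ^ k) (cobounded ℂ) (𝓝 (P.coeff k)) := by
  have h1 : Tendsto (fun z : ℂ => (∑ i ∈ Finset.range k, P.coeff i * (z ^ (k - i))⁻¹) + P.coeff k)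
      (cobounded ℂ) (𝓝 ((∑ i ∈ Finset.range k, P.coeff i * 0) + P.coeff k)) := by
    refine Tendsto.add (tendsto_finsetSum _ fun i hi => ?_) tendsto_const_nhds
    exact (inv_pow_tendsto (k - i) (by have := Finset.mem_range.mp hi; omega)).const_mul _
  simp only [mul_zero, Finset.sum_const_zero, zero_add] at h1
  refine h1.congr' ?_
  filter_upwards [eventually_ne] with z hz
  rw [eval_eq_sum_range' (Nat.lt_succ_of_le h), Finset.sum_range_succ, add_div, Finset.sum_div]
  congr 1
  · refine Finset.sum_congr rfl fun i hi => ?_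
    have hi := Finset.mem_range.mp hi
    have : z ^ k = z ^ (k - i) * z ^ i := by rw [← pow_add]; congr 1; omega
    rw [this]
    field_simp
  · field_simp

lemma natDegree_of_tendsto (P : Polynomial ℂ) (k : ℕ) (c : ℂ)
    (h : Tendsto (fun z : ℂ => P.eval z / z ^ k) (cobounded ℂ) (𝓝 c)) :
    P.natDegree ≤ k ∧ P.coeff k = c := by
  have hk : P.natDegree ≤ k := by
    by_contra! hk
    have h1 := eval_tendsto P _ le_rfl
    have h2 := h.mul (inv_pow_tendsto (P.natDegree - k) (by omega))
    rw [mul_zero] at h2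
    have h3 : Tendsto (fun z : ℂ => P.eval z / z ^ P.natDegree) (cobounded ℂ) (𝓝 0) := by
      refine h2.congr' ?_
      filter_upwards [eventually_ne] with z hz
      have : z ^ P.natDegree = z ^ k * z ^ (P.natDegree - k) := by
        rw [← pow_add]; congr 1; omega
      rw [this]
      field_simp
    have h4 := tendsto_nhds_unique h1 h3
    rw [coeff_natDegree, leadingCoeff_eq_zero] at h4
    simp [h4] at hk
  exact ⟨hk, tendsto_nhds_unique (eval_tendsto P k hk) h⟩

lemma cauchy_inf (g : ℂ → ℂ) (R₀ : ℝ) (hg : DifferentiableOn ℂ g {z : ℂ | R₀ < ‖z‖}) (M : ℂ)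
    (h : Tendsto g (cobounded ℂ) (𝓝 M)) :
    Tendsto (fun z => z * deriv g z) (cobounded ℂ) (𝓝 0) := by
  rw [Metric.tendsto_nhds]
  intro ε hε
  have h1 := (Metric.tendsto_nhds.mp h) (ε / 4) (by positivity)
  rw [← comap_norm_atTop] at h1
  obtain ⟨r, hr⟩ := (eventually_comap.mp h1 |> eventually_atTop.mp)
  filter_upwards [tendsto_norm_cobounded_atTop.eventually
    (eventually_gt_atTop (max 0 (2 * (max r R₀))))] with z hz
  have hz0 : 0 < ‖z‖ := lt_of_le_of_lt (le_max_left _ _) hz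
  have hz1 : 2 * max r R₀ < ‖z‖ := lt_of_le_of_lt (le_max_right _ _) hz
  have hr1 := le_max_left r R₀
  have hr2 := le_max_right r R₀
  have hb : ∀ y ∈ Metric.closedBall z (‖z‖ / 2), max r R₀ < ‖y‖ := by
    intro y hy
    rw [mem_closedBall_iff_norm] at hy
    have := norm_sub_norm_le z y
    rw [norm_sub_rev] at this
    linarith
  have hd : DifferentiableOn ℂ (fun y => g y - M) (Metric.closedBall z (‖z‖ / 2)) :=
    (hg.mono fun y hy => lt_of_le_of_lt hr2 (hb y hy)).sub_const _
  have h2 := Complex.norm_deriv_le_of_forall_mem_sphere_norm_le (c := z) (R := ‖z‖ / 2)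
    (C := ε / 4) (by positivity) (hd.diffContOnCl_ball le_rfl) (fun y hy => by
      have := hr ‖y‖ (hr1.trans (hb y (Metric.sphere_subset_closedBall hy)).le) y rfl
      rw [dist_eq_norm] at this
      exact this.le)
  rw [deriv_sub_const] at h2
  rw [dist_zero_right, norm_mul]
  calc ‖z‖ * ‖deriv g z‖ ≤ ‖z‖ * (ε / 4 / (‖z‖ / 2)) := by gcongr
    _ = ε / 2 := by field_simp; norm_num
    _ < ε := by linarith

/-- Laguerre/Nuttall: Let `f ∈ 𝓛_A` with distinct branch points
`a₁, …, a_p` (`p ≥ 2`), `A = ∏ (X − a_j)`, `B = A f'/f = Σ_j α_j ∏_{i≠j} (X − a_i)`, and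
let `P_n, Q_n ∈ 𝒫_n`, `Q_n ≠ 0`, be Padé polynomials of order `n` for `f`, i.e.
`R_n = Q_n f − P_n = O(z^{−(n+1)})` at `∞`.  Then there are polynomials `H_n, C_n` and a
constant `N` with `H_n ≠ 0`, `deg C_n − deg H_n ≤ p−2`, such that each of `w = P_n`,
`w = Q_n f`, `w = R_n` satisfies `A H_n w'' + [(A'−B)H_n − A H_n'] w' − N C_n w = 0` on
every simply connected subdomain of `ℂ∖A` for every holomorphic branch `g` of `f`
(a nonvanishing holomorphic solution of `A g' = B g`).  If moreover `n` is normal, then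
`N = n(n+1)`, `H_n` is monic of degree `p−2` and `C_n` is monic of degree `2p−4`. -/
theorem stmt_8 (p : ℕ) (hp : 2 ≤ p) (a : Fin p → ℂ) (ha : Function.Injective a)
    (α : Fin p → ℂ) (hα : ∀ j, ∀ m : ℤ, α j ≠ (m : ℂ)) (hsum : ∑ j, α j = 0)
    (A B : Polynomial ℂ)
    (hA : A = ∏ j, (X - C (a j)))
    (hB : B = ∑ j, C (α j) * ∏ i ∈ Finset.univ.erase j, (X - C (a i)))
    (f : ℂ → ℂ) (R₀ : ℝ) (hR : ∀ j, ‖a j‖ < R₀)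
    (hfd : DifferentiableOn ℂ f {z : ℂ | R₀ < ‖z‖})
    (hf1 : Tendsto f (cobounded ℂ) (𝓝 1))
    (hfp : ∀ z ∈ {z : ℂ | R₀ < ‖z‖}, A.eval z * deriv f z = B.eval z * f z)
    (n : ℕ) (P Q : Polynomial ℂ) (hQ : Q ≠ 0)
    (hdegP : P.natDegree ≤ n) (hdegQ : Q.natDegree ≤ n)
    (hPade : (fun z : ℂ => Q.eval z * f z - P.eval z)
      =O[cobounded ℂ] fun z => (z ^ (n + 1))⁻¹) :
    ∃ (Hn Cn : Polynomial ℂ) (N : ℂ), Hn ≠ 0 ∧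
      Cn.natDegree ≤ Hn.natDegree + (p - 2) ∧
      (∀ U : Set ℂ, IsOpen U → SimplyConnectedSpace ↥U → U ⊆ {z : ℂ | ∀ j, z ≠ a j} →
        ∀ g : ℂ → ℂ, DifferentiableOn ℂ g U → (∀ z ∈ U, g z ≠ 0) →
          (∀ z ∈ U, A.eval z * deriv g z = B.eval z * g z) →
          ∀ w : ℂ → ℂ,
            ((w = fun z => P.eval z) ∨ (w = fun z => Q.eval z * g z) ∨
              (w = fun z => Q.eval z * g z - P.eval z)) →
            ∀ z ∈ U,
              A.eval z * Hn.eval z * iteratedDeriv 2 w z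
                + (((A.derivative - B) * Hn).eval z - (A * Hn.derivative).eval z) * deriv w z
                - N * Cn.eval z * w z = 0) ∧
      ((Q.natDegree = n ∧ ∃ M : ℂ, M ≠ 0 ∧
          Tendsto (fun z : ℂ => z ^ (n + 1) * (Q.eval z * f z - P.eval z))
            (cobounded ℂ) (𝓝 M)) →
        (N = (n : ℂ) * ((n : ℂ) + 1) ∧ Hn.Monic ∧ Hn.natDegree = p - 2 ∧
          Cn.Monic ∧ Cn.natDegree = 2 * p - 4)) := by
  have hAm : A.Monic := by rw [hA]; exact monic_prod_X_sub_C _ _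
  have hAd : A.natDegree = p := by rw [hA, natDegree_prod_of_monic _ _ (fun i _ => monic_X_sub_C _)]; simp
  have hAp : A.coeff p = 1 := by rw [← hAd]; exact hAm
  have hprod : ∀ j : Fin p, (∏ i ∈ Finset.univ.erase j, (X - C (a i))).natDegree = p - 1 ∧
      (∏ i ∈ Finset.univ.erase j, (X - C (a i))).coeff (p - 1) = 1 := by
    intro j
    have hm : (∏ i ∈ Finset.univ.erase j, (X - C (a i))).Monic := monic_prod_X_sub_C _ _
    have hd : (∏ i ∈ Finset.univ.erase j, (X - C (a i))).natDegree = p - 1 := by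
      rw [natDegree_prod_of_monic _ _ (fun i _ => monic_X_sub_C _)]; simp
    exact ⟨hd, by rw [← hd]; exact hm⟩
  have hBd : B.natDegree ≤ p - 1 := by
    rw [hB]
    refine natDegree_sum_le_of_forall_le _ _ fun j _ => ?_
    exact (natDegree_C_mul_le _ _).trans (hprod j).1.le
  have hBc : B.coeff (p - 1) = 0 := by
    rw [hB, finsetSum_coeff, ← hsum]
    refine Finset.sum_congr rfl fun j _ => ?_
    rw [coeff_C_mul, (hprod j).2, mul_one]
  have hXB : (X * B).natDegree ≤ p := by
    refine (natDegree_mul_le_of_le natDegree_X_le hBd).trans (by omega)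
  have hXBc : (X * B).coeff p = 0 := by
    obtain ⟨k, rfl⟩ : ∃ k, p = k + 1 := ⟨p - 1, by omega⟩
    rw [coeff_X_mul]; simpa using hBc
  have hR0 : Tendsto (fun z : ℂ => Q.eval z * f z - P.eval z) (cobounded ℂ) (𝓝 0) :=
    hPade.trans_tendsto (inv_pow_tendsto (n + 1) (by omega))
  have hR0' : ∀ k : ℕ, Tendsto (fun z : ℂ => (Q.eval z * f z - P.eval z) / z ^ k)
      (cobounded ℂ) (𝓝 0) := by
    intro k
    rcases Nat.eq_zero_or_pos k with rfl | hk
    · simpa using hR0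
    · simpa [div_eq_mul_inv] using hR0.mul (inv_pow_tendsto k (by omega))
  have hPc : ∀ k, Q.natDegree ≤ k →
      Tendsto (fun z : ℂ => P.eval z / z ^ k) (cobounded ℂ) (𝓝 (Q.coeff k)) := by
    intro k hk
    have h1 := ((eval_tendsto Q k hk).mul hf1).sub (hR0' k)
    rw [mul_one, sub_zero] at h1
    refine h1.congr fun z => ?_
    ring
  have hP : P ≠ 0 := by
    rintro rfl
    have h1 := tendsto_nhds_unique (hPc _ le_rfl) (eval_tendsto 0 _ (by simp))
    rw [coeff_natDegree, coeff_zero, leadingCoeff_eq_zero] at h1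
    exact hQ h1
  have hH : wH A B P Q ≠ 0 := by
    let j : Fin p := ⟨0, by omega⟩
    refine H_ne (∏ i ∈ Finset.univ.erase j, (X - C (a i))) A B
      (∑ k ∈ Finset.univ.erase j, C (α k) * ∏ i ∈ (Finset.univ.erase k).erase j, (X - C (a i)))
      P Q (a j) (α j) (hα j) ?_ ?_ ?_ hP hQ
    · rw [hA, Finset.mul_prod_erase Finset.univ (fun i => X - C (a i)) (Finset.mem_univ j)]
    · rw [eval_prod, Finset.prod_ne_zero_iff]
      intro i hi
      simp only [eval_sub, eval_X, eval_C]
      rw [sub_ne_zero]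
      exact fun h => (Finset.ne_of_mem_erase hi) (ha h).symm
    · rw [hB, ← Finset.add_sum_erase _ _ (Finset.mem_univ j), Finset.mul_sum]
      congr 1
      refine Finset.sum_congr rfl fun k hk => ?_
      rw [← Finset.mul_prod_erase (Finset.univ.erase k) (fun i => X - C (a i))
        (Finset.mem_erase.mpr ⟨(Finset.ne_of_mem_erase hk).symm, Finset.mem_univ j⟩)]
      ring
  have hODE : ∀ (c : ℂ) (Hn Cn : Polynomial ℂ) (N : ℂ), Hn = C c * wH A B P Q →
      C N * Cn = - (C c * wD A B P Q) →
      (∀ U : Set ℂ, IsOpen U → SimplyConnectedSpace ↥U → U ⊆ {z : ℂ | ∀ j, z ≠ a j} →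
        ∀ g : ℂ → ℂ, DifferentiableOn ℂ g U → (∀ z ∈ U, g z ≠ 0) →
          (∀ z ∈ U, A.eval z * deriv g z = B.eval z * g z) →
          ∀ w : ℂ → ℂ,
            ((w = fun z => P.eval z) ∨ (w = fun z => Q.eval z * g z) ∨
              (w = fun z => Q.eval z * g z - P.eval z)) →
            ∀ z ∈ U,
              A.eval z * Hn.eval z * iteratedDeriv 2 w z
                + (((A.derivative - B) * Hn).eval z - (A * Hn.derivative).eval z) * deriv w z
                - N * Cn.eval z * w z = 0) := by
    intro c Hn Cn N hHn hCn U hU _ hUa g hg _ hgd w hw z hz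
    have hA0 : ∀ z ∈ U, A.eval z ≠ 0 := by
      intro z hz
      rw [hA, eval_prod, Finset.prod_ne_zero_iff]
      intro i _
      simpa [sub_ne_zero] using hUa hz i
    obtain ⟨d, e, h1, h2, h3, h4⟩ := ode_Q A B P Q U hU hA0 g hg hgd z hz
    have hp4 := congrArg (eval z) (ode_P A B P Q)
    have hCev := congrArg (eval z) hCn
    subst hHn
    simp only [eval_add, eval_sub, eval_mul, eval_neg, eval_C, eval_zero, derivative_mul,
      derivative_C, zero_mul, zero_add] at hp4 h4 hCev ⊢
    have it2 : ∀ w : ℂ → ℂ, iteratedDeriv 2 w = deriv (deriv w) := by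
      intro w; rw [iteratedDeriv_succ, iteratedDeriv_one]
    rw [it2]
    have hPd : deriv (fun z => P.eval z) = fun z => (derivative P).eval z := by
      funext y; exact P.deriv
    have hPdd : deriv (fun z => (derivative P).eval z) z = (derivative (derivative P)).eval z :=
      (derivative P).deriv
    have hQd : deriv (fun z => Q.eval z * g z) =ᶠ[𝓝 z]
        fun y => ((A * derivative Q + Q * B).eval y / A.eval y) * g y := by
      filter_upwards [h1] with y hy using hy.deriv
    rcases hw with rfl | rfl | rfl
    · rw [hPd, hPdd]
      linear_combination c * hp4 - P.eval z * hCev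
    · rw [hQd.deriv_eq, hQd.eq_of_nhds, h3.deriv, h2]
      linear_combination c * h4 - (Q.eval z * g z) * hCev
    · have hRd : deriv (fun z => Q.eval z * g z - P.eval z) =ᶠ[𝓝 z]
          fun y => ((A * derivative Q + Q * B).eval y / A.eval y) * g y
            - (derivative P).eval y := by
        filter_upwards [h1] with y hy using (hy.fun_sub (P.hasDerivAt y)).deriv
      rw [hRd.deriv_eq, hRd.eq_of_nhds, (h3.fun_sub ((derivative P).hasDerivAt z)).deriv, h2]
      linear_combination c * h4 - c * hp4 - (Q.eval z * g z - P.eval z) * hCev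
  have hDdeg : (wD A B P Q).natDegree ≤ (wH A B P Q).natDegree + (p - 2) := by
    have h1 := (deg_aux A B _ _ P p _ _ hAd.le hXB le_rfl le_rfl hXBc (ode_P A B P Q)).1
    by_cases hD : wD A B P Q = 0
    · rw [hD]; simp
    · rw [natDegree_mul (pow_ne_zero _ X_ne_zero) (mul_ne_zero hD hP), natDegree_mul hD hP,
        natDegree_X_pow] at h1
      omega
  by_cases hn : Q.natDegree = n ∧ ∃ M : ℂ, M ≠ 0 ∧
          Tendsto (fun z : ℂ => z ^ (n + 1) * (Q.eval z * f z - P.eval z))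
            (cobounded ℂ) (𝓝 M)
  swap
  · refine ⟨wH A B P Q, wD A B P Q, -1, hH, hDdeg, hODE 1 _ _ _ (by simp) (by simp), fun h => absurd h hn⟩
  obtain ⟨hQn, M, hM, hlim⟩ := hn
  have hq : Q.coeff n ≠ 0 := by rw [← hQn, coeff_natDegree]; exact leadingCoeff_ne_zero.mpr hQ
  have hPn : P.coeff n ≠ 0 := by
    rw [tendsto_nhds_unique (eval_tendsto P n hdegP) (hPc n hdegQ)]; exact hq
  have hHlim : Tendsto (fun z : ℂ => (wH A B P Q).eval z / z ^ (p - 2)) (cobounded ℂ)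
      (𝓝 (-((2 * n + 1) * M * Q.coeff n))) := by
    have hS : IsOpen {z : ℂ | R₀ < ‖z‖} := isOpen_lt continuous_const continuous_norm
    have hev : ∀ᶠ z : ℂ in cobounded ℂ, R₀ < ‖z‖ :=
      tendsto_norm_cobounded_atTop.eventually (eventually_gt_atTop R₀)
    have hgd : DifferentiableOn ℂ (fun z : ℂ => z ^ (n + 1) * (Q.eval z * f z - P.eval z))
        {z : ℂ | R₀ < ‖z‖} := by
      refine (differentiableOn_pow _).fun_mul ?_
      exact (Q.differentiableOn.fun_mul hfd).fun_sub P.differentiableOn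
    have hz := cauchy_inf _ R₀ hgd M hlim
    have tA := eval_tendsto A p hAd.le
    have tQ := eval_tendsto Q n hdegQ
    have tQ' := eval_tendsto _ n (X_deriv Q n hdegQ).1
    have tB := eval_tendsto _ p hXB
    rw [hAp] at tA
    rw [hXBc] at tB
    rw [(X_deriv Q n hdegQ).2] at tQ'
    have tot := ((tA.mul tQ).mul (hz.sub (hlim.const_mul ((n : ℂ) + 1)))).sub
      (((tA.mul tQ').add (tB.mul tQ)).mul hlim)
    have e1 : 1 * Q.coeff n * (0 - ((n : ℂ) + 1) * M)
        - (1 * (n * Q.coeff n) + 0 * Q.coeff n) * M = -((2 * n + 1) * M * Q.coeff n) := by ring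
    rw [e1] at tot
    refine tot.congr' ?_
    filter_upwards [eventually_ne, hev] with z hz0 hzR
    have hfz := (hfd.differentiableAt (hS.mem_nhds hzR)).hasDerivAt
    have hder : deriv (fun z : ℂ => z ^ (n + 1) * (Q.eval z * f z - P.eval z)) z =
        (n + 1) * z ^ n * (Q.eval z * f z - P.eval z) + z ^ (n + 1) *
          ((derivative Q).eval z * f z + Q.eval z * deriv f z - (derivative P).eval z) := by
      have := (hasDerivAt_pow (n + 1) z).fun_mul
        (((Q.hasDerivAt z).fun_mul hfz).fun_sub (P.hasDerivAt z))
      rw [this.deriv]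
      push_cast
      simp
    rw [hder]
    have hfe := hfp z hzR
    have hpz : z ^ p = z ^ (p - 2) * z ^ 2 := by rw [← pow_add]; congr 1; omega
    rw [hpz]
    simp only [wH, eval_add, eval_mul, eval_sub, eval_X]
    field_simp
    linear_combination z ^ 2 * z ^ n * (Q.eval z) ^ 2 * hfe
  obtain ⟨hHd, hHc⟩ := natDegree_of_tendsto _ _ _ hHlim
  set c0 : ℂ := -((2 * n + 1) * M * Q.coeff n) with hc0
  have h21 : (2 * (n : ℂ) + 1) ≠ 0 := by exact_mod_cast (by omega : 2 * n + 1 ≠ 0)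
  have hc0n : c0 ≠ 0 := neg_ne_zero.mpr (mul_ne_zero (mul_ne_zero h21 hM) hq)
  have hHdeg : (wH A B P Q).natDegree = p - 2 :=
    le_antisymm hHd (le_natDegree_of_ne_zero (by rw [hHc]; exact hc0n))
  have hci : c0⁻¹ ≠ 0 := inv_ne_zero hc0n
  have hHnd : (C c0⁻¹ * wH A B P Q).natDegree = p - 2 := by
    rw [natDegree_C_mul hci, hHdeg]
  have hHm : (C c0⁻¹ * wH A B P Q).Monic := by
    rw [Monic, leadingCoeff, hHnd, coeff_C_mul, hHc, inv_mul_cancel₀ hc0n]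
  rcases Nat.eq_zero_or_pos n with rfl | hnpos
  · have hD0 : wD A B P Q = 0 := by
      rw [eq_C_of_natDegree_le_zero hdegP]; simp [wD]
    refine ⟨C c0⁻¹ * wH A B P Q, X ^ (2 * p - 4), 0, hHm.ne_zero, ?_,
      hODE c0⁻¹ _ _ _ rfl (by rw [hD0]; simp), fun _ => ⟨by simp, hHm, hHnd, monic_X_pow _, natDegree_X_pow _⟩⟩
    rw [hHnd, natDegree_X_pow]; omega
  · have hD2 : (wD A B P Q).natDegree ≤ 2 * p - 4 := by rw [hHdeg] at hDdeg; omega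
    have hDc := (deg_aux A B _ _ P p (p - 2) n hAd.le hXB hHd hdegP hXBc (ode_P A B P Q)).2
    have hidx : p + (p - 2) + n = ((2 * p - 4) + n) + 2 := by omega
    rw [hidx, coeff_X_pow_mul, coeff_mul_add_eq_of_natDegree_le hD2 hdegP, hAp, hHc,
      Nat.cast_sub hp] at hDc
    have hDc2 : (wD A B P Q).coeff (2 * p - 4) = - (c0 * (n * (n + 1))) := by
      apply mul_right_cancel₀ hPn
      rw [hDc]; push_cast; ring
    have hn0 : (n : ℂ) ≠ 0 := by exact_mod_cast hnpos.ne.symm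
    have hnn : (n : ℂ) * (n + 1) ≠ 0 := by exact_mod_cast (by positivity : n * (n + 1) ≠ 0)
    have hk : -(c0 * ((n : ℂ) * (n + 1)))⁻¹ ≠ 0 := neg_ne_zero.mpr (inv_ne_zero (mul_ne_zero hc0n hnn))
    have hCc : (C (-(c0 * ((n : ℂ) * (n + 1)))⁻¹) * wD A B P Q).coeff (2 * p - 4) = 1 := by
      rw [coeff_C_mul, hDc2]; field_simp
    have hCd : (C (-(c0 * ((n : ℂ) * (n + 1)))⁻¹) * wD A B P Q).natDegree = 2 * p - 4 :=
      le_antisymm ((natDegree_C_mul_le _ _).trans hD2)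
        (le_natDegree_of_ne_zero (by rw [hCc]; exact one_ne_zero))
    refine ⟨C c0⁻¹ * wH A B P Q, C (-(c0 * ((n : ℂ) * (n + 1)))⁻¹) * wD A B P Q,
      (n : ℂ) * (n + 1), hHm.ne_zero, ?_, hODE c0⁻¹ _ _ _ rfl ?_,
      fun _ => ⟨rfl, hHm, hHnd, ?_, hCd⟩⟩
    · rw [hHnd, hCd]; omega
    · rw [← mul_assoc, ← C_mul, ← neg_mul, ← C_neg]
      congr 2
      field_simp
    · rw [Monic, leadingCoeff, hCd, hCc]
end

section
/- Let z ∈ ℂ with z ≠ 1 and z ≠ −1, and let Y ∈ ℂ be any nonzero number with Y³ = (1+z)/(1−z). Then the number y = Y/(z+1) + 1/((z−1)Y) satisfies the cubic equation (z²−1)² y³ − 3(z²−1) y + 2z = 0. -/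
/-- If `z ≠ ±1` and `Y ≠ 0` satisfies `Y³ = (1+z)/(1−z)`, then
`y = Y/(z+1) + 1/((z−1)Y)` solves `(z²−1)² y³ − 3(z²−1) y + 2z = 0`. -/
theorem stmt_11 (z Y : ℂ) (hz1 : z ≠ 1) (hz2 : z ≠ -1) (hY : Y ≠ 0)
    (hY3 : Y ^ 3 = (1 + z) / (1 - z)) :
    (z ^ 2 - 1) ^ 2 * (Y / (z + 1) + 1 / ((z - 1) * Y)) ^ 3
      - 3 * (z ^ 2 - 1) * (Y / (z + 1) + 1 / ((z - 1) * Y)) + 2 * z = 0 := by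
  have hp : z + 1 ≠ 0 := fun h => hz2 (eq_neg_of_add_eq_zero_left h)
  have hq : z - 1 ≠ 0 := sub_ne_zero.mpr hz1
  have hq' : 1 - z ≠ 0 := sub_ne_zero.mpr (Ne.symm hz1)
  have hY4 : Y ^ 3 * (z - 1) = -(z + 1) := by
    rw [eq_div_iff hq'] at hY3
    linear_combination -hY3
  obtain ⟨a, ha⟩ : ∃ a, a = Y / (z + 1) := ⟨_, rfl⟩
  obtain ⟨b, hb⟩ : ∃ b, b = 1 / ((z - 1) * Y) := ⟨_, rfl⟩
  have hY0 : a * (z + 1) = Y := by rw [ha]; field_simp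
  have hb0 : b * ((z - 1) * Y) = 1 := by rw [hb]; field_simp
  have hab : a * b * (z + 1) * (z - 1) = 1 := by
    rw [← hY0] at hb0
    linear_combination hb0
  have ha3 : a ^ 3 * (z + 1) ^ 2 * (z - 1) = -1 := by
    rw [← hY0] at hY4
    apply mul_right_cancel₀ hp
    linear_combination hY4
  have hb3 : b ^ 3 * (z + 1) * (z - 1) ^ 2 = -1 := by
    have h : b ^ 3 * (z - 1) ^ 3 * Y ^ 3 = 1 := by
      rw [← mul_pow, ← mul_pow, mul_assoc, hb0, one_pow]
    linear_combination -h + b ^ 3 * (z - 1) ^ 2 * hY4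
  rw [← ha, ← hb]
  linear_combination (z - 1) * ha3 + (z + 1) * hb3 + 3 * (z + 1) * (z - 1) * (a + b) * hab
end
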